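/- Let G be a finitely generated group of polynomial growth. Then for every k ≥ 1 and every courteous probability measure μ on G, the dimension of HF_k(G,μ) is finite; moreover, for any two courteous probability measures μ and ν on G, dim HF_k(G,μ) = dim HF_k(G,ν). -/

import Mathlib

open Pointwise

noncomputable section

/-- Word norm with respect to a generating set `S`: the least `n` with `x ∈ Sⁿ`. -/
def wordNorm {G : Type*} [Group G] (S : Set G) (x : G) : ℕ :=
  sInf {n : ℕ | x ∈ S ^ n}

/-- A courteous probability measure on a finitely generated (discrete) group, given as a
`PMF`: symmetric, adapted, and with exponential tail with respect to the word norm of `S`. -/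
structure IsCourteousPMF {G : Type*} [Group G] (S : Set G) (p : PMF G) : Prop where
  symm : ∀ x : G, p x⁻¹ = p x
  adapted : Subgroup.closure p.support = ⊤
  tail : ∃ c > 0, ∀ t > 0,
    (∑' x : {x : G // t < (wordNorm S x : ℝ)}, p x) ≤ ENNReal.ofReal (Real.exp (-c * t))

/-- `HFd S p k`: `p`-harmonic functions of polynomial growth of degree at most `k` on a
discrete group. -/
def HFd {G : Type*} [Group G] (S : Set G) (p : PMF G) (k : ℕ) : Set (G → ℂ) :=
  {f | (∀ x : G, f x = ∑' s : G, (p s).toReal • f (x * s)) ∧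
    ∃ c > 0, ∀ x : G, ‖f x‖ ≤ c * (1 + (wordNorm S x : ℝ)) ^ k}

set_option linter.unusedSectionVars false

namespace PolyHarm

/-- A symmetric subadditive length function all of whose balls have polynomially bounded size. -/
structure IsPolyLength {G : Type*} [Group G] (ℓ : G → ℕ) (C d : ℕ) : Prop where
  one : ℓ 1 = 0
  mul : ∀ x y, ℓ (x * y) ≤ ℓ x + ℓ y
  inv : ∀ x, ℓ x⁻¹ = ℓ x
  finite : ∀ n, {x | ℓ x ≤ n}.Finite
  card : ∀ n, {x | ℓ x ≤ n}.ncard ≤ C * (n + 1) ^ d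

/-- Elements of length at most `n + 1` are obtained from elements of length at most `n` by
one unit step. -/
def IsGeodesicLength {G : Type*} [Group G] (ℓ : G → ℕ) : Prop :=
  ∀ x n, ℓ x ≤ n + 1 → ∃ y s, ℓ y ≤ n ∧ ℓ s ≤ 1 ∧ x = y * s

/-- A symmetric, adapted probability weight with exponentially decaying mass function. -/
structure IsCourteousWeight {G : Type*} [Group G] (ℓ : G → ℕ) (m : G → ℝ) : Prop where
  nonneg : ∀ x, 0 ≤ m x
  hasSum : HasSum m 1
  symm : ∀ x, m x⁻¹ = m x
  adapted : Subgroup.closure {x | m x ≠ 0} = ⊤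
  decay : ∃ C > 0, ∃ c > 0, ∀ x, m x ≤ C * Real.exp (-c * ℓ x)

/-- Polynomial growth of degree at most `k` with respect to `ℓ`. -/
def HasGrowth {G : Type*} (ℓ : G → ℕ) (k : ℕ) (f : G → ℂ) : Prop :=
  ∃ c > 0, ∀ x, ‖f x‖ ≤ c * (1 + (ℓ x : ℝ)) ^ k

/-- Harmonicity with respect to the right random walk with weight `m`. -/
def IsHarm {G : Type*} [Group G] (m : G → ℝ) (f : G → ℂ) : Prop :=
  ∀ x, f x = ∑' s, m s • f (x * s)

section Summability

variable {G : Type*} [Group G] {ℓ : G → ℕ} {C d : ℕ}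

lemma IsPolyLength.summable_rpow (hℓ : IsPolyLength ℓ C d) :
    Summable fun x => ((1 + (ℓ x : ℝ)) ^ (d + 2))⁻¹ := by
  have hs : Summable fun n : ℕ => (C : ℝ) * ((1 + (n : ℝ)) ^ 2)⁻¹ := by
    apply Summable.mul_left
    have := (summable_nat_add_iff 1).2 (Real.summable_nat_pow_inv.2 (by norm_num : 1 < 2))
    simpa [add_comm] using this
  refine summable_of_sum_le (c := ∑' n : ℕ, (C : ℝ) * ((1 + (n : ℝ)) ^ 2)⁻¹)
    (fun x => by positivity) fun F => ?_
  have h1 : ∑ x ∈ F, ((1 + (ℓ x : ℝ)) ^ (d + 2))⁻¹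
      = ∑ n ∈ F.image ℓ, ∑ x ∈ F with ℓ x = n, ((1 + (ℓ x : ℝ)) ^ (d + 2))⁻¹ := by
    rw [Finset.sum_fiberwise_of_maps_to]
    intro x hx; exact Finset.mem_image_of_mem _ hx
  rw [h1]
  refine le_trans (Finset.sum_le_sum fun n _ => ?_)
    (hs.sum_le_tsum (F.image ℓ) (fun n _ => by positivity))
  have h2 : ∀ x ∈ F.filter (fun x => ℓ x = n), ((1 + (ℓ x : ℝ)) ^ (d + 2))⁻¹
      = ((1 + (n : ℝ)) ^ (d + 2))⁻¹ := by
    intro x hx; rw [(Finset.mem_filter.1 hx).2]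
  rw [Finset.sum_congr rfl h2, Finset.sum_const, nsmul_eq_mul]
  have h3 : ((F.filter (fun x => ℓ x = n)).card : ℝ) ≤ C * (1 + (n : ℝ)) ^ d := by
    have : (F.filter (fun x => ℓ x = n)).card ≤ {x | ℓ x ≤ n}.ncard := by
      rw [← Set.ncard_coe_finset]
      refine Set.ncard_le_ncard (fun x hx => ?_) (hℓ.finite n)
      simp at hx; exact hx.2.le
    have := this.trans (hℓ.card n)
    rw [add_comm]; exact_mod_cast this
  calc _ ≤ C * (1 + (n : ℝ)) ^ d * ((1 + (n : ℝ)) ^ (d + 2))⁻¹ := by gcongr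
    _ = _ := by field_simp; ring

lemma one_add_pow_le_exp (p n : ℕ) {R : ℝ} (hR : 1 ≤ R) :
    (1 + (n : ℝ)) ^ p ≤ p.factorial * Real.exp 1 * R ^ p * Real.exp (n / R) := by
  have hR0 : 0 < R := by linarith
  have h := Real.pow_div_factorial_le_exp ((1 + (n : ℝ)) / R) (by positivity) p
  rw [div_le_iff₀ (by positivity), div_pow, div_le_iff₀ (by positivity)] at h
  refine h.trans ?_
  have : Real.exp ((1 + (n : ℝ)) / R) ≤ Real.exp 1 * Real.exp (n / R) := by
    rw [← Real.exp_add]; gcongr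
    rw [add_div]; gcongr; rw [div_le_one hR0]; exact hR
  calc _ ≤ Real.exp 1 * Real.exp (n / R) * p.factorial * R ^ p := by gcongr
    _ = _ := by ring

lemma IsPolyLength.weight_bound (hℓ : IsPolyLength ℓ C d) (p : ℕ) :
    ∃ A > 0, ∀ R : ℝ, 1 ≤ R →
      Summable (fun x => Real.exp (-(ℓ x : ℝ) / R) * (1 + (ℓ x : ℝ)) ^ p) ∧
      ∑' x, Real.exp (-(ℓ x : ℝ) / R) * (1 + (ℓ x : ℝ)) ^ p ≤ A * R ^ (p + d + 2) := by
  set K : ℝ := (p + d + 2).factorial * Real.exp 1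
  have hK : 0 < K := by positivity
  have hs := hℓ.summable_rpow
  set T := ∑' x, ((1 + (ℓ x : ℝ)) ^ (d + 2))⁻¹
  have hT : 0 ≤ T := tsum_nonneg fun x => by positivity
  refine ⟨K * (T + 1), by positivity, fun R hR => ?_⟩
  have hR0 : 0 < R := by linarith
  have hb : ∀ x, Real.exp (-(ℓ x : ℝ) / R) * (1 + (ℓ x : ℝ)) ^ p
      ≤ K * R ^ (p + d + 2) * ((1 + (ℓ x : ℝ)) ^ (d + 2))⁻¹ := by
    intro x
    have h := one_add_pow_le_exp (p + d + 2) (ℓ x) hR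
    rw [← div_eq_mul_inv, le_div_iff₀ (by positivity), mul_assoc, ← pow_add, ← add_assoc]
    calc _ ≤ Real.exp (-(ℓ x : ℝ) / R) * (K * R ^ (p + d + 2) * Real.exp (ℓ x / R)) := by gcongr
      _ = K * R ^ (p + d + 2) * (Real.exp (-(ℓ x : ℝ) / R) * Real.exp (ℓ x / R)) := by ring
      _ = _ := by rw [← Real.exp_add]; simp [neg_div]
  have hsum := Summable.of_nonneg_of_le (fun x => by positivity) hb (hs.mul_left _)
  refine ⟨hsum, (hsum.tsum_le_tsum hb (hs.mul_left _)).trans ?_⟩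
  rw [tsum_mul_left]
  have : 0 < R ^ (p + d + 2) := by positivity
  nlinarith [mul_pos hK this]

lemma IsPolyLength.summable_exp (hℓ : IsPolyLength ℓ C d) (p : ℕ) {c : ℝ} (hc : 0 < c) :
    Summable (fun x => Real.exp (-c * ℓ x) * (1 + (ℓ x : ℝ)) ^ p) := by
  obtain ⟨A, -, hA⟩ := hℓ.weight_bound p
  have h := (hA (max 1 c⁻¹) (le_max_left _ _)).1
  refine Summable.of_nonneg_of_le (fun x => by positivity) (fun x => ?_) h
  gcongr
  rw [neg_mul, neg_div, neg_le_neg_iff, div_le_iff₀ (by positivity)]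
  have : 1 ≤ c * max 1 c⁻¹ := by
    calc (1 : ℝ) = c * c⁻¹ := by field_simp
      _ ≤ _ := by gcongr; exact le_max_right _ _
  have h0 : (0 : ℝ) ≤ ℓ x := by positivity
  nlinarith

/-- Exponential moments of a courteous weight. -/
lemma IsCourteousWeight.exp_moment {m : G → ℝ} (hℓ : IsPolyLength ℓ C d)
    (hm : IsCourteousWeight ℓ m) :
    ∃ a > 0, ∀ p : ℕ, Summable (fun s => m s * (Real.exp (a * ℓ s) * (1 + (ℓ s : ℝ)) ^ p)) := by
  obtain ⟨A, hA, c, hc, h⟩ := hm.decay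
  refine ⟨c / 2, by positivity, fun p => ?_⟩
  refine Summable.of_nonneg_of_le (fun x => mul_nonneg (hm.nonneg x) (by positivity))
    (fun x => ?_) ((hℓ.summable_exp p (half_pos hc)).mul_left A)
  calc _ ≤ (A * Real.exp (-c * ℓ x)) * (Real.exp (c / 2 * ℓ x) * (1 + (ℓ x : ℝ)) ^ p) := by
        gcongr; exact h x
    _ = A * ((Real.exp (-c * ℓ x) * Real.exp (c / 2 * ℓ x)) * (1 + (ℓ x : ℝ)) ^ p) := by ring
    _ = _ := by rw [← Real.exp_add]; ring_nf

lemma IsCourteousWeight.summable_pow {m : G → ℝ} (hℓ : IsPolyLength ℓ C d)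
    (hm : IsCourteousWeight ℓ m) (p : ℕ) : Summable (fun s => m s * (1 + (ℓ s : ℝ)) ^ p) := by
  obtain ⟨a, ha, h⟩ := hm.exp_moment hℓ
  refine Summable.of_nonneg_of_le (fun x => mul_nonneg (hm.nonneg x) (by positivity))
    (fun x => ?_) (h p)
  refine mul_le_mul_of_nonneg_left ?_ (hm.nonneg x)
  have : 1 ≤ Real.exp (a * ℓ x) := Real.one_le_exp (by positivity)
  exact le_mul_of_one_le_left (by positivity) this

lemma IsPolyLength.one_add_mul_le (hℓ : IsPolyLength ℓ C d) (x s : G) :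
    1 + (ℓ (x * s) : ℝ) ≤ (1 + ℓ x) * (1 + ℓ s) := by
  have : (ℓ (x * s) : ℝ) ≤ ℓ x + ℓ s := by exact_mod_cast hℓ.mul x s
  nlinarith [(Nat.cast_nonneg (ℓ x) : (0:ℝ) ≤ _), (Nat.cast_nonneg (ℓ s) : (0:ℝ) ≤ _)]

lemma HasGrowth.bound_mul {f : G → ℂ} {c : ℝ} {k : ℕ} (hℓ : IsPolyLength ℓ C d) (hc : 0 < c)
    (hf : ∀ x, ‖f x‖ ≤ c * (1 + (ℓ x : ℝ)) ^ k) (x s : G) :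
    ‖f (x * s)‖ ≤ c * (1 + (ℓ x : ℝ)) ^ k * (1 + (ℓ s : ℝ)) ^ k := by
  refine (hf _).trans ?_
  rw [mul_assoc, ← mul_pow]
  gcongr; exact hℓ.one_add_mul_le x s

lemma HasGrowth.summable {m : G → ℝ} {f : G → ℂ} {k : ℕ} (hℓ : IsPolyLength ℓ C d)
    (hm : IsCourteousWeight ℓ m) (hf : HasGrowth ℓ k f) (x : G) :
    Summable fun s => m s • f (x * s) := by
  obtain ⟨c, hc, hf⟩ := hf
  refine Summable.of_norm_bounded ((hm.summable_pow hℓ k).mul_left (c * (1 + (ℓ x : ℝ)) ^ k))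
    fun s => ?_
  rw [norm_smul, Real.norm_of_nonneg (hm.nonneg s)]
  calc _ ≤ m s * (c * (1 + (ℓ x : ℝ)) ^ k * (1 + (ℓ s : ℝ)) ^ k) :=
        mul_le_mul_of_nonneg_left (HasGrowth.bound_mul hℓ hc hf x s) (hm.nonneg s)
    _ = _ := by ring

end Summability

section Energy

variable {G : Type*} [Group G] {ℓ : G → ℕ} {C d : ℕ}

lemma IsPolyLength.le_mul_right (hℓ : IsPolyLength ℓ C d) (x g : G) :
    ℓ x ≤ ℓ (x * g) + ℓ g := by
  have := hℓ.mul (x * g) g⁻¹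
  rwa [mul_inv_cancel_right, hℓ.inv] at this

/-- The exponential cutoff at scale `R`. -/
def cutoff (ℓ : G → ℕ) (R : ℝ) (x : G) : ℝ := Real.exp (-(ℓ x : ℝ) / R)

/-- The weighted `L²` form at scale `R`. -/
def energyNorm (ℓ : G → ℕ) (R : ℝ) (f : G → ℂ) : ℝ := ∑' x, cutoff ℓ R x * ‖f x‖ ^ 2

/-- The weighted `L²` size of the increments `f (x g) - f x`. -/
def gradNorm (ℓ : G → ℕ) (R : ℝ) (f : G → ℂ) (g : G) : ℝ :=
  ∑' x, cutoff ℓ R x * ‖f (x * g) - f x‖ ^ 2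

lemma cutoff_pos (R : ℝ) (x : G) : 0 < cutoff ℓ R x := Real.exp_pos _

lemma cutoff_le_of_le {R : ℝ} (hR : 0 < R) {x y : G} {n : ℕ} (h : ℓ x ≤ ℓ y + n) :
    cutoff ℓ R y ≤ Real.exp (n / R) * cutoff ℓ R x := by
  unfold cutoff
  rw [← Real.exp_add, ← add_div]
  gcongr
  have : (ℓ x : ℝ) ≤ ℓ y + n := by exact_mod_cast h
  linarith

lemma cutoff_mul_le (hℓ : IsPolyLength ℓ C d) {R : ℝ} (hR : 0 < R) (x g : G) :
    cutoff ℓ R (x * g) ≤ Real.exp (ℓ g / R) * cutoff ℓ R x :=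
  cutoff_le_of_le hR (hℓ.le_mul_right x g)

lemma HasGrowth.mul_right {k : ℕ} {f : G → ℂ} (hℓ : IsPolyLength ℓ C d) (hf : HasGrowth ℓ k f)
    (g : G) : HasGrowth ℓ k (fun x => f (x * g)) := by
  obtain ⟨c, hc, hf⟩ := hf
  refine ⟨c * (1 + (ℓ g : ℝ)) ^ k, by positivity, fun x => ?_⟩
  refine (HasGrowth.bound_mul hℓ hc hf x g).trans (le_of_eq (by ring))

lemma HasGrowth.mul_left {k : ℕ} {f : G → ℂ} (hℓ : IsPolyLength ℓ C d) (hf : HasGrowth ℓ k f)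
    (g : G) : HasGrowth ℓ k (fun x => f (g * x)) := by
  obtain ⟨c, hc, hf⟩ := hf
  refine ⟨c * (1 + (ℓ g : ℝ)) ^ k, by positivity, fun x => ?_⟩
  refine (hf _).trans ?_
  rw [mul_assoc, ← mul_pow]
  gcongr; exact hℓ.one_add_mul_le g x

lemma HasGrowth.add {k : ℕ} {f g : G → ℂ} (hf : HasGrowth ℓ k f) (hg : HasGrowth ℓ k g) :
    HasGrowth ℓ k (f + g) := by
  obtain ⟨c, hc, hf⟩ := hf
  obtain ⟨c', hc', hg⟩ := hg
  refine ⟨c + c', by positivity, fun x => (norm_add_le _ _).trans ?_⟩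
  rw [add_mul]
  exact add_le_add (hf x) (hg x)

lemma HasGrowth.smul {k : ℕ} {f : G → ℂ} (a : ℂ) (hf : HasGrowth ℓ k f) :
    HasGrowth ℓ k (a • f) := by
  obtain ⟨c, hc, hf⟩ := hf
  refine ⟨(‖a‖ + 1) * c, by positivity, fun x => ?_⟩
  rw [Pi.smul_apply, norm_smul, mul_assoc]
  exact mul_le_mul (by linarith) (hf x) (norm_nonneg _) (by positivity)

lemma HasGrowth.sub {k : ℕ} {f g : G → ℂ} (hf : HasGrowth ℓ k f) (hg : HasGrowth ℓ k g) :
    HasGrowth ℓ k (f - g) := by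
  have := hf.add (hg.smul (-1))
  simpa [sub_eq_add_neg] using this

lemma HasGrowth.zero {k : ℕ} : HasGrowth ℓ k (0 : G → ℂ) :=
  ⟨1, one_pos, fun x => by simp; positivity⟩

lemma HasGrowth.energy_bound {k : ℕ} {f : G → ℂ} (hℓ : IsPolyLength ℓ C d)
    (hf : HasGrowth ℓ k f) :
    ∃ A > 0, ∀ R : ℝ, 1 ≤ R → Summable (fun x => cutoff ℓ R x * ‖f x‖ ^ 2) ∧
      energyNorm ℓ R f ≤ A * R ^ (2 * k + d + 2) := by
  obtain ⟨c, hc, hf⟩ := hf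
  obtain ⟨A, hA, h⟩ := hℓ.weight_bound (2 * k)
  refine ⟨c ^ 2 * A, by positivity, fun R hR => ?_⟩
  obtain ⟨h1, h2⟩ := h R hR
  have hb : ∀ x, cutoff ℓ R x * ‖f x‖ ^ 2
      ≤ c ^ 2 * (Real.exp (-(ℓ x : ℝ) / R) * (1 + (ℓ x : ℝ)) ^ (2 * k)) := by
    intro x
    calc _ ≤ Real.exp (-(ℓ x : ℝ) / R) * (c * (1 + (ℓ x : ℝ)) ^ k) ^ 2 := by
          unfold cutoff; gcongr; exact hf x
      _ = _ := by ring
  have hs := Summable.of_nonneg_of_le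
    (fun x => mul_nonneg (cutoff_pos R x).le (by positivity)) hb (h1.mul_left _)
  refine ⟨hs, (hs.tsum_le_tsum hb (h1.mul_left _)).trans ?_⟩
  rw [tsum_mul_left, mul_assoc]
  gcongr

lemma HasGrowth.summable_energy {k : ℕ} {f : G → ℂ} (hℓ : IsPolyLength ℓ C d)
    (hf : HasGrowth ℓ k f) {R : ℝ} (hR : 1 ≤ R) :
    Summable (fun x => cutoff ℓ R x * ‖f x‖ ^ 2) := by
  obtain ⟨A, -, h⟩ := hf.energy_bound hℓ
  exact (h R hR).1

lemma energyNorm_nonneg (R : ℝ) (f : G → ℂ) : 0 ≤ energyNorm ℓ R f :=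
  tsum_nonneg fun x => mul_nonneg (cutoff_pos R x).le (by positivity)

lemma HasGrowth.summable_grad {k : ℕ} {f : G → ℂ} (hℓ : IsPolyLength ℓ C d)
    (hf : HasGrowth ℓ k f) {R : ℝ} (hR : 1 ≤ R) (g : G) :
    Summable (fun x => cutoff ℓ R x * ‖f (x * g) - f x‖ ^ 2) :=
  ((hf.mul_right hℓ g).sub hf).summable_energy hℓ hR

lemma energyNorm_mul_right_le {k : ℕ} {f : G → ℂ} (hℓ : IsPolyLength ℓ C d)
    (hf : HasGrowth ℓ k f) {R : ℝ} (hR : 1 ≤ R) (g : G) :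
    energyNorm ℓ R (fun x => f (x * g)) ≤ Real.exp (ℓ g / R) * energyNorm ℓ R f := by
  have hR0 : 0 < R := by linarith
  have hs := hf.summable_energy hℓ hR
  have h1 := (hf.mul_right hℓ g).summable_energy hℓ hR
  unfold energyNorm
  rw [← tsum_mul_left, ← (Equiv.mulRight g).tsum_eq (fun x => _ * (_ * ‖f x‖ ^ 2))]
  refine h1.tsum_le_tsum (fun x => ?_)
    ((Equiv.mulRight g).summable_iff.2 (hs.mul_left _))
  simp only [Equiv.coe_mulRight]
  rw [← mul_assoc]
  gcongr
  exact cutoff_le_of_le hR0 (hℓ.mul x g)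

lemma energyNorm_mul_left_le {k : ℕ} {f : G → ℂ} (hℓ : IsPolyLength ℓ C d)
    (hf : HasGrowth ℓ k f) {R : ℝ} (hR : 1 ≤ R) (g : G) :
    energyNorm ℓ R (fun x => f (g * x)) ≤ Real.exp (ℓ g / R) * energyNorm ℓ R f := by
  have hR0 : 0 < R := by linarith
  have hs := hf.summable_energy hℓ hR
  have h1 := (hf.mul_left hℓ g).summable_energy hℓ hR
  unfold energyNorm
  rw [← tsum_mul_left, ← (Equiv.mulLeft g).tsum_eq (fun x => _ * (_ * ‖f x‖ ^ 2))]
  refine h1.tsum_le_tsum (fun x => ?_)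
    ((Equiv.mulLeft g).summable_iff.2 (hs.mul_left _))
  simp only [Equiv.coe_mulLeft]
  rw [← mul_assoc]
  gcongr
  refine cutoff_le_of_le hR0 ((hℓ.mul g x).trans (by omega))

lemma gradNorm_inv_le {k : ℕ} {f : G → ℂ} (hℓ : IsPolyLength ℓ C d)
    (hf : HasGrowth ℓ k f) {R : ℝ} (hR : 1 ≤ R) (g : G) :
    gradNorm ℓ R f g⁻¹ ≤ Real.exp (ℓ g) * gradNorm ℓ R f g := by
  have h := energyNorm_mul_right_le hℓ ((hf.mul_right hℓ g).sub hf) hR g⁻¹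
  rw [hℓ.inv] at h
  have h2 : Real.exp (ℓ g / R) ≤ Real.exp (ℓ g) := by
    gcongr; exact div_le_self (by positivity) hR
  have h3 : gradNorm ℓ R f g⁻¹
      = energyNorm ℓ R (fun x => ((fun x => f (x * g)) - f) (x * g⁻¹)) := by
    unfold gradNorm energyNorm
    congr 1; ext x
    simp [norm_sub_rev]
  rw [h3]
  exact h.trans (mul_le_mul_of_nonneg_right h2 (energyNorm_nonneg _ _))

lemma gradNorm_mul_le {k : ℕ} {f : G → ℂ} (hℓ : IsPolyLength ℓ C d)
    (hf : HasGrowth ℓ k f) {R : ℝ} (hR : 1 ≤ R) (g h : G) :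
    gradNorm ℓ R f (g * h)
      ≤ 2 * Real.exp (ℓ g) * gradNorm ℓ R f h + 2 * gradNorm ℓ R f g := by
  have h1 := energyNorm_mul_right_le hℓ ((hf.mul_right hℓ h).sub hf) hR g
  have h2 : Real.exp (ℓ g / R) ≤ Real.exp (ℓ g) := by
    gcongr; exact div_le_self (by positivity) hR
  have h3 := h1.trans (mul_le_mul_of_nonneg_right h2 (energyNorm_nonneg _ _))
  have s1 := (((hf.mul_right hℓ h).sub hf).mul_right hℓ g).summable_energy hℓ hR
  have s2 := hf.summable_grad hℓ hR g
  have s3 := hf.summable_grad hℓ hR (g * h)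
  have h4 : gradNorm ℓ R f (g * h)
      ≤ 2 * energyNorm ℓ R (fun x => ((fun x => f (x * h)) - f) (x * g))
        + 2 * gradNorm ℓ R f g := by
    unfold gradNorm energyNorm
    rw [← tsum_mul_left, ← tsum_mul_left, ← (s1.mul_left 2).tsum_add (s2.mul_left 2)]
    refine s3.tsum_le_tsum (fun x => ?_) ((s1.mul_left 2).add (s2.mul_left 2))
    have hc := (cutoff_pos (ℓ := ℓ) R x).le
    have : ‖f (x * (g * h)) - f x‖ ^ 2
        ≤ 2 * ‖f (x * g * h) - f (x * g)‖ ^ 2 + 2 * ‖f (x * g) - f x‖ ^ 2 := by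
      have t : ‖f (x * (g * h)) - f x‖ ≤ ‖f (x * g * h) - f (x * g)‖ + ‖f (x * g) - f x‖ := by
        rw [← mul_assoc]; exact norm_sub_le_norm_sub_add_norm_sub _ _ _
      nlinarith [norm_nonneg (f (x * (g * h)) - f x),
        sq_nonneg (‖f (x * g * h) - f (x * g)‖ - ‖f (x * g) - f x‖)]
    simp only [Pi.sub_apply]
    nlinarith
  have h5 : energyNorm ℓ R ((fun x => f (x * h)) - f) = gradNorm ℓ R f h := rfl
  rw [h5] at h3
  linarith

/-- The Dirichlet energy of `f` at scale `R`. -/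
def dirichlet (ℓ : G → ℕ) (m : G → ℝ) (R : ℝ) (f : G → ℂ) : ℝ :=
  ∑' p : G × G, m p.2 * (cutoff ℓ R p.1 * ‖f (p.1 * p.2) - f p.1‖ ^ 2)

lemma summable_prod_weight (hℓ : IsPolyLength ℓ C d) {u : G → ℝ} (hu : ∀ s, 0 ≤ u s)
    (hus : Summable u) {R : ℝ} (hR : 1 ≤ R) (p : ℕ) :
    Summable fun q : G × G => u q.2 * (cutoff ℓ R q.1 * (1 + (ℓ q.1 : ℝ)) ^ p) := by
  obtain ⟨A, -, h⟩ := hℓ.weight_bound p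
  have := ((h R hR).1).mul_of_nonneg hus
    (fun x => mul_nonneg (Real.exp_pos _).le (by positivity)) hu
  refine this.congr fun q => ?_
  unfold cutoff; ring

lemma summable_prod_of_le {k : ℕ} (hℓ : IsPolyLength ℓ C d)
    {f : G → ℂ} (hf : HasGrowth ℓ k f) {u : G → ℝ} (hu : ∀ s, 0 ≤ u s)
    (hus : Summable fun s => u s * (1 + (ℓ s : ℝ)) ^ (2 * k)) {R : ℝ} (hR : 1 ≤ R) :
    Summable fun q : G × G => u q.2 * (cutoff ℓ R q.1 * (‖f q.1‖ ^ 2 + ‖f (q.1 * q.2)‖ ^ 2)) := by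
  obtain ⟨c, hc, hf⟩ := hf
  have hs := (summable_prod_weight hℓ (fun s => mul_nonneg (hu s) (by positivity)) hus hR
    (2 * k)).mul_left (2 * c ^ 2)
  refine Summable.of_nonneg_of_le (fun q => ?_) (fun q => ?_) hs
  · exact mul_nonneg (hu _) (mul_nonneg (cutoff_pos R _).le (by positivity))
  · have h1 : ‖f q.1‖ ≤ c * (1 + (ℓ q.1 : ℝ)) ^ k * (1 + (ℓ q.2 : ℝ)) ^ k := by
      refine (hf _).trans (le_mul_of_one_le_right (by positivity) ?_)
      exact one_le_pow₀ (by linarith [(Nat.cast_nonneg (ℓ q.2) : (0:ℝ) ≤ _)])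
    have h2 := HasGrowth.bound_mul hℓ hc hf q.1 q.2
    have h3 : ‖f q.1‖ ^ 2 + ‖f (q.1 * q.2)‖ ^ 2
        ≤ 2 * (c * (1 + (ℓ q.1 : ℝ)) ^ k * (1 + (ℓ q.2 : ℝ)) ^ k) ^ 2 := by
      have := pow_le_pow_left₀ (norm_nonneg _) h1 2
      have := pow_le_pow_left₀ (norm_nonneg _) h2 2
      linarith
    calc _ ≤ u q.2 * (cutoff ℓ R q.1 * (2 * (c * (1 + (ℓ q.1 : ℝ)) ^ k
            * (1 + (ℓ q.2 : ℝ)) ^ k) ^ 2)) := by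
          have := hu q.2
          have := (cutoff_pos (ℓ := ℓ) R q.1).le
          gcongr
      _ = _ := by ring

end Energy

section Caccioppoli

variable {G : Type*} [Group G] {ℓ : G → ℕ} {C d : ℕ}

lemma abs_cutoff_sub_le (hℓ : IsPolyLength ℓ C d) {R : ℝ} (hR : 0 < R) (x s : G) :
    |cutoff ℓ R (x * s) - cutoff ℓ R x| ≤ ℓ s / R * Real.exp (ℓ s / R) * cutoff ℓ R x := by
  have hb := cutoff_mul_le hℓ hR x s
  have ha : cutoff ℓ R x ≤ Real.exp (ℓ s / R) * cutoff ℓ R (x * s) :=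
    cutoff_le_of_le hR (hℓ.mul x s)
  set t : ℝ := ℓ s / R
  have ht : 0 ≤ t := by positivity
  have hw := cutoff_pos (ℓ := ℓ) R x
  have hw' := cutoff_pos (ℓ := ℓ) R (x * s)
  have h1 : Real.exp t - 1 ≤ t * Real.exp t := by
    have := Real.add_one_le_exp (-t)
    rw [Real.exp_neg] at this
    have h0 := Real.exp_pos t
    have h2 := mul_le_mul_of_nonneg_right this h0.le
    rw [inv_mul_cancel₀ h0.ne'] at h2
    linarith
  rw [abs_le]
  constructor
  · have h3 : cutoff ℓ R x - cutoff ℓ R (x * s) ≤ t * Real.exp t * cutoff ℓ R x := by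
      have h4 : Real.exp (-t) * cutoff ℓ R x ≤ cutoff ℓ R (x * s) := by
        rw [Real.exp_neg, inv_mul_le_iff₀ (Real.exp_pos t)]; exact ha
      have h5 := Real.add_one_le_exp (-t)
      have h6 : 1 - Real.exp (-t) ≤ t * Real.exp t := by
        have : 1 ≤ Real.exp t := Real.one_le_exp ht
        nlinarith
      nlinarith
    linarith
  · nlinarith

lemma sq_norm_sub_eq (a b : ℂ) :
    ‖b - a‖ ^ 2 = ‖b‖ ^ 2 - ‖a‖ ^ 2 - 2 * ((starRingEnd ℂ a) * (b - a)).re := by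
  simp only [← Complex.normSq_eq_norm_sq, Complex.normSq_apply, Complex.mul_re, Complex.conj_re,
    Complex.conj_im, Complex.sub_re, Complex.sub_im]
  ring

lemma tsum_sq_sub_eq {m : G → ℝ} {k : ℕ} {f : G → ℂ} (hℓ : IsPolyLength ℓ C d)
    (hm : IsCourteousWeight ℓ m) (hf : HasGrowth ℓ k f) (hh : IsHarm m f) (x : G) :
    HasSum (fun s => m s * ((starRingEnd ℂ (f x)) * (f (x * s) - f x)).re) 0 := by
  have h1 := (hf.summable hℓ hm x).hasSum
  rw [← hh x] at h1
  have h2 : HasSum (fun s => m s • f x) (f x) := by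
    have := hm.hasSum.smul_const (f x)
    simpa using this
  have h3 := (h1.sub h2).mul_left (starRingEnd ℂ (f x))
  rw [sub_self, mul_zero] at h3
  have h4 := Complex.hasSum_re h3
  simp only [Complex.zero_re] at h4
  refine h4.congr_fun fun s => ?_
  simp [Complex.mul_re]
  ring

/-- The Caccioppoli inequality for harmonic functions. -/
theorem caccioppoli {m : G → ℝ} (hℓ : IsPolyLength ℓ C d) (hm : IsCourteousWeight ℓ m) :
    ∃ A > 0, ∃ R₀ ≥ 1, ∀ R : ℝ, R₀ ≤ R → ∀ (k : ℕ) (f : G → ℂ), HasGrowth ℓ k f → IsHarm m f →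
      Summable (fun p : G × G => m p.2 * (cutoff ℓ R p.1 * ‖f (p.1 * p.2) - f p.1‖ ^ 2)) ∧
      dirichlet ℓ m R f ≤ A / R ^ 2 * energyNorm ℓ R f := by
  obtain ⟨a, ha, hmom⟩ := hm.exp_moment hℓ
  set A := ∑' s, m s * (Real.exp (a * ℓ s) * (1 + (ℓ s : ℝ)) ^ 2)
  have hA : 0 ≤ A := tsum_nonneg fun s => mul_nonneg (hm.nonneg s) (by positivity)
  refine ⟨A + 1, by positivity, max 1 (3 / a), le_max_left _ _, fun R hR k f hf hh => ?_⟩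
  have hR1 : 1 ≤ R := (le_max_left _ _).trans hR
  have hR0 : 0 < R := by linarith
  have hRa : 3 / R ≤ a := by
    have := (le_max_right _ _).trans hR
    rw [div_le_iff₀ ha] at this
    rw [div_le_iff₀ hR0]; linarith
  set w := cutoff ℓ R
  have hw : ∀ x, 0 < w x := cutoff_pos R
  have h0 := summable_prod_of_le hℓ hf hm.nonneg (hm.summable_pow hℓ (2 * k)) hR1
  set F1 : G × G → ℝ := fun p => m p.2 * (w p.1 * ‖f (p.1 * p.2) - f p.1‖ ^ 2)
  set F2 : G × G → ℝ := fun p => m p.2 * (w p.1 * (‖f (p.1 * p.2)‖ ^ 2 - ‖f p.1‖ ^ 2))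
  set F3 : G × G → ℝ := fun p => m p.2 * (w (p.1 * p.2) * (‖f p.1‖ ^ 2 - ‖f (p.1 * p.2)‖ ^ 2))
  set u : G → ℝ := fun s => m s * ((ℓ s / R * Real.exp (ℓ s / R)) ^ 2 / 2)
  set F4 : G × G → ℝ := fun p => u p.2 * (w p.1 * (‖f p.1‖ ^ 2 + ‖f (p.1 * p.2)‖ ^ 2))
  have hu : ∀ s, 0 ≤ u s := fun s => mul_nonneg (hm.nonneg s) (by positivity)
  have hexp : ∀ s, Real.exp (ℓ s / R) ^ 3 ≤ Real.exp (a * ℓ s) := by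
    intro s
    rw [← Real.exp_nat_mul]
    apply Real.exp_le_exp.2
    have : (0 : ℝ) ≤ ℓ s := by positivity
    calc _ = 3 / R * ℓ s := by push_cast; ring
      _ ≤ _ := by gcongr
  have hone : ∀ s, 1 ≤ Real.exp (ℓ s / R) := fun s => Real.one_le_exp (by positivity)
  have s1 : Summable F1 := by
    refine Summable.of_nonneg_of_le (fun p => ?_) (fun p => ?_) (h0.mul_left 2)
    · exact mul_nonneg (hm.nonneg _) (mul_nonneg (hw _).le (by positivity))
    · have : ‖f (p.1 * p.2) - f p.1‖ ^ 2 ≤ 2 * (‖f p.1‖ ^ 2 + ‖f (p.1 * p.2)‖ ^ 2) := by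
        nlinarith [norm_sub_le (f (p.1 * p.2)) (f p.1), norm_nonneg (f (p.1 * p.2) - f p.1),
          sq_nonneg (‖f p.1‖ - ‖f (p.1 * p.2)‖)]
      have h1 := hm.nonneg p.2
      have h2 := (hw p.1).le
      calc m p.2 * (w p.1 * ‖f (p.1 * p.2) - f p.1‖ ^ 2)
          ≤ m p.2 * (w p.1 * (2 * (‖f p.1‖ ^ 2 + ‖f (p.1 * p.2)‖ ^ 2))) := by gcongr
        _ = _ := by ring
  have s2 : Summable F2 := by
    refine Summable.of_norm_bounded h0 fun p => ?_
    have h1 := hm.nonneg p.2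
    have h2 := (hw p.1).le
    rw [Real.norm_eq_abs, abs_mul, abs_mul, abs_of_nonneg h1, abs_of_nonneg h2]
    gcongr
    rw [abs_le]; constructor <;> nlinarith [sq_nonneg ‖f p.1‖, sq_nonneg ‖f (p.1 * p.2)‖]
  let σ : G × G ≃ G × G :=
    { toFun := fun p => (p.1 * p.2, p.2⁻¹)
      invFun := fun p => (p.1 * p.2, p.2⁻¹)
      left_inv := fun p => by simp
      right_inv := fun p => by simp }
  have h32 : ∀ p, F2 (σ p) = F3 p := fun p => by simp [F2, F3, σ, hm.symm]
  have s3 : Summable F3 := by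
    refine (σ.summable_iff.2 s2).congr fun p => ?_
    simp [h32]
  have e23 : ∑' p, F2 p = ∑' p, F3 p := by
    rw [← σ.tsum_eq F2]; exact tsum_congr h32
  have s4 : Summable F4 := by
    refine summable_prod_of_le hℓ hf hu ?_ hR1
    refine Summable.of_nonneg_of_le (fun s => mul_nonneg (hu s) (by positivity)) (fun s => ?_)
      (hmom (2 * k + 2))
    have h1 := hm.nonneg s
    have h3 : Real.exp (ℓ s / R) ^ 2 ≤ Real.exp (a * ℓ s) :=
      (pow_le_pow_right₀ (hone s) (by norm_num)).trans (hexp s)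
    have h4 : (ℓ s / R) ≤ 1 + (ℓ s : ℝ) := by
      have := div_le_self (by positivity : (0:ℝ) ≤ ℓ s) hR1
      linarith
    calc u s * (1 + (ℓ s : ℝ)) ^ (2 * k)
        = m s * ((ℓ s / R) ^ 2 * Real.exp (ℓ s / R) ^ 2 / 2 * (1 + (ℓ s : ℝ)) ^ (2 * k)) := by
          simp only [u]; ring
      _ ≤ m s * ((1 + (ℓ s : ℝ)) ^ 2 * Real.exp (a * ℓ s) * (1 + (ℓ s : ℝ)) ^ (2 * k)) := by
          gcongr
          refine (half_le_self (by positivity)).trans ?_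
          gcongr
      _ = _ := by ring
  have e12 : ∑' p, F1 p = ∑' p, F2 p := by
    rw [s1.tsum_prod, s2.tsum_prod]
    refine tsum_congr fun x => ?_
    have hx := (tsum_sq_sub_eq hℓ hm hf hh x).mul_left (2 * w x)
    have t2 := (s2.prod_factor x).hasSum
    have := t2.sub hx
    rw [mul_zero, sub_zero] at this
    refine HasSum.tsum_eq (this.congr_fun fun s => ?_)
    simp only [F1, F2]
    rw [sq_norm_sub_eq]
    ring
  have hpt : ∀ p, F2 p + F3 p ≤ F1 p + F4 p := by
    intro p
    have h1 := hm.nonneg p.2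
    have hc := abs_cutoff_sub_le hℓ hR0 p.1 p.2
    set θ : ℝ := ℓ p.2 / R * Real.exp (ℓ p.2 / R)
    have hθ : 0 ≤ θ := by positivity
    have hab : |‖f (p.1 * p.2)‖ ^ 2 - ‖f p.1‖ ^ 2|
        ≤ ‖f (p.1 * p.2) - f p.1‖ * (‖f (p.1 * p.2)‖ + ‖f p.1‖) := by
      rw [sq_sub_sq, abs_mul, mul_comm]
      rw [abs_of_nonneg (by positivity : 0 ≤ ‖f (p.1 * p.2)‖ + ‖f p.1‖)]
      gcongr
      exact abs_norm_sub_norm_le _ _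
    set b := ‖f (p.1 * p.2)‖
    set c := ‖f p.1‖
    set e := ‖f (p.1 * p.2) - f p.1‖
    have hb : 0 ≤ b := norm_nonneg _
    have hcc : 0 ≤ c := norm_nonneg _
    have he : 0 ≤ e := norm_nonneg _
    have key : (w p.1 - w (p.1 * p.2)) * (b ^ 2 - c ^ 2)
        ≤ w p.1 * e ^ 2 + θ ^ 2 / 2 * (w p.1 * (c ^ 2 + b ^ 2)) := by
      calc _ ≤ |w (p.1 * p.2) - w p.1| * |b ^ 2 - c ^ 2| := by
            rw [abs_sub_comm, ← abs_mul]; exact le_abs_self _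
        _ ≤ (θ * w p.1) * (e * (b + c)) := by
            have := (hw p.1).le
            gcongr
        _ = w p.1 * (e * (θ * (b + c))) := by ring
        _ ≤ w p.1 * (e ^ 2 + θ ^ 2 / 2 * (c ^ 2 + b ^ 2)) := by
            have := (hw p.1).le
            gcongr
            nlinarith [sq_nonneg (2 * e - θ * (b + c)), mul_nonneg (sq_nonneg θ) (sq_nonneg (b - c))]
        _ = _ := by ring
    calc F2 p + F3 p = m p.2 * ((w p.1 - w (p.1 * p.2)) * (b ^ 2 - c ^ 2)) := by
          simp only [F2, F3, b, c]; ring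
      _ ≤ m p.2 * (w p.1 * e ^ 2 + θ ^ 2 / 2 * (w p.1 * (c ^ 2 + b ^ 2))) := by gcongr
      _ = _ := by simp only [F1, F4, u, θ, b, c, e]; ring
  have hE : ∑' p, F1 p ≤ ∑' p, F4 p := by
    have := (s2.add s3).tsum_le_tsum hpt (s1.add s4)
    rw [s2.tsum_add s3, s1.tsum_add s4] at this
    linarith
  have hQs := hf.summable_energy hℓ hR1
  have hQ0 := energyNorm_nonneg (ℓ := ℓ) R f
  have hF4 : ∑' p, F4 p ≤ A / R ^ 2 * energyNorm ℓ R f := by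
    rw [← (Equiv.prodComm G G).tsum_eq F4]
    have s4' : Summable (F4 ∘ (Equiv.prodComm G G)) := (Equiv.prodComm G G).summable_iff.2 s4
    change ∑' p, (F4 ∘ (Equiv.prodComm G G)) p ≤ _
    rw [s4'.tsum_prod, div_mul_eq_mul_div, mul_div_assoc, ← tsum_mul_right]
    refine s4'.prod.tsum_le_tsum (fun s => ?_) ((hmom 2).mul_right _)
    have hs2 := (hf.mul_right hℓ s).summable_energy hℓ hR1
    have : ∑' x, (F4 ∘ (Equiv.prodComm G G)) (s, x)
        = u s * (energyNorm ℓ R f + energyNorm ℓ R (fun x => f (x * s))) := by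
      unfold energyNorm
      rw [← hQs.tsum_add hs2, ← tsum_mul_left]
      refine tsum_congr fun x => ?_
      simp only [F4, w, Function.comp, Equiv.prodComm_apply, Prod.swap_prod_mk]; ring
    rw [this]
    have h1 := hm.nonneg s
    have h2 := energyNorm_mul_right_le hℓ hf hR1 s
    have h3 : energyNorm ℓ R f + energyNorm ℓ R (fun x => f (x * s))
        ≤ 2 * Real.exp (ℓ s / R) * energyNorm ℓ R f := by
      nlinarith [hone s]
    calc _ ≤ u s * (2 * Real.exp (ℓ s / R) * energyNorm ℓ R f) :=
          mul_le_mul_of_nonneg_left h3 (hu s)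
      _ = m s * (Real.exp (ℓ s / R) ^ 3 * (ℓ s : ℝ) ^ 2) * (energyNorm ℓ R f / R ^ 2) := by
          simp only [u]; field_simp
      _ ≤ _ := by
          gcongr
          · exact hexp s
          · linarith
  refine ⟨s1, ?_⟩
  change ∑' p, F1 p ≤ _
  refine hE.trans (hF4.trans ?_)
  gcongr
  linarith

/-- Increments in an arbitrary direction are controlled by the Dirichlet energy. -/
lemma gradNorm_le_dirichlet {m : G → ℝ} (hℓ : IsPolyLength ℓ C d) (hm : IsCourteousWeight ℓ m)
    (g : G) : ∃ A > 0, ∀ R : ℝ, 1 ≤ R → ∀ (k : ℕ) (f : G → ℂ), HasGrowth ℓ k f →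
      Summable (fun p : G × G => m p.2 * (cutoff ℓ R p.1 * ‖f (p.1 * p.2) - f p.1‖ ^ 2)) →
      gradNorm ℓ R f g ≤ A * dirichlet ℓ m R f := by
  have hg : g ∈ Subgroup.closure {x | m x ≠ 0} := by rw [hm.adapted]; trivial
  have hD : ∀ (R : ℝ) (f : G → ℂ), 0 ≤ dirichlet ℓ m R f := fun R f =>
    tsum_nonneg fun p => mul_nonneg (hm.nonneg _) (mul_nonneg (cutoff_pos R _).le (by positivity))
  induction hg using Subgroup.closure_induction with
  | mem s hs =>
    have hms : 0 < m s := lt_of_le_of_ne (hm.nonneg s) (Ne.symm hs)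
    refine ⟨(m s)⁻¹, by positivity, fun R hR k f hf hsum => ?_⟩
    rw [le_inv_mul_iff₀ hms]
    unfold gradNorm dirichlet
    rw [← tsum_mul_left]
    have hinj : Function.Injective (fun x : G => (x, s)) := fun a b h => (Prod.ext_iff.1 h).1
    have := hsum.comp_injective hinj
    refine (tsum_comp_le_tsum_of_inj hsum (fun p => mul_nonneg (hm.nonneg _)
      (mul_nonneg (cutoff_pos R _).le (by positivity))) hinj)
  | one =>
    refine ⟨1, one_pos, fun R hR k f hf hsum => ?_⟩
    have : gradNorm ℓ R f 1 = 0 := by simp [gradNorm]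
    rw [this, one_mul]; exact hD R f
  | mul g h _ _ hg hh =>
    obtain ⟨A, hA, h1⟩ := hg
    obtain ⟨B, hB, h2⟩ := hh
    refine ⟨2 * Real.exp (ℓ g) * B + 2 * A, by positivity, fun R hR k f hf hsum => ?_⟩
    refine (gradNorm_mul_le hℓ hf hR g h).trans ?_
    have := h1 R hR k f hf hsum
    have := mul_le_mul_of_nonneg_left (h2 R hR k f hf hsum)
      (by positivity : 0 ≤ 2 * Real.exp (ℓ g))
    nlinarith
  | inv g _ hg =>
    obtain ⟨A, hA, h1⟩ := hg
    refine ⟨Real.exp (ℓ g) * A, by positivity, fun R hR k f hf hsum => ?_⟩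
    refine (gradNorm_inv_le hℓ hf hR g).trans ?_
    rw [mul_assoc]
    exact mul_le_mul_of_nonneg_left (h1 R hR k f hf hsum) (Real.exp_pos _).le

/-- The weighted `L²` size of the gradient of a harmonic function. -/
theorem grad_sum_le {m : G → ℝ} (hℓ : IsPolyLength ℓ C d) (hm : IsCourteousWeight ℓ m)
    (T : Finset G) : ∃ A > 0, ∃ R₀ ≥ 1, ∀ R : ℝ, R₀ ≤ R → ∀ (k : ℕ) (f : G → ℂ),
      HasGrowth ℓ k f → IsHarm m f →
      ∑ s ∈ T, gradNorm ℓ R f s ≤ A / R ^ 2 * energyNorm ℓ R f := by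
  obtain ⟨A, hA, R₀, hR₀, hcac⟩ := caccioppoli hℓ hm
  choose B hB hBg using gradNorm_le_dirichlet hℓ hm
  have hB0 : 0 ≤ ∑ s ∈ T, B s := Finset.sum_nonneg fun s _ => (hB s).le
  refine ⟨(∑ s ∈ T, B s + 1) * A, by positivity, R₀, hR₀, fun R hR k f hf hh => ?_⟩
  obtain ⟨h1, h2⟩ := hcac R hR k f hf hh
  have hD : 0 ≤ dirichlet ℓ m R f :=
    tsum_nonneg fun p => mul_nonneg (hm.nonneg _) (mul_nonneg (cutoff_pos R _).le (by positivity))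
  calc _ ≤ ∑ s ∈ T, B s * dirichlet ℓ m R f :=
        Finset.sum_le_sum fun s _ => hBg s R (hR₀.trans hR) k f hf h1
    _ = (∑ s ∈ T, B s) * dirichlet ℓ m R f := by rw [Finset.sum_mul]
    _ ≤ (∑ s ∈ T, B s + 1) * dirichlet ℓ m R f := by nlinarith
    _ ≤ (∑ s ∈ T, B s + 1) * (A / R ^ 2 * energyNorm ℓ R f) := by gcongr
    _ = _ := by ring

end Caccioppoli

section Poincare

variable {G : Type*} [Group G] {ℓ : G → ℕ} {C d : ℕ}

/-- The ball of radius `n` as a finset. -/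
def IsPolyLength.ball (hℓ : IsPolyLength ℓ C d) (n : ℕ) : Finset G := (hℓ.finite n).toFinset

lemma IsPolyLength.mem_ball (hℓ : IsPolyLength ℓ C d) {n : ℕ} {x : G} :
    x ∈ hℓ.ball n ↔ ℓ x ≤ n := by simp [IsPolyLength.ball]

lemma IsPolyLength.card_ball (hℓ : IsPolyLength ℓ C d) (n : ℕ) :
    (hℓ.ball n).card ≤ C * (n + 1) ^ d := by
  have := hℓ.card n
  rwa [Set.ncard_eq_toFinset_card _ (hℓ.finite n)] at this

lemma IsPolyLength.card_ball_pos (hℓ : IsPolyLength ℓ C d) (n : ℕ) : 0 < (hℓ.ball n).card :=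
  Finset.card_pos.2 ⟨1, hℓ.mem_ball.2 (by simp [hℓ.one])⟩

lemma IsPolyLength.ball_mono (hℓ : IsPolyLength ℓ C d) {a b : ℕ} (h : a ≤ b) :
    hℓ.ball a ⊆ hℓ.ball b := fun _ hx => hℓ.mem_ball.2 ((hℓ.mem_ball.1 hx).trans h)

/-- The squared size of the gradient of `f` at `y`. -/
def sqGrad (hℓ : IsPolyLength ℓ C d) (f : G → ℂ) (y : G) : ℝ :=
  ∑ s ∈ hℓ.ball 1, ‖f (y * s) - f y‖ ^ 2

lemma sqGrad_nonneg (hℓ : IsPolyLength ℓ C d) (f : G → ℂ) (y : G) : 0 ≤ sqGrad hℓ f y :=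
  Finset.sum_nonneg fun _ _ => by positivity

lemma sum_sq_path_le (hℓ : IsPolyLength ℓ C d) (hgeo : IsGeodesicLength ℓ) (f : G → ℂ) (r n : ℕ)
    (u : G) (hu : ℓ u ≤ n) :
    ∑ v ∈ hℓ.ball r, ‖f (v * u) - f v‖ ^ 2
      ≤ ((n : ℝ) + 1) ^ 2 * ∑ v ∈ hℓ.ball (r + n), sqGrad hℓ f v := by
  classical
  induction n generalizing u with
  | zero =>
    simp only [Nat.cast_zero, zero_add, one_pow, one_mul, add_zero]
    refine Finset.sum_le_sum fun v _ => ?_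
    exact Finset.single_le_sum (f := fun s => ‖f (v * s) - f v‖ ^ 2)
      (fun s _ => by positivity) (hℓ.mem_ball.2 (hu.trans (by norm_num)))
  | succ n ih =>
    obtain ⟨y, s, hy, hs, rfl⟩ := hgeo u n hu
    set S := ∑ v ∈ hℓ.ball (r + (n + 1)), sqGrad hℓ f v
    have h1 : ∑ v ∈ hℓ.ball r, ‖f (v * y) - f v‖ ^ 2 ≤ ((n : ℝ) + 1) ^ 2 * S := by
      refine (ih y hy).trans ?_
      gcongr
      exact Finset.sum_le_sum_of_subset_of_nonneg (hℓ.ball_mono (by omega))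
        fun v _ _ => sqGrad_nonneg hℓ f v
    have h2 : ∑ v ∈ hℓ.ball r, ‖f (v * y * s) - f (v * y)‖ ^ 2 ≤ S := by
      calc _ ≤ ∑ v ∈ hℓ.ball r, sqGrad hℓ f (v * y) := by
            refine Finset.sum_le_sum fun v _ => ?_
            exact Finset.single_le_sum (f := fun s => ‖f (v * y * s) - f (v * y)‖ ^ 2)
              (fun s _ => by positivity) (hℓ.mem_ball.2 hs)
        _ = ∑ v ∈ (hℓ.ball r).image (· * y), sqGrad hℓ f v := by
            rw [Finset.sum_image]; intro a _ b _ h; exact mul_right_cancel h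
        _ ≤ _ := by
            refine Finset.sum_le_sum_of_subset_of_nonneg (fun v hv => ?_)
              fun v _ _ => sqGrad_nonneg hℓ f v
            obtain ⟨w, hw, rfl⟩ := Finset.mem_image.1 hv
            have := hℓ.mul w y
            have := hℓ.mem_ball.1 hw
            exact hℓ.mem_ball.2 (by omega)
    have hn : (0 : ℝ) < (n : ℝ) + 1 := by positivity
    have h3 : ∀ v, ‖f (v * (y * s)) - f v‖ ^ 2 ≤ ((n : ℝ) + 2) * ‖f (v * y * s) - f (v * y)‖ ^ 2
        + (1 + 1 / ((n : ℝ) + 1)) * ‖f (v * y) - f v‖ ^ 2 := by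
      intro v
      have t : ‖f (v * (y * s)) - f v‖ ≤ ‖f (v * y * s) - f (v * y)‖ + ‖f (v * y) - f v‖ := by
        rw [← mul_assoc]; exact norm_sub_le_norm_sub_add_norm_sub _ _ _
      set a := ‖f (v * y * s) - f (v * y)‖
      set b := ‖f (v * y) - f v‖
      have : ((n : ℝ) + 2) * a ^ 2 + (1 + 1 / ((n : ℝ) + 1)) * b ^ 2 - (a + b) ^ 2
          = (((n : ℝ) + 1) * a - b) ^ 2 / ((n : ℝ) + 1) := by field_simp; ring
      have h4 : 0 ≤ (((n : ℝ) + 1) * a - b) ^ 2 / ((n : ℝ) + 1) := by positivity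
      have := pow_le_pow_left₀ (norm_nonneg _) t 2
      linarith
    calc _ ≤ ∑ v ∈ hℓ.ball r, (((n : ℝ) + 2) * ‖f (v * y * s) - f (v * y)‖ ^ 2
        + (1 + 1 / ((n : ℝ) + 1)) * ‖f (v * y) - f v‖ ^ 2) := Finset.sum_le_sum fun v _ => h3 v
      _ = ((n : ℝ) + 2) * ∑ v ∈ hℓ.ball r, ‖f (v * y * s) - f (v * y)‖ ^ 2
        + (1 + 1 / ((n : ℝ) + 1)) * ∑ v ∈ hℓ.ball r, ‖f (v * y) - f v‖ ^ 2 := by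
          rw [Finset.sum_add_distrib, Finset.mul_sum, Finset.mul_sum]
      _ ≤ ((n : ℝ) + 2) * S + (1 + 1 / ((n : ℝ) + 1)) * (((n : ℝ) + 1) ^ 2 * S) := by gcongr
      _ = _ := by push_cast; field_simp; ring

/-- A Poincaré inequality on balls for functions with zero average. -/
lemma poincare (hℓ : IsPolyLength ℓ C d) (hgeo : IsGeodesicLength ℓ) (f : G → ℂ) (r : ℕ)
    (h0 : ∑ v ∈ hℓ.ball r, f v = 0) :
    (hℓ.ball r).card * ∑ v ∈ hℓ.ball r, ‖f v‖ ^ 2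
      ≤ (hℓ.ball (2 * r)).card * ((2 * r + 1) ^ 2 * ∑ v ∈ hℓ.ball (3 * r), sqGrad hℓ f v) := by
  classical
  have h1 : ∀ v, (hℓ.ball r).card * ‖f v‖ ^ 2 ≤ ∑ y ∈ hℓ.ball r, ‖f y - f v‖ ^ 2 := by
    intro v
    have : ∑ y ∈ hℓ.ball r, ‖f y - f v‖ ^ 2
        = ∑ y ∈ hℓ.ball r, ‖f y‖ ^ 2 + (hℓ.ball r).card * ‖f v‖ ^ 2 := by
      simp only [sq_norm_sub_eq]
      rw [Finset.sum_sub_distrib, Finset.sum_sub_distrib, ← Finset.mul_sum, ← Complex.re_sum,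
        ← Finset.mul_sum, Finset.sum_sub_distrib, h0, Finset.sum_const, Finset.sum_const]
      have h2 : ((starRingEnd ℂ (f v)) * (0 - (hℓ.ball r).card • f v)).re
          = -((hℓ.ball r).card * ‖f v‖ ^ 2) := by
        rw [← Complex.normSq_eq_norm_sq, Complex.normSq_apply]
        simp [Complex.mul_re]; ring
      rw [h2]; simp; ring
    rw [this]
    have : 0 ≤ ∑ y ∈ hℓ.ball r, ‖f y‖ ^ 2 := Finset.sum_nonneg fun _ _ => by positivity
    linarith
  have h2 : ∀ v ∈ hℓ.ball r, ∑ y ∈ hℓ.ball r, ‖f y - f v‖ ^ 2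
      ≤ ∑ u ∈ hℓ.ball (2 * r), ‖f (v * u) - f v‖ ^ 2 := by
    intro v hv
    calc _ = ∑ u ∈ (hℓ.ball r).image (v⁻¹ * ·), ‖f (v * u) - f v‖ ^ 2 := by
          rw [Finset.sum_image]
          · simp
          · intro a _ b _ h; exact mul_left_cancel h
      _ ≤ _ := by
          refine Finset.sum_le_sum_of_subset_of_nonneg (fun u hu => ?_) fun _ _ _ => by positivity
          obtain ⟨w, hw, rfl⟩ := Finset.mem_image.1 hu
          have h3 := hℓ.mul v⁻¹ w
          rw [hℓ.inv] at h3
          have := hℓ.mem_ball.1 hw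
          have := hℓ.mem_ball.1 hv
          exact hℓ.mem_ball.2 (by omega)
  rw [Finset.mul_sum]
  calc _ ≤ ∑ v ∈ hℓ.ball r, ∑ u ∈ hℓ.ball (2 * r), ‖f (v * u) - f v‖ ^ 2 :=
        Finset.sum_le_sum fun v hv => (h1 v).trans (h2 v hv)
    _ = ∑ u ∈ hℓ.ball (2 * r), ∑ v ∈ hℓ.ball r, ‖f (v * u) - f v‖ ^ 2 := Finset.sum_comm
    _ ≤ ∑ u ∈ hℓ.ball (2 * r), ((2 * r + 1) ^ 2 * ∑ v ∈ hℓ.ball (3 * r), sqGrad hℓ f v) := by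
        refine Finset.sum_le_sum fun u hu => ?_
        have := sum_sq_path_le hℓ hgeo f r (2 * r) u (hℓ.mem_ball.1 hu)
        rw [show r + 2 * r = 3 * r by ring] at this
        exact_mod_cast this
    _ = _ := by rw [Finset.sum_const, nsmul_eq_mul]

/-- A finite set whose points are at mutual distance larger than `2 r`. -/
def IsSeparated (ℓ : G → ℕ) (r : ℕ) (Z : Finset G) : Prop :=
  ∀ z ∈ Z, ∀ z' ∈ Z, ℓ (z⁻¹ * z') ≤ 2 * r → z = z'

lemma exists_separated_cover (hℓ : IsPolyLength ℓ C d) (M r : ℕ) :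
    ∃ Z ⊆ hℓ.ball M, IsSeparated ℓ r Z ∧ ∀ x ∈ hℓ.ball M, ∃ z ∈ Z, ℓ (z⁻¹ * x) ≤ 2 * r := by
  classical
  have hne : ((hℓ.ball M).powerset.filter (IsSeparated ℓ r)).Nonempty :=
    ⟨∅, by simp [IsSeparated]⟩
  obtain ⟨Z, hZ, hmax⟩ := Finset.exists_max_image _ Finset.card hne
  rw [Finset.mem_filter, Finset.mem_powerset] at hZ
  refine ⟨Z, hZ.1, hZ.2, fun x hx => ?_⟩
  by_contra! hcon
  have hxZ : x ∉ Z := fun h => by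
    have := hcon x h
    rw [inv_mul_cancel, hℓ.one] at this
    omega
  have := hmax (insert x Z) (by
    rw [Finset.mem_filter, Finset.mem_powerset]
    refine ⟨Finset.insert_subset hx hZ.1, fun z hz z' hz' h => ?_⟩
    rcases Finset.mem_insert.1 hz with hzx | hzm
    · subst hzx
      rcases Finset.mem_insert.1 hz' with hzx | hz'
      · exact hzx.symm
      · have := hcon z' hz'
        have h3 := hℓ.inv (z'⁻¹ * z)
        rw [mul_inv_rev, inv_inv] at h3
        omega
    · rcases Finset.mem_insert.1 hz' with hzx | hz'
      · subst hzx
        have := hcon z hzm; omega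
      · exact hZ.2 z hzm z' hz' h)
  rw [Finset.card_insert_of_notMem hxZ] at this
  omega

lemma IsSeparated.card_mul_le (hℓ : IsPolyLength ℓ C d) {r t : ℕ} {Z : Finset G}
    (hZ : IsSeparated ℓ r Z) (y : G) (hy : ∀ z ∈ Z, ℓ (z⁻¹ * y) ≤ t) :
    Z.card * (hℓ.ball r).card ≤ (hℓ.ball (t + r)).card := by
  rw [← Finset.card_product]
  refine Finset.card_le_card_of_injOn (fun p => y⁻¹ * p.1 * p.2) (fun p hp => ?_) ?_
  · have hp := Finset.mem_product.1 hp
    have h1 := hy _ hp.1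
    have h2 := hℓ.mem_ball.1 hp.2
    have h3 := hℓ.mul (y⁻¹ * p.1) p.2
    have h4 := hℓ.inv (p.1⁻¹ * y)
    rw [mul_inv_rev, inv_inv] at h4
    exact hℓ.mem_ball.2 (by change ℓ (y⁻¹ * p.1 * p.2) ≤ _; omega)
  · intro p hp q hq h
    have hp := Finset.mem_product.1 hp
    have hq := Finset.mem_product.1 hq
    simp only [mul_assoc] at h
    have h := mul_left_cancel h
    have h1 : p.1⁻¹ * q.1 = p.2 * q.2⁻¹ := by
      rw [inv_mul_eq_iff_eq_mul, ← mul_assoc, h, mul_inv_cancel_right]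
    have h2 := hZ p.1 hp.1 q.1 hq.1 (by
      rw [h1]
      have := hℓ.mul p.2 q.2⁻¹
      have h3 := hℓ.mem_ball.1 hp.2
      have h4 := hℓ.mem_ball.1 hq.2
      rw [hℓ.inv] at this
      omega)
    rw [h2] at h
    exact Prod.ext h2 (mul_left_cancel h)

lemma IsSeparated.sum_le {r t : ℕ} {K : ℝ} (hℓ : IsPolyLength ℓ C d) {Z : Finset G}
    (hZ : IsSeparated ℓ r Z)
    (hK : ((hℓ.ball (t + r)).card : ℝ) ≤ K * (hℓ.ball r).card) {F : G → ℝ} (hF : ∀ x, 0 ≤ F x)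
    (hs : Summable F) : ∑ z ∈ Z, ∑ u ∈ hℓ.ball t, F (z * u) ≤ K * ∑' y, F y := by
  classical
  have h1 : ∀ z, HasSum (fun y => if ℓ (z⁻¹ * y) ≤ t then F y else 0)
      (∑ u ∈ hℓ.ball t, F (z * u)) := by
    intro z
    have : ∑ u ∈ hℓ.ball t, F (z * u)
        = ∑ y ∈ (hℓ.ball t).image (z * ·), if ℓ (z⁻¹ * y) ≤ t then F y else 0 := by
      rw [Finset.sum_image (fun a _ b _ h => mul_left_cancel h)]
      refine Finset.sum_congr rfl fun u hu => ?_
      rw [if_pos]; simpa using hℓ.mem_ball.1 hu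
    rw [this]
    refine hasSum_sum_of_ne_finset_zero fun y hy => ?_
    rw [if_neg]
    intro h
    exact hy (Finset.mem_image.2 ⟨z⁻¹ * y, hℓ.mem_ball.2 h, by simp⟩)
  have h2 : HasSum (fun y => ∑ z ∈ Z, if ℓ (z⁻¹ * y) ≤ t then F y else 0)
      (∑ z ∈ Z, ∑ u ∈ hℓ.ball t, F (z * u)) := hasSum_sum fun z _ => h1 z
  rw [← tsum_mul_left]
  refine hasSum_le (fun y => ?_) h2 (hs.mul_left K).hasSum
  rw [← Finset.sum_filter, Finset.sum_const, nsmul_eq_mul]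
  refine mul_le_mul_of_nonneg_right ?_ (hF y)
  have h3 : IsSeparated ℓ r (Z.filter fun z => ℓ (z⁻¹ * y) ≤ t) := fun z hz z' hz' =>
    hZ z (Finset.mem_filter.1 hz).1 z' (Finset.mem_filter.1 hz').1
  have h4 := h3.card_mul_le hℓ y (t := t) fun z hz => (Finset.mem_filter.1 hz).2
  have h5 : (0 : ℝ) < (hℓ.ball r).card := by exact_mod_cast hℓ.card_ball_pos r
  have h6 : (((Z.filter fun z => ℓ (z⁻¹ * y) ≤ t).card * (hℓ.ball r).card : ℕ) : ℝ)
      ≤ K * (hℓ.ball r).card := (by exact_mod_cast h4 : _ ≤ ((hℓ.ball (t + r)).card : ℝ)).trans hK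
  push_cast at h6
  exact le_of_mul_le_mul_right h6 h5

lemma HasGrowth.summable_sqGrad {k : ℕ} {f : G → ℂ} (hℓ : IsPolyLength ℓ C d)
    (hf : HasGrowth ℓ k f) {R : ℝ} (hR : 1 ≤ R) :
    HasSum (fun x => cutoff ℓ R x * sqGrad hℓ f x) (∑ s ∈ hℓ.ball 1, gradNorm ℓ R f s) := by
  have := hasSum_sum fun s (_ : s ∈ hℓ.ball 1) => (hf.summable_grad hℓ hR s).hasSum
  refine this.congr_fun fun x => ?_
  rw [sqGrad, Finset.mul_sum]

/-- If `f` has zero average on the balls of a suitable cover, then its energy is dominated by its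
gradient up to a small tail. -/
theorem energyNorm_le_of_average {k : ℕ} {f : G → ℂ} (hℓ : IsPolyLength ℓ C d)
    (hgeo : IsGeodesicLength ℓ) (hf : HasGrowth ℓ k f) {R : ℝ} (hR : 1 ≤ R) {r M : ℕ} (hr : 1 ≤ r)
    {K : ℝ} (hK : 0 ≤ K) (hK1 : ((hℓ.ball (4 * r)).card : ℝ) ≤ K * (hℓ.ball (2 * r)).card)
    (hK2 : ((hℓ.ball (7 * r)).card : ℝ) ≤ K * (hℓ.ball r).card) {Z : Finset G}
    (hZ : IsSeparated ℓ r Z) (hcov : ∀ x ∈ hℓ.ball M, ∃ z ∈ Z, ℓ (z⁻¹ * x) ≤ 2 * r)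
    (havg : ∀ z ∈ Z, ∑ u ∈ hℓ.ball (2 * r), f (z * u) = 0) :
    energyNorm ℓ R f ≤ Real.exp (8 * r / R) * (25 * K ^ 2 * r ^ 2)
        * ∑ s ∈ hℓ.ball 1, gradNorm ℓ R f s
      + Real.exp (-(M / (2 * R))) * energyNorm ℓ (2 * R) f := by
  classical
  have hR0 : 0 < R := by linarith
  set w := cutoff ℓ R
  have hw : ∀ x, 0 < w x := cutoff_pos R
  have hs := hf.summable_energy hℓ hR
  have hs2 := hf.summable_energy hℓ (by linarith : 1 ≤ 2 * R)
  have hg := hf.summable_sqGrad hℓ hR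
  have hloc : ∀ z ∈ Z, ∑ u ∈ hℓ.ball (2 * r), w (z * u) * ‖f (z * u)‖ ^ 2
      ≤ Real.exp (8 * r / R) * (25 * K * r ^ 2)
        * ∑ u ∈ hℓ.ball (6 * r), w (z * u) * sqGrad hℓ f (z * u) := by
    intro z hz
    have hp := poincare hℓ hgeo (fun v => f (z * v)) (2 * r) (havg z hz)
    rw [show 2 * (2 * r) = 4 * r by ring, show 3 * (2 * r) = 6 * r by ring] at hp
    have hgz : ∀ v, sqGrad hℓ (fun v => f (z * v)) v = sqGrad hℓ f (z * v) := fun v => by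
      simp [sqGrad, mul_assoc]
    simp only [hgz] at hp
    set S1 := ∑ v ∈ hℓ.ball (2 * r), ‖f (z * v)‖ ^ 2
    set S2 := ∑ v ∈ hℓ.ball (6 * r), sqGrad hℓ f (z * v)
    have hS2 : 0 ≤ S2 := Finset.sum_nonneg fun _ _ => sqGrad_nonneg hℓ f _
    have hb : (0 : ℝ) < (hℓ.ball (2 * r)).card := by exact_mod_cast hℓ.card_ball_pos _
    have h1 : S1 ≤ 25 * K * r ^ 2 * S2 := by
      refine le_of_mul_le_mul_left ?_ hb
      refine hp.trans ?_
      have hr' : (1 : ℝ) ≤ r := by exact_mod_cast hr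
      have : (2 * ((2 * r : ℕ) : ℝ) + 1) ^ 2 ≤ 25 * (r : ℝ) ^ 2 := by
        push_cast
        calc (2 * (2 * (r : ℝ)) + 1) ^ 2 ≤ (5 * r) ^ 2 := by gcongr; linarith
          _ = _ := by ring
      calc _ ≤ K * (hℓ.ball (2 * r)).card * (25 * (r : ℝ) ^ 2 * S2) := by gcongr
        _ = _ := by ring
    have h2 : ∑ u ∈ hℓ.ball (2 * r), w (z * u) * ‖f (z * u)‖ ^ 2
        ≤ Real.exp (2 * r / R) * w z * S1 := by
      rw [Finset.mul_sum]
      refine Finset.sum_le_sum fun u hu => ?_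
      gcongr
      have := hℓ.le_mul_right z u
      have := hℓ.mem_ball.1 hu
      have := cutoff_le_of_le (ℓ := ℓ) hR0 (x := z) (y := z * u) (n := 2 * r) (by omega)
      push_cast at this; exact this
    have h3 : w z * S2 ≤ Real.exp (6 * r / R)
        * ∑ u ∈ hℓ.ball (6 * r), w (z * u) * sqGrad hℓ f (z * u) := by
      rw [Finset.mul_sum, Finset.mul_sum]
      refine Finset.sum_le_sum fun u hu => ?_
      rw [← mul_assoc]
      refine mul_le_mul_of_nonneg_right ?_ (sqGrad_nonneg hℓ f _)
      have := hℓ.mul z u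
      have := hℓ.mem_ball.1 hu
      have := cutoff_le_of_le (ℓ := ℓ) hR0 (x := z * u) (y := z) (n := 6 * r) (by omega)
      push_cast at this; exact this
    calc _ ≤ Real.exp (2 * r / R) * w z * S1 := h2
      _ ≤ Real.exp (2 * r / R) * w z * (25 * K * r ^ 2 * S2) := by
          have := (hw z).le
          gcongr
      _ = Real.exp (2 * r / R) * (25 * K * r ^ 2) * (w z * S2) := by ring
      _ ≤ Real.exp (2 * r / R) * (25 * K * r ^ 2) * (Real.exp (6 * r / R)
        * ∑ u ∈ hℓ.ball (6 * r), w (z * u) * sqGrad hℓ f (z * u)) := by gcongr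
      _ = (Real.exp (2 * r / R) * Real.exp (6 * r / R)) * (25 * K * r ^ 2)
        * ∑ u ∈ hℓ.ball (6 * r), w (z * u) * sqGrad hℓ f (z * u) := by ring
      _ = _ := by rw [← Real.exp_add]; ring_nf
  have hin : ∑ x ∈ hℓ.ball M, w x * ‖f x‖ ^ 2 ≤ Real.exp (8 * r / R) * (25 * K ^ 2 * r ^ 2)
        * ∑ s ∈ hℓ.ball 1, gradNorm ℓ R f s := by
    calc _ ≤ ∑ z ∈ Z, ∑ u ∈ hℓ.ball (2 * r), w (z * u) * ‖f (z * u)‖ ^ 2 := by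
          rw [← Finset.sum_product']
          refine le_trans (Finset.sum_le_sum_of_subset_of_nonneg (fun x hx => ?_)
            fun x _ _ => mul_nonneg (hw x).le (by positivity))
            (Finset.sum_image_le_of_nonneg (g := fun p : G × G => p.1 * p.2)
              (f := fun x => w x * ‖f x‖ ^ 2)
              fun x _ => mul_nonneg (hw x).le (by positivity))
          obtain ⟨z, hz, hzx⟩ := hcov x hx
          exact Finset.mem_image.2 ⟨(z, z⁻¹ * x),
            Finset.mem_product.2 ⟨hz, hℓ.mem_ball.2 hzx⟩, by simp⟩
      _ ≤ ∑ z ∈ Z, Real.exp (8 * r / R) * (25 * K * r ^ 2)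
        * ∑ u ∈ hℓ.ball (6 * r), w (z * u) * sqGrad hℓ f (z * u) := Finset.sum_le_sum hloc
      _ = Real.exp (8 * r / R) * (25 * K * r ^ 2)
        * ∑ z ∈ Z, ∑ u ∈ hℓ.ball (6 * r), w (z * u) * sqGrad hℓ f (z * u) := by
          rw [Finset.mul_sum]
      _ ≤ Real.exp (8 * r / R) * (25 * K * r ^ 2)
        * (K * ∑' y, w y * sqGrad hℓ f y) := by
          gcongr
          refine hZ.sum_le hℓ (t := 6 * r) (F := fun y => w y * sqGrad hℓ f y) ?_
            (fun x => mul_nonneg (hw x).le (sqGrad_nonneg hℓ f x)) hg.summable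
          rw [show 6 * r + r = 7 * r by ring]; exact hK2
      _ = _ := by rw [hg.tsum_eq]; ring
  have hpt : ∀ x, w x * ‖f x‖ ^ 2 ≤ (if x ∈ hℓ.ball M then w x * ‖f x‖ ^ 2 else 0)
      + Real.exp (-(M / (2 * R))) * (cutoff ℓ (2 * R) x * ‖f x‖ ^ 2) := by
    intro x
    have hpos : 0 ≤ Real.exp (-(M / (2 * R))) * (cutoff ℓ (2 * R) x * ‖f x‖ ^ 2) :=
      mul_nonneg (Real.exp_pos _).le (mul_nonneg (cutoff_pos _ x).le (by positivity))
    split_ifs with hx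
    · linarith
    · rw [hℓ.mem_ball, not_le] at hx
      rw [zero_add, ← mul_assoc]
      gcongr
      simp only [w, cutoff]
      rw [← Real.exp_add]
      gcongr
      have : (M : ℝ) ≤ ℓ x := by exact_mod_cast hx.le
      have h1 : -(M / (2 * R)) + -(ℓ x : ℝ) / (2 * R) - (-(ℓ x : ℝ) / R)
          = (ℓ x - M) / (2 * R) := by field_simp; ring
      have h2 : 0 ≤ ((ℓ x : ℝ) - M) / (2 * R) := div_nonneg (by linarith) (by linarith)
      linarith
  have h1 : HasSum (fun x => if x ∈ hℓ.ball M then w x * ‖f x‖ ^ 2 else 0)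
      (∑ x ∈ hℓ.ball M, w x * ‖f x‖ ^ 2) := by
    rw [← Finset.sum_congr rfl fun x hx => if_pos hx]
    exact hasSum_sum_of_ne_finset_zero fun x hx => if_neg hx
  exact (hasSum_le hpt hs.hasSum (h1.add (hs2.hasSum.mul_left _))).trans (add_le_add_left hin _)

end Poincare

section Determinant

open Matrix
open scoped ComplexOrder MatrixOrder

lemma exists_factor {n : Type*} [Fintype n] [DecidableEq n] {A : Matrix n n ℂ}
    (hA : A.PosSemidef) : ∃ M : Matrix n n ℂ, A = Mᴴ * M := by
  obtain ⟨X, hX, -, rfl⟩ := CFC.exists_sqrt_of_isSelfAdjoint_of_quasispectrumRestricts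
    (a := A) hA.isHermitian (QuasispectrumRestricts.nnreal_of_nonneg hA.nonneg)
  exact ⟨X, by rw [← Matrix.star_eq_conjTranspose, hX.star_eq]⟩

lemma prod_le_avg_pow {D : ℕ} (hD : 0 < D) (z : Fin D → ℝ) (hz : ∀ i, 0 ≤ z i) :
    ∏ i, z i ≤ ((∑ i, z i) / D) ^ D := by
  have hD' : (0 : ℝ) < D := by exact_mod_cast hD
  have h := Real.geom_mean_le_arith_mean Finset.univ (fun _ : Fin D => (1 : ℝ)) z
    (fun _ _ => zero_le_one) (by simpa using hD) (fun i _ => hz i)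
  simp only [Real.rpow_one, Finset.sum_const, Finset.card_univ, Fintype.card_fin, nsmul_eq_mul,
    mul_one, one_mul] at h
  have hp : 0 ≤ ∏ i, z i := Finset.prod_nonneg fun i _ => hz i
  calc _ = ((∏ i, z i) ^ ((D : ℝ)⁻¹)) ^ D := by
        rw [Real.rpow_inv_natCast_pow hp hD.ne']
    _ ≤ _ := pow_le_pow_left₀ (by positivity) h D

lemma det_re_le_trace_pow {D : ℕ} (hD : 0 < D) {A : Matrix (Fin D) (Fin D) ℂ}
    (hA : A.PosSemidef) : A.det.re ≤ (A.trace.re / D) ^ D := by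
  rw [hA.isHermitian.det_eq_prod_eigenvalues, hA.isHermitian.trace_eq_sum_eigenvalues]
  have h := prod_le_avg_pow hD _ hA.eigenvalues_nonneg
  have h1 : (∏ i, (hA.isHermitian.eigenvalues i : ℂ)).re = ∏ i, hA.isHermitian.eigenvalues i := by
    rw [← Complex.ofReal_prod, Complex.ofReal_re]
  have h2 : (∑ i, (hA.isHermitian.eigenvalues i : ℂ)).re = ∑ i, hA.isHermitian.eigenvalues i := by
    rw [← Complex.ofReal_sum, Complex.ofReal_re]
  exact (h1.trans_le h).trans_eq (by rw [← h2]; rfl)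

lemma trace_re_le {D N : ℕ} {A : Matrix (Fin D) (Fin D) ℂ} {η : ℝ} (hη : 0 ≤ η)
    (T : Submodule ℂ (EuclideanSpace ℂ (Fin D))) (hT : D ≤ Module.finrank ℂ T + N)
    (h1 : ∀ x : EuclideanSpace ℂ (Fin D), (inner ℂ x (toEuclideanLin A x)).re ≤ ‖x‖ ^ 2)
    (h2 : ∀ x ∈ T, (inner ℂ x (toEuclideanLin A x)).re ≤ η * ‖x‖ ^ 2) :
    A.trace.re ≤ N + η * D := by
  set t := Module.finrank ℂ T
  have htD : t ≤ D := by
    have := Submodule.finrank_le T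
    simpa using this
  let b1 := stdOrthonormalBasis ℂ T
  let v : Fin D → EuclideanSpace ℂ (Fin D) := fun i => if h : (i : ℕ) < t then b1 ⟨i, h⟩ else 0
  have hv : Orthonormal ℂ (({i : Fin D | (i : ℕ) < t}).domRestrict v) := by
    have hb : Orthonormal ℂ (fun i => (b1 i : EuclideanSpace ℂ (Fin D))) :=
      b1.orthonormal.comp_linearIsometry T.subtypeₗᵢ
    have := hb.comp (fun i : {i : Fin D | (i : ℕ) < t} => (⟨i.1, i.2⟩ : Fin t))
      (fun i j h => by
        have := Fin.ext_iff.1 h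
        exact Subtype.ext (Fin.ext this))
    convert this using 1
    ext i : 1
    have hi : ((i : Fin D) : ℕ) < t := i.2
    simp [v, hi]
  obtain ⟨b, hb⟩ := hv.exists_orthonormalBasis_extension_of_card_eq (by simp)
  have htr : A.trace = ∑ i, inner ℂ (b i) (toEuclideanLin A (b i)) := by
    rw [← LinearMap.trace_eq_sum_inner, toEuclideanLin_eq_toLin_orthonormal,
      Matrix.trace_toLin_eq]
  rw [htr, Complex.re_sum]
  have hle : ∀ i : Fin D, (inner ℂ (b i) (toEuclideanLin A (b i))).re
      ≤ η + if (i : ℕ) < t then 0 else 1 := by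
    intro i
    split_ifs with hi
    · have hm : b i ∈ T := by
        rw [hb i hi]; simp [v, hi]
      have := h2 (b i) hm
      simpa using this
    · have := h1 (b i)
      simp only [OrthonormalBasis.norm_eq_one, one_pow] at this
      linarith
  refine (Finset.sum_le_sum fun i _ => hle i).trans ?_
  rw [Finset.sum_add_distrib, Finset.sum_const, Finset.card_univ, Fintype.card_fin, nsmul_eq_mul]
  have hcount : ∑ i : Fin D, (if (i : ℕ) < t then (0 : ℝ) else 1) ≤ N := by
    have : ∑ i : Fin D, (if (i : ℕ) < t then (0 : ℝ) else 1)
        = ∑ i ∈ Finset.range D, if i < t then (0 : ℝ) else 1 :=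
      Fin.sum_univ_eq_sum_range (fun i => if i < t then (0 : ℝ) else 1) D
    rw [this]
    have h3 : ∀ i ∈ Finset.range D, (if i < t then (0 : ℝ) else 1) = if i ∈ Finset.Ico t D then 1 else 0 := by
      intro i hi
      have := Finset.mem_range.1 hi
      by_cases h : i < t
      · simp [h]
      · simp [h, this, not_lt.1 h]
    rw [Finset.sum_congr rfl h3, Finset.sum_ite_mem, Finset.inter_eq_right.2 (by
      intro i hi; simp at hi ⊢; exact hi.2)]
    simp only [Finset.sum_const, Nat.card_Ico, nsmul_eq_mul, mul_one]
    exact_mod_cast (by omega : D - t ≤ N)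
  linarith

/-- If `A ≤ B` and `A ≤ η B` on a subspace of codimension at most `N`, then the determinant of `A`
is much smaller than that of `B`. -/
lemma det_re_le {D N : ℕ} (hD : 0 < D) {A B : Matrix (Fin D) (Fin D) ℂ} (hA : A.PosSemidef)
    (hB : B.PosDef) {η : ℝ} (hη : 0 ≤ η) (T : Submodule ℂ (Fin D → ℂ))
    (hT : D ≤ Module.finrank ℂ T + N)
    (h1 : ∀ c : Fin D → ℂ, (star c ⬝ᵥ (A *ᵥ c)).re ≤ (star c ⬝ᵥ (B *ᵥ c)).re)
    (h2 : ∀ c ∈ T, (star c ⬝ᵥ (A *ᵥ c)).re ≤ η * (star c ⬝ᵥ (B *ᵥ c)).re) :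
    A.det.re ≤ ((N + η * D) / D) ^ D * B.det.re := by
  obtain ⟨M, hM⟩ := exists_factor hB.posSemidef
  have hdetB : B.det ≠ 0 := hB.det_pos.ne'
  have hMu : IsUnit M.det := by
    rw [isUnit_iff_ne_zero]; intro h
    apply hdetB; rw [hM, det_mul, h, mul_zero]
  set P := M⁻¹
  have hMP : M * P = 1 := mul_nonsing_inv M hMu
  have hPM : P * M = 1 := nonsing_inv_mul M hMu
  set A' := Pᴴ * A * P
  have hA' : A'.PosSemidef := hA.conjTranspose_mul_mul_same P
  have hq : ∀ (X : Matrix (Fin D) (Fin D) ℂ) (c : Fin D → ℂ),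
      star c ⬝ᵥ ((Pᴴ * X * P) *ᵥ c) = star (P *ᵥ c) ⬝ᵥ (X *ᵥ (P *ᵥ c)) := by
    intro X c
    rw [star_mulVec, ← mulVec_mulVec, ← mulVec_mulVec, dotProduct_mulVec]
  have hBP : Pᴴ * B * P = 1 := by
    rw [hM, ← mul_assoc, ← conjTranspose_mul, hMP, conjTranspose_one, one_mul, hMP]
  have hin : ∀ x : EuclideanSpace ℂ (Fin D), inner ℂ x (toEuclideanLin A' x)
      = star (P *ᵥ x.ofLp) ⬝ᵥ (A *ᵥ (P *ᵥ x.ofLp)) := by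
    intro x
    rw [← hq, dotProduct_comm]; rfl
  have hnorm : ∀ x : EuclideanSpace ℂ (Fin D),
      (star (P *ᵥ x.ofLp) ⬝ᵥ (B *ᵥ (P *ᵥ x.ofLp))).re = ‖x‖ ^ 2 := by
    intro x
    rw [← hq, hBP, one_mulVec, dotProduct_comm]
    exact (inner_self_eq_norm_sq (𝕜 := ℂ) x)
  let e : EuclideanSpace ℂ (Fin D) →ₗ[ℂ] (Fin D → ℂ) :=
    P.mulVecLin ∘ₗ (WithLp.linearEquiv 2 ℂ (Fin D → ℂ)).toLinearMap
  have hdet : A.det.re = B.det.re * A'.det.re := by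
    have hAd : A = Mᴴ * A' * M := by
      simp only [A']
      calc A = (P * M)ᴴ * A * (P * M) := by rw [hPM]; simp
        _ = _ := by rw [conjTranspose_mul]; simp only [mul_assoc]
    have hBim : B.det.im = 0 := (Complex.lt_def.1 hB.det_pos).2.symm
    have : A.det = B.det * A'.det := by
      have hBd : B.det = Mᴴ.det * M.det := by rw [← det_mul]; exact congrArg det hM
      rw [hBd]
      refine (congrArg det hAd).trans ?_
      rw [det_mul, det_mul]; ring
    rw [this, Complex.mul_re, hBim, zero_mul, sub_zero]
  have htr : A'.trace.re ≤ N + η * D := by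
    refine trace_re_le hη (T.comap e) (hT.trans ?_) (fun x => ?_) (fun x hx => ?_)
    · have hinj : Function.Surjective e := by
        intro c
        refine ⟨WithLp.toLp 2 (M *ᵥ c), ?_⟩
        change P *ᵥ (M *ᵥ c) = c
        rw [mulVec_mulVec, hPM, one_mulVec]
      have h3 : T.map (LinearMap.id) ≤ (T.comap e).map e := by
        rw [Submodule.map_comap_eq_of_surjective hinj, Submodule.map_id]
      rw [Submodule.map_id] at h3
      have := (Submodule.finrank_mono h3).trans (Submodule.finrank_map_le e (T.comap e))
      omega
    · rw [hin, ← hnorm]; exact h1 _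
    · rw [hin, ← hnorm]; exact h2 _ hx
  have hBp : 0 ≤ B.det.re := (Complex.lt_def.1 hB.det_pos).1.le
  have hD' : (0 : ℝ) < D := by exact_mod_cast hD
  have htr0 : 0 ≤ A'.trace.re := (Complex.le_def.1 hA'.trace_nonneg).1
  rw [hdet, mul_comm]
  refine mul_le_mul_of_nonneg_right ((det_re_le_trace_pow hD hA').trans ?_) hBp
  gcongr

end Determinant

section Pigeonhole

lemma sum_shift_sub_le {u : ℕ → ℝ} (hu : Monotone u) (a n : ℕ) :
    ∑ j ∈ Finset.range n, (u (j + a) - u j) ≤ a * (u (n + a) - u 0) := by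
  induction a with
  | zero => simp
  | succ a ih =>
    have h1 : ∑ j ∈ Finset.range n, (u (j + (a + 1)) - u j)
        = ∑ j ∈ Finset.range n, (u (j + a) - u j)
          + ∑ j ∈ Finset.range n, (u (j + 1 + a) - u (j + a)) := by
      rw [← Finset.sum_add_distrib]
      refine Finset.sum_congr rfl fun j _ => ?_
      rw [show j + (a + 1) = j + 1 + a by ring]; ring
    rw [h1, Finset.sum_range_sub (fun j => u (j + a))]
    have h2 : u (n + a) ≤ u (n + (a + 1)) := hu (by omega)
    have h3 : u 0 ≤ u (0 + a) := hu (by omega)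
    push_cast
    have : (0 : ℝ) ≤ a := by positivity
    nlinarith

/-- Three monotone sequences with linear growth simultaneously have small increments at some
arbitrarily large time. -/
lemma exists_small_increments {v δ : ℕ → ℝ} (hv : Monotone v) (hδ : Monotone δ) {α γ β : ℝ}
    (hα : 0 < α) (hγ : 0 < γ) (hvb : ∀ n : ℕ, v n ≤ α * n + β) (hδb : ∀ n : ℕ, δ n ≤ γ * n + β)
    (a j₀ : ℕ) : ∃ j ≥ j₀, v (j + 3) - v j < 12 * α ∧ v (j + a) - v j < 4 * (a + 1) * α ∧
      δ (j + 1) - δ j < 4 * γ := by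
  by_contra! hcon
  set v' : ℕ → ℝ := fun j => v (j + j₀)
  set δ' : ℕ → ℝ := fun j => δ (j + j₀)
  have hv' : Monotone v' := fun i j h => hv (by omega)
  have hδ' : Monotone δ' := fun i j h => hδ (by omega)
  have hge : ∀ j, 1 ≤ (v' (j + 3) - v' j) / (12 * α) + (v' (j + a) - v' j) / (4 * (a + 1) * α)
      + (δ' (j + 1) - δ' j) / (4 * γ) := by
    intro j
    have p1 : 0 ≤ (v' (j + 3) - v' j) / (12 * α) :=
      div_nonneg (sub_nonneg.2 (hv' (by omega))) (by positivity)
    have p2 : 0 ≤ (v' (j + a) - v' j) / (4 * (a + 1) * α) :=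
      div_nonneg (sub_nonneg.2 (hv' (by omega))) (by positivity)
    have p3 : 0 ≤ (δ' (j + 1) - δ' j) / (4 * γ) :=
      div_nonneg (sub_nonneg.2 (hδ' (by omega))) (by positivity)
    by_cases c1 : v' (j + 3) - v' j < 12 * α
    · by_cases c2 : v' (j + a) - v' j < 4 * (a + 1) * α
      · have := hcon (j + j₀) (by omega) (by
          simpa [v', add_assoc, add_comm, add_left_comm] using c1) (by
          simpa [v', add_assoc, add_comm, add_left_comm] using c2)
        have h3 : 4 * γ ≤ δ' (j + 1) - δ' j := by
          simpa [δ', add_assoc, add_comm, add_left_comm] using this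
        have : 1 ≤ (δ' (j + 1) - δ' j) / (4 * γ) := by rwa [one_le_div (by positivity)]
        linarith
      · have : 1 ≤ (v' (j + a) - v' j) / (4 * (a + 1) * α) := by
          rw [one_le_div (by positivity)]; exact not_lt.1 c2
        linarith
    · have : 1 ≤ (v' (j + 3) - v' j) / (12 * α) := by
        rw [one_le_div (by positivity)]; exact not_lt.1 c1
      linarith
  have hsum : ∀ n : ℕ, (n : ℝ) ≤ 3 * (v' (n + 3) - v' 0) / (12 * α)
      + a * (v' (n + a) - v' 0) / (4 * (a + 1) * α) + 1 * (δ' (n + 1) - δ' 0) / (4 * γ) := by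
    intro n
    have h1 := Finset.sum_le_sum fun j (_ : j ∈ Finset.range n) => hge j
    rw [Finset.sum_const, Finset.card_range, nsmul_eq_mul, mul_one, Finset.sum_add_distrib,
      Finset.sum_add_distrib, ← Finset.sum_div, ← Finset.sum_div, ← Finset.sum_div] at h1
    refine h1.trans ?_
    have e1 := sum_shift_sub_le hv' 3 n
    have e2 := sum_shift_sub_le hv' a n
    have e3 := sum_shift_sub_le hδ' 1 n
    push_cast at e1 e3
    gcongr
  set β₁ := α * (j₀ + 3 + a) + |β| + |v' 0|
  set β₂ := γ * (j₀ + 1) + |β| + |δ' 0|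
  have hb1 : ∀ n : ℕ, v' (n + 3) - v' 0 ≤ α * n + β₁ := by
    intro n
    have := hvb (n + 3 + j₀)
    push_cast at this
    have h1 := le_abs_self β
    have h2 := neg_abs_le (v' 0)
    have h3 : 0 ≤ α * a := by positivity
    simp only [β₁, v'] at *
    nlinarith
  have hb2 : ∀ n : ℕ, v' (n + a) - v' 0 ≤ α * n + β₁ := by
    intro n
    have := hvb (n + a + j₀)
    push_cast at this
    have h1 := le_abs_self β
    have h2 := neg_abs_le (v' 0)
    simp only [β₁, v'] at *
    nlinarith
  have hb3 : ∀ n : ℕ, δ' (n + 1) - δ' 0 ≤ γ * n + β₂ := by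
    intro n
    have := hδb (n + 1 + j₀)
    push_cast at this
    have h1 := le_abs_self β
    have h2 := neg_abs_le (δ' 0)
    simp only [β₂, δ'] at *
    nlinarith
  have hβ₁ : 0 ≤ β₁ := by positivity
  have hlin : ∀ n : ℕ, (n : ℝ) ≤ 3 / 4 * n + (β₁ / (2 * α) + β₂ / (4 * γ)) := by
    intro n
    have i1 : 3 * (v' (n + 3) - v' 0) / (12 * α) ≤ 3 * (α * n + β₁) / (12 * α) := by
      gcongr; exact hb1 n
    have i2 : a * (v' (n + a) - v' 0) / (4 * (a + 1) * α)
        ≤ (a + 1) * (α * n + β₁) / (4 * (a + 1) * α) := by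
      have : (0 : ℝ) ≤ a := by positivity
      have h0 : 0 ≤ v' (n + a) - v' 0 := sub_nonneg.2 (hv' (by omega))
      have := hb2 n
      gcongr
      linarith
    have i3 : 1 * (δ' (n + 1) - δ' 0) / (4 * γ) ≤ 1 * (γ * n + β₂) / (4 * γ) := by
      gcongr; exact hb3 n
    refine (hsum n).trans ((add_le_add (add_le_add i1 i2) i3).trans (le_of_eq ?_))
    have : (a : ℝ) + 1 ≠ 0 := by positivity
    field_simp
    ring
  obtain ⟨n, hn⟩ := exists_nat_gt (4 * (β₁ / (2 * α) + β₂ / (4 * γ)))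
  have := hlin n
  linarith

end Pigeonhole

section HarmonicSpace

variable {G : Type*} [Group G] {ℓ : G → ℕ} {C d : ℕ} {m : G → ℝ}

/-- The space of functions of polynomial growth of degree at most `k`. -/
def growthSpace (ℓ : G → ℕ) (k : ℕ) : Submodule ℂ (G → ℂ) where
  carrier := {f | HasGrowth ℓ k f}
  add_mem' hf hg := hf.add hg
  zero_mem' := HasGrowth.zero
  smul_mem' a _ hf := hf.smul a

/-- The space of harmonic functions of polynomial growth of degree at most `k`. -/
def harmSpace (hℓ : IsPolyLength ℓ C d) (hm : IsCourteousWeight ℓ m) (k : ℕ) :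
    Submodule ℂ (G → ℂ) where
  carrier := {f | HasGrowth ℓ k f ∧ IsHarm m f}
  add_mem' := by
    rintro f g ⟨hf, hf'⟩ ⟨hg, hg'⟩
    refine ⟨hf.add hg, fun x => ?_⟩
    simp only [Pi.add_apply, smul_add]
    rw [Summable.tsum_add (hf.summable hℓ hm x) (hg.summable hℓ hm x), ← hf' x, ← hg' x]
  zero_mem' := ⟨HasGrowth.zero, fun x => by simp⟩
  smul_mem' := by
    rintro a f ⟨hf, hf'⟩
    refine ⟨hf.smul a, fun x => ?_⟩
    simp only [Pi.smul_apply, smul_comm _ a]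
    rw [tsum_const_smul'', ← hf' x]

lemma mem_harmSpace (hℓ : IsPolyLength ℓ C d) (hm : IsCourteousWeight ℓ m) {k : ℕ} {f : G → ℂ} :
    f ∈ harmSpace hℓ hm k ↔ HasGrowth ℓ k f ∧ IsHarm m f := Iff.rfl

open Matrix
open scoped ComplexOrder MatrixOrder ComplexConjugate

/-- The Gram matrix of a family for the weighted `L²` form at scale `R`. -/
def gram {ι : Type*} (ℓ : G → ℕ) (R : ℝ) (f : ι → G → ℂ) : Matrix ι ι ℂ :=
  Matrix.of fun i j => ∑' x, (cutoff ℓ R x : ℂ) * (conj (f i x) * f j x)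

variable {ι : Type*} [Fintype ι] {k : ℕ} {f : ι → G → ℂ} {R : ℝ}

lemma summable_gram (hℓ : IsPolyLength ℓ C d) {f g : G → ℂ} (hf : HasGrowth ℓ k f)
    (hg : HasGrowth ℓ k g) (hR : 1 ≤ R) :
    Summable fun x => (cutoff ℓ R x : ℂ) * (conj (f x) * g x) := by
  refine Summable.of_norm_bounded
    ((hf.summable_energy hℓ hR).add (hg.summable_energy hℓ hR)) fun x => ?_
  have hw := (cutoff_pos (ℓ := ℓ) R x).le
  rw [norm_mul, norm_mul, Complex.norm_real, Real.norm_of_nonneg hw, Complex.norm_conj, ← mul_add]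
  refine mul_le_mul_of_nonneg_left ?_ hw
  nlinarith [sq_nonneg (‖f x‖ - ‖g x‖), sq_nonneg (‖f x‖), sq_nonneg (‖g x‖)]

lemma sum_smul_mem_growth (hf : ∀ i, HasGrowth ℓ k (f i)) (c : ι → ℂ) :
    HasGrowth ℓ k (∑ i, c i • f i) :=
  (growthSpace ℓ k).sum_mem fun i _ => (growthSpace ℓ k).smul_mem _ (hf i)

lemma gram_form (hℓ : IsPolyLength ℓ C d) (hf : ∀ i, HasGrowth ℓ k (f i)) (hR : 1 ≤ R)
    (c : ι → ℂ) :
    star c ⬝ᵥ (gram ℓ R f *ᵥ c) = (energyNorm ℓ R (∑ i, c i • f i) : ℂ) := by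
  have h1 : ∀ x, ((cutoff ℓ R x * ‖(∑ i, c i • f i) x‖ ^ 2 : ℝ) : ℂ)
      = ∑ i, ∑ j, conj (c i) * ((cutoff ℓ R x : ℂ) * (conj (f i x) * f j x) * c j) := by
    intro x
    push_cast
    rw [← Complex.conj_mul', Finset.sum_apply, map_sum, Finset.sum_mul_sum, Finset.mul_sum]
    refine Finset.sum_congr rfl fun i _ => ?_
    rw [Finset.mul_sum]
    refine Finset.sum_congr rfl fun j _ => ?_
    simp only [Pi.smul_apply, smul_eq_mul, map_mul]
    ring
  rw [energyNorm, Complex.ofReal_tsum]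
  simp_rw [h1]
  have hs : ∀ i j, Summable fun x => conj (c i) * ((cutoff ℓ R x : ℂ) * (conj (f i x) * f j x) * c j) :=
    fun i j => ((summable_gram hℓ (hf i) (hf j) hR).mul_right _).mul_left _
  rw [Summable.tsum_finsetSum fun i _ => summable_sum fun j _ => hs i j]
  refine Finset.sum_congr rfl fun i _ => ?_
  rw [Summable.tsum_finsetSum fun j _ => hs i j, mulVec, dotProduct, Finset.mul_sum]
  refine Finset.sum_congr rfl fun j _ => ?_
  rw [tsum_mul_left, tsum_mul_right]
  rfl

lemma gram_isHermitian : (gram ℓ R f).IsHermitian := by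
  ext i j
  simp only [gram, conjTranspose_apply, of_apply]
  rw [← starRingEnd_apply, Complex.conj_tsum]
  refine tsum_congr fun x => ?_
  simp only [map_mul, Complex.conj_ofReal, Complex.conj_conj]
  ring

lemma gram_posSemidef (hℓ : IsPolyLength ℓ C d) (hf : ∀ i, HasGrowth ℓ k (f i)) (hR : 1 ≤ R) :
    (gram ℓ R f).PosSemidef :=
  PosSemidef.of_dotProduct_mulVec_nonneg gram_isHermitian fun c => by
    rw [gram_form hℓ hf hR]
    exact_mod_cast energyNorm_nonneg R _

lemma energyNorm_pos (hℓ : IsPolyLength ℓ C d) {f : G → ℂ} (hf : HasGrowth ℓ k f) (hR : 1 ≤ R)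
    (h0 : f ≠ 0) : 0 < energyNorm ℓ R f := by
  obtain ⟨x, hx⟩ := Function.ne_iff.1 h0
  have hx' : 0 < ‖f x‖ := norm_pos_iff.2 hx
  refine (hf.summable_energy hℓ hR).tsum_pos
    (fun x => mul_nonneg (cutoff_pos R x).le (by positivity)) x ?_
  exact mul_pos (cutoff_pos R x) (by positivity)

lemma gram_posDef (hℓ : IsPolyLength ℓ C d) (hf : ∀ i, HasGrowth ℓ k (f i)) (hR : 1 ≤ R)
    (hli : LinearIndependent ℂ f) : (gram ℓ R f).PosDef :=
  PosDef.of_dotProduct_mulVec_pos gram_isHermitian fun c hc => by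
    rw [gram_form hℓ hf hR]
    have : ∑ i, c i • f i ≠ 0 := fun h =>
      hc (funext (Fintype.linearIndependent_iff.1 hli c h))
    exact_mod_cast energyNorm_pos hℓ (sum_smul_mem_growth hf c) hR this

lemma energyNorm_mono (hℓ : IsPolyLength ℓ C d) {f : G → ℂ} (hf : HasGrowth ℓ k f) (hR : 1 ≤ R)
    {R' : ℝ} (hRR : R ≤ R') : energyNorm ℓ R f ≤ energyNorm ℓ R' f := by
  refine Summable.tsum_le_tsum (fun x => ?_) (hf.summable_energy hℓ hR)
    (hf.summable_energy hℓ (hR.trans hRR))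
  refine mul_le_mul_of_nonneg_right ?_ (by positivity)
  unfold cutoff
  rw [neg_div, neg_div]
  gcongr

lemma gram_diag (i : ι) : (gram ℓ R f i i).re = energyNorm ℓ R (f i) := by
  rw [energyNorm, ← Complex.ofReal_re (∑' x, _), Complex.ofReal_tsum]
  simp only [gram, of_apply]
  congr 1
  refine tsum_congr fun x => ?_
  push_cast
  rw [← Complex.conj_mul']

lemma gram_trace : (gram ℓ R f).trace.re = ∑ i, energyNorm ℓ R (f i) := by
  rw [trace, Complex.re_sum]
  exact Finset.sum_congr rfl fun i _ => gram_diag i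

lemma gram_det_pos {D : ℕ} {f : Fin D → G → ℂ} (hℓ : IsPolyLength ℓ C d)
    (hf : ∀ i, HasGrowth ℓ k (f i)) (hR : 1 ≤ R) (hli : LinearIndependent ℂ f) :
    0 < (gram ℓ R f).det.re :=
  (Complex.lt_def.1 (gram_posDef hℓ hf hR hli).det_pos).1

lemma gram_det_mono {D : ℕ} {f : Fin D → G → ℂ} (hℓ : IsPolyLength ℓ C d)
    (hf : ∀ i, HasGrowth ℓ k (f i)) (hR : 1 ≤ R) (hli : LinearIndependent ℂ f) (hD : 0 < D)
    {R' : ℝ} (hRR : R ≤ R') : (gram ℓ R f).det.re ≤ (gram ℓ R' f).det.re := by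
  have h1 : ∀ c : Fin D → ℂ, (star c ⬝ᵥ (gram ℓ R f *ᵥ c)).re
      ≤ (star c ⬝ᵥ (gram ℓ R' f *ᵥ c)).re := fun c => by
    rw [gram_form hℓ hf hR, gram_form hℓ hf (hR.trans hRR)]
    exact energyNorm_mono hℓ (sum_smul_mem_growth hf c) hR hRR
  have hD' : (D : ℝ) ≠ 0 := by exact_mod_cast hD.ne'
  have := det_re_le (N := 0) hD (gram_posSemidef hℓ hf hR)
    (gram_posDef hℓ hf (hR.trans hRR) hli) zero_le_one ⊤ (by simp) h1
    (fun c _ => by rw [one_mul]; exact h1 c)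
  simpa [div_self hD'] using this

/-- A single scale at which the doubling, covering and energy increments are controlled
contradicts linear independence of a large family. -/
lemma gram_det_le {D : ℕ} {f : Fin D → G → ℂ} (hℓ : IsPolyLength ℓ C d)
    (hgeo : IsGeodesicLength ℓ) (hD : 0 < D) (hf : ∀ i, HasGrowth ℓ k (f i))
    (hli : LinearIndependent ℂ f) (hR : 1 ≤ R) {r M : ℕ} (hr : 1 ≤ r) {K : ℝ} (hK : 0 ≤ K)
    (hK1 : ((hℓ.ball (4 * r)).card : ℝ) ≤ K * (hℓ.ball (2 * r)).card)
    (hK2 : ((hℓ.ball (7 * r)).card : ℝ) ≤ K * (hℓ.ball r).card) {A : ℝ}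
    (hgrad : ∀ c : Fin D → ℂ, ∑ s ∈ hℓ.ball 1, gradNorm ℓ R (∑ i, c i • f i) s
      ≤ A / R ^ 2 * energyNorm ℓ R (∑ i, c i • f i))
    (hA : Real.exp (8 * r / R) * (25 * K ^ 2 * r ^ 2) * (A / R ^ 2) ≤ 1 / 2) {η : ℝ}
    (hη : 2 * Real.exp (-(M / (2 * R))) ≤ η)
    (hN : ((hℓ.ball (M + r)).card : ℝ) ≤ η * D * (hℓ.ball r).card) :
    (gram ℓ R f).det.re ≤ (2 * η) ^ D * (gram ℓ (2 * R) f).det.re := by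
  have hR2 : 1 ≤ 2 * R := by linarith
  have hη0 : 0 ≤ η := le_trans (by positivity) hη
  have hD' : (0 : ℝ) < D := by exact_mod_cast hD
  obtain ⟨Z, hZM, hZ, hcov⟩ := exists_separated_cover hℓ M r
  have hcard : (Z.card : ℝ) ≤ η * D := by
    have h1 := hZ.card_mul_le hℓ 1 (t := M) fun z hz => by
      rw [mul_one, hℓ.inv]; exact hℓ.mem_ball.1 (hZM hz)
    have h2 : (0 : ℝ) < (hℓ.ball r).card := by exact_mod_cast hℓ.card_ball_pos r
    have h3 : (Z.card : ℝ) * (hℓ.ball r).card ≤ (hℓ.ball (M + r)).card := by exact_mod_cast h1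
    exact le_of_mul_le_mul_right (h3.trans hN) h2
  let Φ : (Fin D → ℂ) →ₗ[ℂ] (Z → ℂ) :=
    { toFun := fun c z => ∑ u ∈ hℓ.ball (2 * r), (∑ i, c i • f i) (z * u)
      map_add' := fun a b => by
        ext z
        simp [add_mul, Finset.sum_add_distrib]
      map_smul' := fun a b => by
        ext z
        simp only [Finset.sum_apply, Pi.smul_apply, smul_eq_mul, RingHom.id_apply, Finset.mul_sum,
          mul_assoc] }
  have hT : D ≤ Module.finrank ℂ (LinearMap.ker Φ) + Z.card := by
    have h1 := LinearMap.finrank_range_add_finrank_ker Φ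
    have h2 := Submodule.finrank_le (LinearMap.range Φ)
    simp only [Module.finrank_fintype_fun_eq_card, Fintype.card_fin, Fintype.card_coe] at h1 h2
    omega
  refine (det_re_le hD (gram_posSemidef hℓ hf hR) (gram_posDef hℓ hf hR2 hli) hη0
    (LinearMap.ker Φ) hT (fun c => ?_) fun c hc => ?_).trans ?_
  · rw [gram_form hℓ hf hR, gram_form hℓ hf hR2]
    exact energyNorm_mono hℓ (sum_smul_mem_growth hf c) hR (by linarith)
  · rw [gram_form hℓ hf hR, gram_form hℓ hf hR2, Complex.ofReal_re, Complex.ofReal_re]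
    have hg := sum_smul_mem_growth hf c
    have h1 := energyNorm_le_of_average hℓ hgeo hg hR hr hK hK1 hK2 hZ hcov
      (fun z hz => congrFun (LinearMap.mem_ker.1 hc) ⟨z, hz⟩)
    have h2 : Real.exp (8 * r / R) * (25 * K ^ 2 * r ^ 2)
        * ∑ s ∈ hℓ.ball 1, gradNorm ℓ R (∑ i, c i • f i) s
        ≤ 1 / 2 * energyNorm ℓ R (∑ i, c i • f i) := by
      calc _ ≤ Real.exp (8 * r / R) * (25 * K ^ 2 * r ^ 2)
            * (A / R ^ 2 * energyNorm ℓ R (∑ i, c i • f i)) := by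
            gcongr; exact hgrad c
        _ = Real.exp (8 * r / R) * (25 * K ^ 2 * r ^ 2) * (A / R ^ 2)
            * energyNorm ℓ R (∑ i, c i • f i) := by ring
        _ ≤ _ := mul_le_mul_of_nonneg_right hA (energyNorm_nonneg _ _)
    have h3 := energyNorm_nonneg (ℓ := ℓ) (2 * R) (∑ i, c i • f i)
    have h4 := mul_le_mul_of_nonneg_right hη h3
    linarith
  · refine mul_le_mul_of_nonneg_right ?_ (gram_det_pos hℓ hf hR2 hli).le
    gcongr
    rw [div_le_iff₀ hD']
    linarith

lemma IsPolyLength.log_card_ball_le (hℓ : IsPolyLength ℓ C d) :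
    ∃ α > 0, ∃ β, ∀ n : ℕ, Real.log (hℓ.ball (2 ^ n)).card ≤ α * n + β := by
  have hC : (1 : ℝ) ≤ C := by
    have h1 := hℓ.card_ball 0
    have h2 := hℓ.card_ball_pos 0
    have : 1 ≤ C := by
      simp at h1; omega
    exact_mod_cast this
  refine ⟨d * Real.log 2 + 1, by positivity, Real.log C + d * Real.log 2, fun n => ?_⟩
  have hp : (0 : ℝ) < (hℓ.ball (2 ^ n)).card := by exact_mod_cast hℓ.card_ball_pos _
  have h1 : ((hℓ.ball (2 ^ n)).card : ℝ) ≤ C * (2 ^ (n + 1)) ^ d := by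
    have h2 : ((hℓ.ball (2 ^ n)).card : ℝ) ≤ C * (2 ^ n + 1) ^ d := by
      exact_mod_cast hℓ.card_ball (2 ^ n)
    refine h2.trans ?_
    gcongr
    have : (1 : ℝ) ≤ 2 ^ n := one_le_pow₀ (by norm_num)
    rw [pow_succ]; linarith
  refine (Real.log_le_log hp h1).trans ?_
  rw [Real.log_mul (by positivity) (by positivity), Real.log_pow, Real.log_pow]
  push_cast
  have : (0 : ℝ) ≤ n := by positivity
  nlinarith

lemma HasGrowth.log_gram_det_le {D : ℕ} {f : Fin D → G → ℂ} (hℓ : IsPolyLength ℓ C d)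
    (hf : ∀ i, HasGrowth ℓ k (f i)) (hD : 0 < D) (hli : LinearIndependent ℂ f) (b : ℕ) :
    ∃ β, ∀ n : ℕ, Real.log (gram ℓ (2 ^ (b + n)) f).det.re / D
      ≤ (2 * k + d + 2) * Real.log 2 * n + β := by
  choose A hA hAR using fun i => (hf i).energy_bound hℓ
  have : Nonempty (Fin D) := ⟨⟨0, hD⟩⟩
  have hS : 0 < ∑ i, A i := Finset.sum_pos (fun i _ => hA i) Finset.univ_nonempty
  have hD' : (0 : ℝ) < D := by exact_mod_cast hD
  refine ⟨Real.log ((∑ i, A i) / D) + (2 * k + d + 2) * Real.log 2 * b, fun n => ?_⟩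
  have hR : (1 : ℝ) ≤ 2 ^ (b + n) := one_le_pow₀ (by norm_num)
  have h1 : (gram ℓ (2 ^ (b + n)) f).det.re
      ≤ (((∑ i, A i) / D) * (2 ^ (b + n)) ^ (2 * k + d + 2)) ^ D := by
    refine (det_re_le_trace_pow hD (gram_posSemidef hℓ hf hR)).trans ?_
    rw [gram_trace]
    refine pow_le_pow_left₀ (div_nonneg (Finset.sum_nonneg fun i _ => energyNorm_nonneg _ _)
      hD'.le) ?_ D
    rw [div_mul_eq_mul_div, Finset.sum_mul]
    gcongr with i
    exact (hAR i _ hR).2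
  have h2 := Real.log_le_log (gram_det_pos hℓ hf hR hli) h1
  rw [Real.log_pow, Real.log_mul (by positivity) (by positivity), Real.log_pow, Real.log_pow] at h2
  rw [div_le_iff₀ hD']
  push_cast at h2
  linarith

theorem finiteDimensional_harmSpace (hℓ : IsPolyLength ℓ C d) (hgeo : IsGeodesicLength ℓ)
    (hm : IsCourteousWeight ℓ m) (k : ℕ) : FiniteDimensional ℂ (harmSpace hℓ hm k) := by
  obtain ⟨α, hα, β, hv⟩ := hℓ.log_card_ball_le
  obtain ⟨A, hA, R₀, hR₀, hgrad⟩ := grad_sum_le hℓ hm (hℓ.ball 1)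
  set γ : ℝ := (2 * k + d + 2) * Real.log 2
  have hγ : 0 < γ := by positivity
  set K := Real.exp (12 * α)
  obtain ⟨b, hb⟩ := pow_unbounded_of_one_lt (50 * Real.exp 8 * K ^ 2 * A)
    (by norm_num : (1 : ℝ) < 2)
  obtain ⟨c, hc⟩ := pow_unbounded_of_one_lt (2 * (Real.log 4 + 4 * γ))
    (by norm_num : (1 : ℝ) < 2)
  set η := 2 * Real.exp (-((2 : ℝ) ^ c / 2))
  have hη : 0 < η := by positivity
  have h2η : Real.log (2 * η) < -(4 * γ) := by
    have : 2 * η = 4 * Real.exp (-((2 : ℝ) ^ c / 2)) := by simp only [η]; ring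
    rw [this, Real.log_mul (by norm_num) (Real.exp_ne_zero _), Real.log_exp]
    linarith
  set a := b + c + 1
  obtain ⟨D, hDη⟩ := exists_nat_gt (Real.exp (4 * (a + 1) * α) / η)
  have hD' : (0 : ℝ) < D := lt_trans (by positivity) hDη
  have hD : 0 < D := by exact_mod_cast hD'
  rw [div_lt_iff₀ hη] at hDη
  have key : ∀ f : Fin D → G → ℂ, (∀ i, f i ∈ harmSpace hℓ hm k) → ¬ LinearIndependent ℂ f := by
    intro f hf hli
    have hfg : ∀ i, HasGrowth ℓ k (f i) := fun i => (hf i).1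
    obtain ⟨β', hδ⟩ := HasGrowth.log_gram_det_le hℓ hfg hD hli b
    set v : ℕ → ℝ := fun n => Real.log (hℓ.ball (2 ^ n)).card
    set δ : ℕ → ℝ := fun n => Real.log (gram ℓ (2 ^ (b + n)) f).det.re / D
    have hcp : ∀ n, (0 : ℝ) < (hℓ.ball n).card := fun n => by exact_mod_cast hℓ.card_ball_pos n
    have hone : ∀ n : ℕ, (1 : ℝ) ≤ 2 ^ n := fun n => one_le_pow₀ (by norm_num)
    have hvm : Monotone v := fun i j h => Real.log_le_log (hcp _) (by
      exact_mod_cast Finset.card_le_card (hℓ.ball_mono (Nat.pow_le_pow_right (by norm_num) h)))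
    have hδm : Monotone δ := fun i j h => by
      refine div_le_div_of_nonneg_right (Real.log_le_log (gram_det_pos hℓ hfg (hone _) hli)
        (gram_det_mono hℓ hfg (hone _) hli hD ?_)) hD'.le
      exact pow_le_pow_right₀ (by norm_num) (by omega)
    obtain ⟨j₀, hj₀⟩ := pow_unbounded_of_one_lt R₀ (by norm_num : (1 : ℝ) < 2)
    obtain ⟨j, hj, h3, ha, h1⟩ := exists_small_increments hvm hδm hα hγ (β := max β β')
      (fun n => (hv n).trans (by gcongr; exact le_max_left _ _))
      (fun n => (hδ n).trans (by gcongr; exact le_max_right _ _)) a j₀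
    have hball : ∀ (p q : ℕ) (t : ℝ), v p - v q < t →
        ((hℓ.ball (2 ^ p)).card : ℝ) ≤ Real.exp t * (hℓ.ball (2 ^ q)).card := by
      intro p q t h
      rw [← Real.log_le_log_iff (hcp _) (by have := hcp (2 ^ q); positivity),
        Real.log_mul (Real.exp_ne_zero _) (hcp _).ne', Real.log_exp]
      simp only [v] at h
      linarith
    have hcle : ∀ p q, p ≤ q → ((hℓ.ball p).card : ℝ) ≤ (hℓ.ball q).card := fun p q h => by
      exact_mod_cast Finset.card_le_card (hℓ.ball_mono h)
    have hK := hball _ _ _ h3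
    have hR : (1 : ℝ) ≤ 2 ^ (b + j) := hone _
    have hRR : R₀ ≤ 2 ^ (b + j) :=
      hj₀.le.trans (pow_le_pow_right₀ (by norm_num) (by omega))
    have hdet := gram_det_le (R := 2 ^ (b + j)) (r := 2 ^ j) (M := 2 ^ (b + c + j)) (K := K)
      (η := η) (A := A) hℓ hgeo hD hfg hli hR Nat.one_le_two_pow (Real.exp_pos _).le
      ((hcle _ _ (by rw [pow_add]; omega)).trans (hK.trans (mul_le_mul_of_nonneg_left
        (hcle _ _ (by omega)) (Real.exp_pos _).le)))
      ((hcle _ _ (by rw [pow_add]; omega)).trans hK)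
      (fun e => hgrad _ hRR k _ (sum_smul_mem_growth hfg e)
        ((harmSpace hℓ hm k).sum_mem fun i _ => (harmSpace hℓ hm k).smul_mem _ (hf i)).2)
      (by
        have e1 : (8 * ((2 ^ j : ℕ) : ℝ) / 2 ^ (b + j)) ≤ 8 := by
          rw [div_le_iff₀ (by positivity), pow_add]
          push_cast
          nlinarith [hone b, hone j]
        have e2 : ((2 : ℝ) ^ b) ≤ (2 ^ b) ^ 2 := by nlinarith [hone b]
        calc _ ≤ Real.exp 8 * (25 * K ^ 2 * ((2 ^ j : ℕ) : ℝ) ^ 2) * (A / (2 ^ (b + j)) ^ 2) := by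
              gcongr
          _ = Real.exp 8 * (25 * K ^ 2) * A / (2 ^ b) ^ 2 := by
              rw [pow_add]; push_cast; field_simp
          _ ≤ 1 / 2 := by
              rw [div_le_iff₀ (by positivity)]
              linarith)
      (le_of_eq (by
        simp only [η]
        congr 3
        rw [pow_add, pow_add, pow_add]; push_cast
        field_simp))
      (by
        refine (hcle _ (2 ^ (j + a)) ?_).trans ((hball _ _ _ ha).trans ?_)
        · have : 2 ^ (j + a) = 2 * 2 ^ (b + c + j) := by simp only [a]; ring
          have h5 : 2 ^ j ≤ 2 ^ (b + c + j) := Nat.pow_le_pow_right (by norm_num) (by omega)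
          omega
        · rw [mul_comm η]
          exact mul_le_mul_of_nonneg_right hDη.le (hcp _).le)
    have h6 := Real.log_le_log (gram_det_pos hℓ hfg hR hli) hdet
    rw [← pow_succ', Real.log_mul (by positivity) (gram_det_pos hℓ hfg (hone _) hli).ne',
      Real.log_pow] at h6
    have h7 : δ j ≤ Real.log (2 * η) + δ (j + 1) := by
      simp only [δ]
      rw [div_le_iff₀ hD', add_mul, div_mul_cancel₀ _ hD'.ne']
      rw [show b + j + 1 = b + (j + 1) by ring] at h6
      linarith
    linarith
  have hrank : Module.rank ℂ (harmSpace hℓ hm k) ≤ (D : ℕ) := by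
    refine rank_le fun s hs => ?_
    by_contra! hlt
    obtain ⟨t, hts, htD⟩ := Finset.exists_subset_card_eq hlt.le
    let e : Fin D ≃ t := (finCongr htD.symm).trans t.equivFin.symm
    have h1 : LinearIndependent ℂ (fun i : Fin D => (⟨(e i : harmSpace hℓ hm k),
        hts (e i).2⟩ : s)  |> fun x : s => (x : harmSpace hℓ hm k)) :=
      hs.comp _ fun i j h => e.injective (Subtype.ext (Subtype.mk.inj h))
    exact key (fun i => ((e i : harmSpace hℓ hm k) : G → ℂ)) (fun i => (e i).1.2)
      (h1.map' (harmSpace hℓ hm k).subtype (Submodule.ker_subtype _))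
  exact Module.rank_lt_aleph0_iff.1 (hrank.trans_lt (Cardinal.natCast_lt_aleph0))

end HarmonicSpace

section InvariantForm

open Matrix Filter Topology
open scoped ComplexOrder MatrixOrder ComplexConjugate

variable {G : Type*} [Group G] {ℓ : G → ℕ} {C d : ℕ} {k : ℕ}

/-- The left translation representation. -/
def leftTr (G : Type*) [Group G] : G →* ((G → ℂ) →ₗ[ℂ] (G → ℂ)) where
  toFun g := LinearMap.funLeft ℂ ℂ (fun x => g⁻¹ * x)
  map_one' := by ext f x; simp
  map_mul' g h := by ext f x; simp [LinearMap.funLeft_apply, mul_assoc]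

@[simp] lemma leftTr_apply (g : G) (f : G → ℂ) (x : G) : leftTr G g f x = f (g⁻¹ * x) := rfl

lemma gram_norm_le (hℓ : IsPolyLength ℓ C d) {ι : Type*} [Fintype ι] {f : ι → G → ℂ} {R : ℝ}
    (hf : ∀ i, HasGrowth ℓ k (f i)) (hR : 1 ≤ R) (i j : ι) :
    ‖gram ℓ R f i j‖ ≤ ∑ i, energyNorm ℓ R (f i) := by
  have hi := (hf i).summable_energy hℓ hR
  have hj := (hf j).summable_energy hℓ hR
  have h1 : ‖gram ℓ R f i j‖ ≤ (energyNorm ℓ R (f i) + energyNorm ℓ R (f j)) / 2 := by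
    refine tsum_of_norm_bounded ((hi.hasSum.add hj.hasSum).div_const 2) fun x => ?_
    have hw := (cutoff_pos (ℓ := ℓ) R x).le
    rw [norm_mul, norm_mul, Complex.norm_real, Real.norm_of_nonneg hw, Complex.norm_conj,
      ← mul_add, mul_div_assoc]
    refine mul_le_mul_of_nonneg_left ?_ hw
    nlinarith [sq_nonneg (‖f i x‖ - ‖f j x‖)]
  have h2 : ∀ i, energyNorm ℓ R (f i) ≤ ∑ i, energyNorm ℓ R (f i) := fun i =>
    Finset.single_le_sum (f := fun i => energyNorm ℓ R (f i))
      (fun i _ => energyNorm_nonneg _ _) (Finset.mem_univ i)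
  linarith [h2 i, h2 j]

/-- A nonzero quadratic form on a space of functions of polynomial growth which does not increase
under left translations, obtained as a limit of normalized weighted `L²` forms. -/
lemma exists_invariant_matrix {D : ℕ} {f : Fin D → G → ℂ} (hℓ : IsPolyLength ℓ C d)
    (hf : ∀ i, HasGrowth ℓ k (f i)) (hne : ∃ i, f i ≠ 0) :
    ∃ B : Matrix (Fin D) (Fin D) ℂ, B ≠ 0 ∧ ∀ (g : G) (c c' : Fin D → ℂ),
      ∑ i, c' i • f i = leftTr G g (∑ i, c i • f i) →
      ‖WithLp.toLp 2 (B *ᵥ c')‖ ≤ ‖WithLp.toLp 2 (B *ᵥ c)‖ := by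
  set t : ℕ → ℝ := fun n => ∑ i, energyNorm ℓ (n + 1) (f i)
  have hR : ∀ n : ℕ, (1 : ℝ) ≤ (n : ℝ) + 1 := fun n => by
    have : (0 : ℝ) ≤ n := n.cast_nonneg
    linarith
  have ht : ∀ n, 0 < t n := fun n => by
    obtain ⟨i, hi⟩ := hne
    exact Finset.sum_pos' (fun i _ => energyNorm_nonneg _ _)
      ⟨i, Finset.mem_univ i, energyNorm_pos hℓ (hf i) (hR n) hi⟩
  let A : ℕ → Fin D → Fin D → ℂ := fun n i j => ((t n)⁻¹ : ℝ) • gram ℓ (n + 1) f i j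
  have hAb : ∀ n, A n ∈ Metric.closedBall (0 : Fin D → Fin D → ℂ) 1 := fun n => by
    rw [mem_closedBall_zero_iff, pi_norm_le_iff_of_nonneg zero_le_one]
    refine fun i => (pi_norm_le_iff_of_nonneg zero_le_one).2 fun j => ?_
    rw [norm_smul, Real.norm_of_nonneg (inv_nonneg.2 (ht n).le), inv_mul_le_iff₀ (ht n), mul_one]
    exact gram_norm_le hℓ hf (hR n) i j
  obtain ⟨M, -, φ, hφ, hlim⟩ := tendsto_subseq_of_bounded Metric.isBounded_closedBall hAb
  have hent : ∀ i j, Tendsto (fun n => A (φ n) i j) atTop (𝓝 (M i j)) := fun i j =>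
    tendsto_pi_nhds.1 (tendsto_pi_nhds.1 hlim i) j
  have hform : ∀ c : Fin D → ℂ, Tendsto
      (fun n => (((t (φ n))⁻¹ * energyNorm ℓ (φ n + 1) (∑ i, c i • f i) : ℝ) : ℂ)) atTop
      (𝓝 (star c ⬝ᵥ (Matrix.of M *ᵥ c))) := by
    intro c
    have h1 : Tendsto (fun n => ∑ i, star c i * ∑ j, A (φ n) i j * c j) atTop
        (𝓝 (∑ i, star c i * ∑ j, M i j * c j)) :=
      tendsto_finsetSum _ fun i _ => tendsto_const_nhds.mul
        (tendsto_finsetSum _ fun j _ => (hent i j).mul tendsto_const_nhds)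
    refine h1.congr fun n => ?_
    rw [Complex.ofReal_mul, ← gram_form hℓ hf (hR _)]
    simp only [dotProduct, mulVec, Finset.mul_sum, A, Complex.real_smul]
    refine Finset.sum_congr rfl fun i _ => Finset.sum_congr rfl fun j _ => ?_
    ring
  have hpsd : (Matrix.of M).PosSemidef := by
    refine PosSemidef.of_dotProduct_mulVec_nonneg ?_ fun c => ?_
    · ext i j
      refine tendsto_nhds_unique ((hent j i).star) ((hent i j).congr fun n => ?_)
      simp only [A, star_smul, star_trivial]
      congr 1
      exact (congrFun (congrFun (gram_isHermitian (ℓ := ℓ) (R := φ n + 1) (f := f)) i) j).symm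
    · refine ge_of_tendsto' (hform c) fun n => ?_
      exact_mod_cast mul_nonneg (inv_nonneg.2 (ht _).le) (energyNorm_nonneg _ _)
  obtain ⟨B, hB⟩ := exists_factor hpsd
  have hBn : ∀ c : Fin D → ℂ, star c ⬝ᵥ (Matrix.of M *ᵥ c)
      = ((‖WithLp.toLp 2 (B *ᵥ c)‖ ^ 2 : ℝ) : ℂ) := by
    intro c
    rw [hB, ← mulVec_mulVec, dotProduct_mulVec, ← star_mulVec, EuclideanSpace.norm_sq_eq]
    simp only [dotProduct, Pi.star_apply, RCLike.star_def, Complex.ofReal_sum, Complex.ofReal_pow,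
      Complex.conj_mul']
  have hlimr : ∀ c : Fin D → ℂ, Tendsto
      (fun n => (t (φ n))⁻¹ * energyNorm ℓ (φ n + 1) (∑ i, c i • f i)) atTop
      (𝓝 (‖WithLp.toLp 2 (B *ᵥ c)‖ ^ 2)) := by
    intro c
    have := hform c
    rw [hBn] at this
    exact tendsto_ofReal_iff.1 this
  refine ⟨B, ?_, fun g c c' hcc => ?_⟩
  · rintro rfl
    have h0 : ∀ i, Tendsto (fun n => (t (φ n))⁻¹ * energyNorm ℓ (φ n + 1) (f i)) atTop (𝓝 0) := by
      intro i
      have := hlimr (Pi.single i 1)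
      simpa only [zero_mulVec, Pi.single_apply, ite_smul, one_smul, zero_smul, Finset.sum_ite_eq',
        Finset.mem_univ, if_true, WithLp.toLp_zero, norm_zero, ne_eq, OfNat.ofNat_ne_zero,
        not_false_eq_true, zero_pow] using this
    have h1 := tendsto_finsetSum Finset.univ fun i _ => h0 i
    simp only [← Finset.mul_sum, Finset.sum_const_zero] at h1
    have h2 : (fun n => (t (φ n))⁻¹ * ∑ i, energyNorm ℓ (φ n + 1) (f i)) = fun _ => 1 := by
      funext n
      exact inv_mul_cancel₀ (ht _).ne'
    rw [h2] at h1
    exact one_ne_zero (tendsto_nhds_unique tendsto_const_nhds h1)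
  · have hexp : Tendsto (fun n => Real.exp (ℓ g⁻¹ / ((φ n : ℝ) + 1))
        * ((t (φ n))⁻¹ * energyNorm ℓ (φ n + 1) (∑ i, c i • f i))) atTop
        (𝓝 (1 * ‖WithLp.toLp 2 (B *ᵥ c)‖ ^ 2)) := by
      refine Tendsto.mul ?_ (hlimr c)
      rw [← Real.exp_zero]
      refine (Real.continuous_exp.tendsto 0).comp ?_
      refine Tendsto.div_atTop tendsto_const_nhds ?_
      exact tendsto_atTop_add_const_right _ _ (tendsto_natCast_atTop_atTop.comp hφ.tendsto_atTop)
    have hle := le_of_tendsto_of_tendsto' (hlimr c') hexp fun n => by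
      rw [hcc, mul_left_comm]
      refine mul_le_mul_of_nonneg_left ?_ (inv_nonneg.2 (ht _).le)
      exact energyNorm_mul_left_le hℓ (sum_smul_mem_growth hf c) (hR _) g⁻¹
    rw [one_mul] at hle
    exact (sq_le_sq₀ (norm_nonneg _) (norm_nonneg _)).1 hle

lemma exists_invariant_map (hℓ : IsPolyLength ℓ C d) (V : Submodule ℂ (G → ℂ))
    [FiniteDimensional ℂ V] (hV : V ≤ growthSpace ℓ k) (hne : V ≠ ⊥) :
    ∃ (D : ℕ) (T : V →ₗ[ℂ] EuclideanSpace ℂ (Fin D)), T ≠ 0 ∧ ∀ (g : G) (f f' : V),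
      (f' : G → ℂ) = leftTr G g f → ‖T f'‖ ≤ ‖T f‖ := by
  let b := Module.finBasis ℂ V
  have hbne : ∃ i, (b i : G → ℂ) ≠ 0 := by
    by_contra! h
    apply hne
    have : ∀ i, b i = 0 := fun i => Subtype.ext (h i)
    rw [Submodule.eq_bot_iff]
    intro x hx
    have h1 := b.sum_repr ⟨x, hx⟩
    simp only [this, smul_zero, Finset.sum_const_zero] at h1
    exact (congrArg Subtype.val h1).symm
  obtain ⟨B, hB, hBg⟩ := exists_invariant_matrix hℓ (fun i => hV (b i).2) hbne
  have hrep : ∀ f : V, ∑ i, b.equivFun f i • (b i : G → ℂ) = f := fun f => by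
    have := congrArg Subtype.val (b.sum_equivFun f)
    rwa [AddSubmonoidClass.coe_finsetSum] at this
  refine ⟨Module.finrank ℂ V, (WithLp.linearEquiv 2 ℂ _).symm.toLinearMap ∘ₗ B.mulVecLin ∘ₗ
    b.equivFun.toLinearMap, fun h => hB ?_, fun g f f' hff => ?_⟩
  · ext i j
    have h1 := congrArg WithLp.ofLp (LinearMap.congr_fun h (b.equivFun.symm (Pi.single j 1)))
    have h2 : (B *ᵥ b.equivFun (b.equivFun.symm (Pi.single j 1))) i = 0 := congrFun h1 i
    rw [LinearEquiv.apply_symm_apply, mulVec_single_one] at h2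
    exact h2
  · exact hBg g _ _ ((hrep f').trans (hff.trans (congrArg _ (hrep f).symm)))

end InvariantForm

section Isometric

variable {Γ : Type*} [Group Γ] {X : Type*} [NormedAddCommGroup X] [NormedSpace ℂ X]

/-- A representation by linear isometries. -/
def IsIsometric (π : Γ →* (X →L[ℂ] X)) : Prop := ∀ g x, ‖π g x‖ = ‖x‖

variable {π : Γ →* (X →L[ℂ] X)}

lemma IsIsometric.norm_le_one (hπ : IsIsometric π) (g : Γ) : ‖π g‖ ≤ 1 :=
  ContinuousLinearMap.opNorm_le_bound _ zero_le_one fun x => by rw [hπ, one_mul]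

lemma IsIsometric.mul_norm_le (hπ : IsIsometric π) (g : Γ) (A : X →L[ℂ] X) :
    ‖π g * A‖ ≤ ‖A‖ :=
  (norm_mul_le _ _).trans (mul_le_of_le_one_left (norm_nonneg _) (hπ.norm_le_one g))

lemma IsIsometric.norm_mul_le (hπ : IsIsometric π) (g : Γ) (A : X →L[ℂ] X) :
    ‖A * π g‖ ≤ ‖A‖ :=
  (_root_.norm_mul_le _ _).trans (mul_le_of_le_one_right (norm_nonneg _) (hπ.norm_le_one g))

lemma map_mul_map_inv (π : Γ →* (X →L[ℂ] X)) (g : Γ) : π g * π g⁻¹ = 1 := by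
  rw [← map_mul, mul_inv_cancel, map_one]

lemma IsIsometric.norm_mul_sub_one_le (hπ : IsIsometric π) (g h : Γ) :
    ‖π (g * h) - 1‖ ≤ ‖π g - 1‖ + ‖π h - 1‖ := by
  have : π (g * h) - 1 = π g * (π h - 1) + (π g - 1) := by rw [map_mul]; noncomm_ring
  rw [this, add_comm]
  exact (norm_add_le _ _).trans (add_le_add le_rfl (hπ.mul_norm_le _ _))

lemma IsIsometric.norm_inv_mul_sub_one (hπ : IsIsometric π) (g h : Γ) :
    ‖π (g⁻¹ * h) - 1‖ ≤ ‖π h - π g‖ := by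
  have : π (g⁻¹ * h) - 1 = π g⁻¹ * (π h - π g) := by
    rw [mul_sub, ← map_mul, ← map_mul, inv_mul_cancel, map_one]
  rw [this]
  exact hπ.mul_norm_le _ _

lemma IsIsometric.norm_inv_sub_one (hπ : IsIsometric π) (g : Γ) :
    ‖π g⁻¹ - 1‖ ≤ ‖π g - 1‖ := by
  have := hπ.norm_inv_mul_sub_one g 1
  rwa [mul_one, map_one, norm_sub_rev 1] at this

lemma IsIsometric.norm_commutator_le (hπ : IsIsometric π) (g t : Γ) :
    ‖π (g * t * g⁻¹ * t⁻¹) - 1‖ ≤ 2 * ‖π t - 1‖ * ‖π g - 1‖ := by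
  have h1 : π (g * t * g⁻¹ * t⁻¹) - 1
      = ((π g - 1) * (π t - 1) - (π t - 1) * (π g - 1)) * π (g⁻¹ * t⁻¹) := by
    have h2 : π t * π g * π (g⁻¹ * t⁻¹) = 1 := by
      rw [← map_mul, ← map_mul, ← map_one π]; congr 1; group
    have h3 : π (g * t * g⁻¹ * t⁻¹) = π g * π t * π (g⁻¹ * t⁻¹) := by
      rw [← map_mul, ← map_mul]; congr 1; group
    rw [h3]
    nth_rewrite 1 [← h2]
    noncomm_ring
  rw [h1]
  refine (hπ.norm_mul_le _ _).trans ((norm_sub_le _ _).trans ?_)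
  have h2 := _root_.norm_mul_le (π g - 1) (π t - 1)
  have h3 := _root_.norm_mul_le (π t - 1) (π g - 1)
  linarith

lemma IsIsometric.norm_pow_sub_one_le (hπ : IsIsometric π) (g : Γ) (n : ℕ) :
    ‖π (g ^ n) - 1‖ ≤ n * ‖π g - 1‖ := by
  induction n with
  | zero => simp
  | succ n ih =>
    rw [pow_succ]
    refine (hπ.norm_mul_sub_one_le _ _).trans ?_
    push_cast
    linarith

lemma IsIsometric.le_norm_pow_sub_one (hπ : IsIsometric π) (g : Γ) {n : ℕ} (hn : 1 ≤ n)
    (hna : n * ‖π g - 1‖ ≤ 1 / 2) : ‖π g - 1‖ / 2 ≤ ‖π (g ^ n) - 1‖ := by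
  have h1 : ∀ n : ℕ, ‖π (g ^ n) - 1 - (n : ℂ) • (π g - 1)‖ ≤ n ^ 2 * ‖π g - 1‖ ^ 2 := by
    intro n
    induction n with
    | zero => simp
    | succ n ih =>
      have h2 : π (g ^ (n + 1)) - 1 - ((n + 1 : ℕ) : ℂ) • (π g - 1)
          = (π (g ^ n) - 1 - (n : ℂ) • (π g - 1)) + (π (g ^ n) - 1) * (π g - 1) := by
        rw [pow_succ, map_mul]
        push_cast
        rw [add_smul, one_smul]
        noncomm_ring
      rw [h2]
      refine (norm_add_le _ _).trans ?_
      have h3 := _root_.norm_mul_le (π (g ^ n) - 1) (π g - 1)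
      have h4 := mul_le_mul_of_nonneg_right (hπ.norm_pow_sub_one_le g n) (norm_nonneg (π g - 1))
      push_cast
      have : (0 : ℝ) ≤ n := n.cast_nonneg
      nlinarith [sq_nonneg ‖π g - 1‖, mul_nonneg this (sq_nonneg ‖π g - 1‖)]
  have h2 := norm_sub_norm_le ((n : ℂ) • (π g - 1)) ((n : ℂ) • (π g - 1) - (π (g ^ n) - 1))
  rw [sub_sub_cancel, norm_smul, Complex.norm_natCast,
    norm_sub_rev ((n : ℂ) • (π g - 1))] at h2
  have h3 := h1 n
  have hn' : (1 : ℝ) ≤ n := by exact_mod_cast hn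
  have h4 : (n : ℝ) ^ 2 * ‖π g - 1‖ ^ 2 ≤ n * ‖π g - 1‖ * (1 / 2) := by
    rw [← mul_pow, sq]
    exact mul_le_mul_of_nonneg_left hna (by positivity)
  nlinarith [norm_nonneg (π g - 1)]

end Isometric

section Counting

variable {Γ : Type*} [Group Γ] {X : Type*} [NormedAddCommGroup X] [NormedSpace ℂ X]
  {ℓ : Γ → ℕ} {C d : ℕ} {π : Γ →* (X →L[ℂ] X)}

open Classical in
/-- The products `g i ^ e₀ * g (i + 1) ^ e₁ * ⋯` with `m` factors and exponents at most `E`. -/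
def powerProducts (g : ℕ → Γ) (E : ℕ) : ℕ → ℕ → Finset Γ
  | _, 0 => {1}
  | i, m + 1 => (Finset.range (E + 1) ×ˢ powerProducts g E (i + 1) m).image
      fun p => g i ^ p.1 * p.2

lemma mem_powerProducts_succ {g : ℕ → Γ} {E i m : ℕ} {y : Γ} :
    y ∈ powerProducts g E i (m + 1) ↔
      ∃ e ≤ E, ∃ z ∈ powerProducts g E (i + 1) m, g i ^ e * z = y := by
  simp only [powerProducts, Finset.mem_image, Finset.mem_product, Finset.mem_range, Prod.exists]
  constructor
  · rintro ⟨e, z, ⟨h1, h2⟩, h3⟩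
    exact ⟨e, by omega, z, h2, h3⟩
  · rintro ⟨e, h1, z, h2, h3⟩
    exact ⟨e, z, ⟨by omega, h2⟩, h3⟩

lemma norm_powerProducts (hπ : IsIsometric π) {g : ℕ → Γ} {E : ℕ} (hE : 1 ≤ E)
    (hdec : ∀ i, ‖π (g (i + 1)) - 1‖ ≤ ‖π (g i) - 1‖ / (16 * E)) (m i : ℕ) (y : Γ)
    (hy : y ∈ powerProducts g E i m) : ‖π y - 1‖ ≤ 2 * E * ‖π (g i) - 1‖ := by
  have hE' : (1 : ℝ) ≤ E := by exact_mod_cast hE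
  induction m generalizing i y with
  | zero =>
    have : y = 1 := by simpa [powerProducts] using hy
    rw [this, map_one, sub_self, norm_zero]
    positivity
  | succ m ih =>
    obtain ⟨e, he, z, hz, rfl⟩ := mem_powerProducts_succ.1 hy
    refine (hπ.norm_mul_sub_one_le _ _).trans ?_
    have h1 := hπ.norm_pow_sub_one_le (g i) e
    have h2 := ih (i + 1) z hz
    have h3 := hdec i
    rw [le_div_iff₀ (by positivity)] at h3
    have he' : (e : ℝ) ≤ E := by exact_mod_cast he
    nlinarith [norm_nonneg (π (g i) - 1)]

lemma card_powerProducts (hπ : IsIsometric π) {g : ℕ → Γ} {E : ℕ} (hE : 1 ≤ E)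
    (hdec : ∀ i, ‖π (g (i + 1)) - 1‖ ≤ ‖π (g i) - 1‖ / (16 * E))
    (hpos : ∀ i, 0 < ‖π (g i) - 1‖) (hsmall : ∀ i, E * ‖π (g i) - 1‖ ≤ 1 / 2) (m i : ℕ) :
    (powerProducts g E i m).card = (E + 1) ^ m := by
  have hE' : (1 : ℝ) ≤ E := by exact_mod_cast hE
  induction m generalizing i with
  | zero => simp [powerProducts]
  | succ m ih =>
    have hlt : ∀ e e' : ℕ, e' ≤ E → ∀ y ∈ powerProducts g E (i + 1) m,
        ∀ y' ∈ powerProducts g E (i + 1) m, g i ^ e * y = g i ^ e' * y' → ¬ e < e' := by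
      intro e e' he' y hy y' hy' heq hlt
      obtain ⟨n, rfl⟩ := Nat.exists_eq_add_of_lt hlt
      have h1 : g i ^ (n + 1) = y * y'⁻¹ := by
        rw [add_assoc, pow_add, mul_assoc] at heq
        rw [mul_left_cancel heq, mul_inv_cancel_right]
      have hn : ((n + 1 : ℕ) : ℝ) * ‖π (g i) - 1‖ ≤ 1 / 2 := by
        refine le_trans ?_ (hsmall i)
        gcongr
        omega
      have h2 := hπ.le_norm_pow_sub_one (g i) (by omega : 1 ≤ n + 1) hn
      rw [h1] at h2
      have h3 := hπ.norm_mul_sub_one_le y y'⁻¹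
      have h4 := hπ.norm_inv_sub_one y'
      have h5 := norm_powerProducts hπ hE hdec m (i + 1) y hy
      have h6 := norm_powerProducts hπ hE hdec m (i + 1) y' hy'
      have h7 := hdec i
      rw [le_div_iff₀ (by positivity)] at h7
      linarith [hpos i]
    classical
    rw [powerProducts, Finset.card_image_of_injOn, Finset.card_product, ih, Finset.card_range,
      pow_succ, mul_comm]
    rintro ⟨e, y⟩ hp ⟨e', y'⟩ hp' heq
    simp only [Finset.coe_product, Finset.coe_range, Set.mem_prod, Set.mem_Iio,
      Finset.mem_coe] at hp hp'
    have hee : e = e' := by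
      have h1 := hlt e e' (by omega) y hp.2 y' hp'.2 heq
      have h2 := hlt e' e (by omega) y' hp'.2 y hp.2 heq.symm
      omega
    subst hee
    exact Prod.ext rfl (mul_left_cancel heq)

lemma length_powerProducts (hℓ : IsPolyLength ℓ C d) {g : ℕ → Γ} {E Λ : ℕ}
    (hg : ∀ i, ℓ (g i) ≤ Λ * 2 ^ i) (m i : ℕ) (y : Γ) (hy : y ∈ powerProducts g E i m) :
    ℓ y + E * Λ * 2 ^ i ≤ E * Λ * 2 ^ (i + m) := by
  have hpow : ∀ (x : Γ) (n : ℕ), ℓ (x ^ n) ≤ n * ℓ x := by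
    intro x n
    induction n with
    | zero => simp [hℓ.one]
    | succ n ih =>
      rw [pow_succ, add_mul, one_mul]
      exact (hℓ.mul _ _).trans (by omega)
  induction m generalizing i y with
  | zero =>
    have : y = 1 := by simpa [powerProducts] using hy
    rw [this, hℓ.one]; simp
  | succ m ih =>
    obtain ⟨e, he, z, hz, rfl⟩ := mem_powerProducts_succ.1 hy
    have h1 := ih (i + 1) z hz
    have h2 := hℓ.mul (g i ^ e) z
    have h3 : ℓ (g i ^ e) ≤ E * Λ * 2 ^ i := (hpow _ _).trans (by
      rw [mul_assoc]; exact Nat.mul_le_mul he (hg i))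
    rw [show i + (m + 1) = i + 1 + m by ring]
    have h4 : E * Λ * 2 ^ (i + 1) = E * Λ * 2 ^ i + E * Λ * 2 ^ i := by ring
    omega

lemma IsPolyLength.card_le_of_length_le (hℓ : IsPolyLength ℓ C d) (F : Finset Γ) {n : ℕ}
    (h : ∀ x ∈ F, ℓ x ≤ n) : F.card ≤ C * (n + 1) ^ d :=
  (Finset.card_le_card fun x hx => hℓ.mem_ball.2 (h x hx)).trans (hℓ.card_ball n)

lemma no_contracting_sequence (hℓ : IsPolyLength ℓ C d) (hπ : IsIsometric π) {g : ℕ → Γ}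
    (hdec : ∀ i, ‖π (g (i + 1)) - 1‖ ≤ ‖π (g i) - 1‖ / (16 * 2 ^ d))
    (hpos : ∀ i, 0 < ‖π (g i) - 1‖) (hsmall : ∀ i, 2 ^ d * ‖π (g i) - 1‖ ≤ 1 / 2) {Λ : ℕ}
    (hg : ∀ i, ℓ (g i) ≤ Λ * 2 ^ i) : False := by
  have hE : 1 ≤ 2 ^ d := Nat.one_le_two_pow
  have h1 : ∀ m : ℕ, (2 ^ d + 1) ^ m ≤ C * (2 ^ d * Λ + 1) ^ d * (2 ^ d) ^ m := by
    intro m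
    have h2 := card_powerProducts hπ hE (by exact_mod_cast hdec) hpos (by exact_mod_cast hsmall) m 0
    rw [← h2]
    refine (hℓ.card_le_of_length_le _ (n := 2 ^ d * Λ * 2 ^ m) fun y hy => ?_).trans ?_
    · have := length_powerProducts hℓ hg m 0 y hy
      rw [zero_add] at this
      omega
    · rw [← pow_mul, mul_comm d m, pow_mul, mul_assoc C, ← mul_pow]
      gcongr
      have : 1 ≤ 2 ^ m := Nat.one_le_two_pow
      nlinarith
  obtain ⟨m, hm⟩ := pow_unbounded_of_one_lt ((C * (2 ^ d * Λ + 1) ^ d : ℕ) : ℝ)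
    (show (1 : ℝ) < (2 ^ d + 1) / 2 ^ d by rw [lt_div_iff₀ (by positivity)]; linarith)
  rw [div_pow, lt_div_iff₀ (by positivity)] at hm
  have := h1 m
  have h3 : ((2 : ℝ) ^ d + 1) ^ m ≤ (C * (2 ^ d * Λ + 1) ^ d : ℕ) * (2 ^ d) ^ m := by
    exact_mod_cast this
  linarith

end Counting

universe u v

lemma eq_one_of_pow_eq_one {z : ℂ} {n : ℕ} (hn : 1 ≤ n) (hz : z ^ n = 1) (h : n * ‖z - 1‖ < 1) :
    z = 1 := by
  by_contra hne
  have hz1 : ‖z‖ = 1 := Complex.norm_eq_one_of_pow_eq_one hz (by omega)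
  have h1 : ∀ j : ℕ, ‖z ^ j - 1‖ ≤ j * ‖z - 1‖ := by
    intro j
    induction j with
    | zero => simp
    | succ j ih =>
      have h2 : z ^ (j + 1) - 1 = z * (z ^ j - 1) + (z - 1) := by ring
      rw [h2]
      refine (norm_add_le _ _).trans ?_
      rw [norm_mul, hz1, one_mul]
      push_cast
      linarith
  have h2 : ∑ j ∈ Finset.range n, (z ^ j - 1) = -(n : ℂ) := by
    rw [Finset.sum_sub_distrib, geom_sum_eq hne, hz]
    simp
  have hn' : (1 : ℝ) ≤ n := by exact_mod_cast hn
  have h3 : (n : ℝ) ≤ n * (n * ‖z - 1‖) := by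
    calc (n : ℝ) = ‖∑ j ∈ Finset.range n, (z ^ j - 1)‖ := by
          rw [h2, norm_neg, Complex.norm_natCast]
      _ ≤ ∑ j ∈ Finset.range n, (n * ‖z - 1‖) := by
          refine norm_sum_le_of_le _ fun j hj => (h1 j).trans ?_
          have : (j : ℝ) ≤ n := by exact_mod_cast (Finset.mem_range.1 hj).le
          gcongr
      _ = _ := by simp
  nlinarith

section Generators

variable {Γ : Type*} [Group Γ]

lemma exists_finset_mem_closure {U : Set Γ} {x : Γ} (hx : x ∈ Subgroup.closure U) :
    ∃ T : Finset Γ, (T : Set Γ) ⊆ U ∧ x ∈ Subgroup.closure (T : Set Γ) := by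
  classical
  induction hx using Subgroup.closure_induction with
  | mem x hx => exact ⟨{x}, by simpa using hx, Subgroup.subset_closure (by simp)⟩
  | one => exact ⟨∅, by simp, Subgroup.one_mem _⟩
  | mul x y _ _ hx hy =>
    obtain ⟨T, hT, hxT⟩ := hx
    obtain ⟨T', hT', hyT⟩ := hy
    refine ⟨T ∪ T', by simp [hT, hT'], Subgroup.mul_mem _ ?_ ?_⟩
    · exact Subgroup.closure_mono (by simp) hxT
    · exact Subgroup.closure_mono (by simp) hyT
  | inv x _ hx =>
    obtain ⟨T, hT, hxT⟩ := hx
    exact ⟨T, hT, Subgroup.inv_mem _ hxT⟩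

lemma exists_finset_closure_eq {U : Set Γ} (hU : (Subgroup.closure U).FG) :
    ∃ T : Finset Γ, (T : Set Γ) ⊆ U ∧ Subgroup.closure (T : Set Γ) = Subgroup.closure U := by
  classical
  obtain ⟨S, hS⟩ := hU
  have h1 : ∀ x : S, ∃ T : Finset Γ, (T : Set Γ) ⊆ U ∧ (x : Γ) ∈ Subgroup.closure (T : Set Γ) :=
    fun x => exists_finset_mem_closure (by rw [← hS]; exact Subgroup.subset_closure x.2)
  choose T hT hTx using h1
  refine ⟨Finset.univ.biUnion T, by simpa using hT, le_antisymm
    (Subgroup.closure_mono (by simpa using hT)) ?_⟩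
  rw [← hS, Subgroup.closure_le]
  intro x hx
  refine Subgroup.closure_mono ?_ (hTx ⟨x, hx⟩)
  intro y hy
  simp only [Finset.coe_biUnion, Set.mem_iUnion]
  exact ⟨_, Finset.mem_coe.2 (Finset.mem_univ _), hy⟩

end Generators

section Jordan

variable {Γ : Type*} [Group Γ] {X : Type*} [NormedAddCommGroup X] [NormedSpace ℂ X]
  {ℓ : Γ → ℕ} {C d : ℕ} {π : Γ →* (X →L[ℂ] X)}

lemma finiteIndex_closure_near_one [FiniteDimensional ℂ X] (hπ : IsIsometric π) {ε : ℝ}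
    (hε : 0 < ε) : (Subgroup.closure {g | ‖π g - 1‖ < ε}).FiniteIndex := by
  set K := Subgroup.closure {g | ‖π g - 1‖ < ε}
  have : ProperSpace (X →L[ℂ] X) := FiniteDimensional.proper ℂ _
  have hb : Bornology.IsBounded (Set.range π) := by
    refine (Metric.isBounded_closedBall (x := (0 : X →L[ℂ] X)) (r := 1)).subset ?_
    rintro _ ⟨g, rfl⟩
    rw [mem_closedBall_zero_iff]
    exact hπ.norm_le_one g
  obtain ⟨t, ht, hcov⟩ := Metric.totallyBounded_iff.1
    (hb.isCompact_closure.totallyBounded.subset subset_closure) (ε / 2) (by positivity)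
  have hq : ∀ q : Γ ⧸ K, ∃ y ∈ t, ‖π q.out - y‖ < ε / 2 := fun q => by
    have := hcov ⟨q.out, rfl⟩
    simpa [dist_eq_norm] using this
  choose y hyt hy using hq
  have : Finite t := ht
  have hfin : Finite (Γ ⧸ K) := by
    refine Finite.of_injective (fun q => (⟨y q, hyt q⟩ : t)) fun q q' h => ?_
    have h1 : y q = y q' := congrArg Subtype.val h
    rw [← q.out_eq', ← q'.out_eq']
    refine Quotient.sound' (QuotientGroup.leftRel_apply.2 (Subgroup.subset_closure ?_))
    refine (hπ.norm_inv_mul_sub_one _ _).trans_lt ?_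
    have h2 : π q'.out - π q.out = (π q'.out - y q') - (π q.out - y q) := by rw [h1]; abel
    rw [h2]
    exact (norm_sub_le _ _).trans_lt (by linarith [hy q, hy q'])
  exact Subgroup.finiteIndex_of_finite_quotient

/-- The operator `π g` is a scalar. -/
def IsScalar (π : Γ →* (X →L[ℂ] X)) (g : Γ) : Prop := ∃ z : ℂ, π g = z • 1

lemma isScalar_commutator_eq_one [FiniteDimensional ℂ X] [Nontrivial X] {g t : Γ}
    (hs : IsScalar π (g * t * g⁻¹ * t⁻¹))
    (hsmall : Module.finrank ℂ X * ‖π (g * t * g⁻¹ * t⁻¹) - 1‖ < 1) :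
    π (g * t * g⁻¹ * t⁻¹) = 1 := by
  obtain ⟨z, hz⟩ := hs
  let δ : Γ →* ℂ := LinearMap.det.comp
    { toFun := fun g => (π g : X →ₗ[ℂ] X)
      map_one' := by rw [map_one]; rfl
      map_mul' := fun a b => by rw [map_mul]; rfl }
  have h1 : δ (g * t * g⁻¹ * t⁻¹) = 1 := by
    have : δ (g * t * g⁻¹ * t⁻¹) = δ (g * g⁻¹) * δ (t * t⁻¹) := by
      simp only [map_mul]; ring
    rw [this, mul_inv_cancel, mul_inv_cancel, map_one, one_mul]
  have h2 : δ (g * t * g⁻¹ * t⁻¹) = z ^ Module.finrank ℂ X := by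
    have : δ (g * t * g⁻¹ * t⁻¹) = LinearMap.det (z • (1 : X →ₗ[ℂ] X)) := by
      change LinearMap.det (π (g * t * g⁻¹ * t⁻¹) : X →ₗ[ℂ] X) = _
      rw [hz]; rfl
    rw [this, LinearMap.det_smul, map_one, mul_one]
  have h3 : π (g * t * g⁻¹ * t⁻¹) - 1 = (z - 1) • 1 := by rw [hz, sub_smul, one_smul]
  rw [h3, norm_smul, norm_one, mul_one] at hsmall
  rw [hz, eq_one_of_pow_eq_one Module.finrank_pos (h2.symm.trans h1) hsmall, one_smul]

lemma isScalar_of_commuting_isScalar [FiniteDimensional ℂ X] [Nontrivial X]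
    (hℓ : IsPolyLength ℓ C d) (hπ : IsIsometric π) {ε : ℝ} (hε : 32 * 2 ^ d * ε ≤ 1)
    (hε' : 4 * Module.finrank ℂ X * ε < 1) {T : Finset Γ} (hT : ∀ t ∈ T, ‖π t - 1‖ < ε)
    (hsc : ∀ h ∈ Subgroup.closure (T : Set Γ), (∀ t ∈ T, Commute (π h) (π t)) → IsScalar π h) :
    ∀ t ∈ T, IsScalar π t := by
  classical
  by_contra! hcon
  obtain ⟨t₀, ht₀, hns⟩ := hcon
  have hd : (1 : ℝ) ≤ 2 ^ d := one_le_pow₀ (by norm_num)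
  have hε0 : 0 < ε := (norm_nonneg _).trans_lt (hT t₀ ht₀)
  obtain ⟨L, hL⟩ : ∃ L, ∀ t ∈ T, ℓ t ≤ L := ⟨T.sup ℓ, fun t ht => Finset.le_sup ht⟩
  let P := {h : Γ // h ∈ Subgroup.closure (T : Set Γ) ∧ ¬ IsScalar π h ∧ ‖π h - 1‖ ≤ ε}
  have hstep : ∀ h : P, ∃ h' : P, ‖π h'.1 - 1‖ ≤ ‖π h.1 - 1‖ / (16 * 2 ^ d) ∧
      ℓ h'.1 ≤ 2 * ℓ h.1 + 2 * L := by
    rintro ⟨h, hh, hhs, hhε⟩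
    obtain ⟨t, ht, hnc⟩ : ∃ t ∈ T, ¬ Commute (π h) (π t) := by
      by_contra! hc
      exact hhs (hsc h hh hc)
    have h1 := hπ.norm_commutator_le h t
    have h2 : ‖π (h * t * h⁻¹ * t⁻¹) - 1‖ ≤ ‖π h - 1‖ / (16 * 2 ^ d) := by
      refine h1.trans ?_
      rw [le_div_iff₀ (by positivity)]
      have h3 : 2 * ‖π t - 1‖ * (16 * 2 ^ d) ≤ 1 := by
        have := hT t ht
        have h4 : 32 * (2 : ℝ) ^ d * ‖π t - 1‖ ≤ 32 * 2 ^ d * ε := by gcongr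
        linarith
      nlinarith [norm_nonneg (π h - 1)]
    have h3 : ‖π h - 1‖ / (16 * 2 ^ d) ≤ ‖π h - 1‖ :=
      div_le_self (norm_nonneg _) (by linarith)
    refine ⟨⟨h * t * h⁻¹ * t⁻¹, ?_, fun hs => hnc ?_, (h2.trans h3).trans hhε⟩, h2, ?_⟩
    · have htT := Subgroup.subset_closure (Finset.mem_coe.2 ht)
      exact mul_mem (mul_mem (mul_mem hh htT) (inv_mem hh)) (inv_mem htT)
    · have h4 := isScalar_commutator_eq_one hs (by
        have h5 := (h2.trans h3).trans hhε
        have h6 : (Module.finrank ℂ X : ℝ) * ‖π (h * t * h⁻¹ * t⁻¹) - 1‖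
            ≤ Module.finrank ℂ X * ε := by gcongr
        have h7 : (0 : ℝ) ≤ Module.finrank ℂ X * ε := by positivity
        linarith)
      have h5 : π h * π t = π (h * t * h⁻¹ * t⁻¹) * (π t * π h) := by
        rw [← map_mul, ← map_mul, ← map_mul]; congr 1; group
      rw [h4, one_mul] at h5
      exact h5
    · have e1 := hℓ.mul (h * t * h⁻¹) t⁻¹
      have e2 := hℓ.mul (h * t) h⁻¹
      have e3 := hℓ.mul h t
      rw [hℓ.inv] at e1 e2
      have := hL t ht
      change ℓ (h * t * h⁻¹ * t⁻¹) ≤ 2 * ℓ h + 2 * L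
      omega
  choose next hnext hlen using hstep
  let s : ℕ → P := fun i => next^[i] ⟨t₀, Subgroup.subset_closure ht₀, hns, (hT t₀ ht₀).le⟩
  have hs : ∀ i, s (i + 1) = next (s i) := fun i => Function.iterate_succ_apply' _ _ _
  have hlen' : ∀ i, ℓ (s i).1 + 2 * L ≤ 3 * L * 2 ^ i := by
    intro i
    induction i with
    | zero =>
      have := hL t₀ ht₀
      change ℓ t₀ + 2 * L ≤ 3 * L * 2 ^ 0
      omega
    | succ i ih =>
      rw [hs]
      have := hlen (s i)
      rw [pow_succ, ← mul_assoc]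
      omega
  refine no_contracting_sequence hℓ hπ (g := fun i => (s i).1) (Λ := 3 * L)
    (fun i => by simpa only [hs] using hnext (s i)) (fun i => ?_) (fun i => ?_)
    (fun i => by have := hlen' i; omega)
  · rw [norm_pos_iff, sub_ne_zero]
    exact fun h => (s i).2.2.1 ⟨1, by rw [h, one_smul]⟩
  · have := (s i).2.2.2
    have h1 : (2 : ℝ) ^ d * ‖π (s i).1 - 1‖ ≤ 2 ^ d * ε := by gcongr
    linarith

lemma IsPolyLength.restrict (hℓ : IsPolyLength ℓ C d) (H : Subgroup Γ) :
    IsPolyLength (fun h : H => ℓ h) C d where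
  one := hℓ.one
  mul x y := hℓ.mul x y
  inv x := hℓ.inv x
  finite n := (hℓ.finite n).preimage Subtype.val_injective.injOn
  card n := by
    refine le_trans ?_ (hℓ.card n)
    exact Set.ncard_le_ncard_of_injOn Subtype.val (fun x hx => hx)
      Subtype.val_injective.injOn (hℓ.finite n)

end Jordan

/-- An isometric finite-dimensional representation of a finitely generated group with a polynomial
length function has a common eigenvector for a finite index subgroup. -/
theorem exists_common_eigenvector {C d : ℕ} (n : ℕ) : ∀ (Γ : Type u) [Group Γ] [Group.FG Γ]
    (ℓ : Γ → ℕ) (_ : IsPolyLength ℓ C d) (X : Type v) [NormedAddCommGroup X] [NormedSpace ℂ X]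
    [FiniteDimensional ℂ X] [Nontrivial X] (π : Γ →* (X →L[ℂ] X)) (_ : IsIsometric π),
    Module.finrank ℂ X ≤ n → ∃ H : Subgroup Γ, H.FiniteIndex ∧ ∃ x : X, x ≠ 0 ∧
      ∀ g ∈ H, ∃ z : ℂ, π g x = z • x := by
  induction n with
  | zero =>
    intro Γ _ _ ℓ hℓ X _ _ _ _ π hπ hX
    have := Module.finrank_pos (R := ℂ) (M := X)
    omega
  | succ n ih =>
    intro Γ _ _ ℓ hℓ X _ _ _ _ π hπ hX
    have hfr : (0 : ℝ) < Module.finrank ℂ X := by exact_mod_cast Module.finrank_pos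
    obtain ⟨ε, hε, hε1, hε2⟩ : ∃ ε : ℝ, 0 < ε ∧ 32 * 2 ^ d * ε ≤ 1 ∧
        4 * Module.finrank ℂ X * ε < 1 := by
      have hpos : 0 < 32 * (2 : ℝ) ^ d + 4 * Module.finrank ℂ X := by positivity
      refine ⟨(32 * 2 ^ d + 4 * Module.finrank ℂ X)⁻¹, inv_pos.2 hpos, ?_, ?_⟩
      · rw [← div_eq_mul_inv, div_le_one hpos]; linarith
      · rw [← div_eq_mul_inv, div_lt_one hpos]; linarith [show (0 : ℝ) < 32 * 2 ^ d by positivity]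
    have hfi := finiteIndex_closure_near_one hπ hε
    obtain ⟨T, hTε, hTcl⟩ := exists_finset_closure_eq
      ((Group.fg_iff_subgroup_fg _).1 (Subgroup.fg_of_index_ne_zero
        (Subgroup.closure {g | ‖π g - 1‖ < ε})))
    rw [← hTcl] at hfi
    by_cases hsc : ∀ h ∈ Subgroup.closure (T : Set Γ), (∀ t ∈ T, Commute (π h) (π t)) →
        IsScalar π h
    · have h1 := isScalar_of_commuting_isScalar hℓ hπ hε1 hε2 (fun t ht => hTε ht) hsc
      obtain ⟨x, hx⟩ := exists_ne (0 : X)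
      refine ⟨_, hfi, x, hx, fun g hg => ?_⟩
      obtain ⟨z, hz⟩ := hsc g hg fun t ht => by
        obtain ⟨z, hz⟩ := h1 t ht
        rw [hz]
        exact (Commute.one_right (π g)).smul_right z
      exact ⟨z, by rw [hz]; rfl⟩
    · push Not at hsc
      obtain ⟨h, hh, hcomm, hns⟩ := hsc
      obtain ⟨z, hz⟩ := Module.End.exists_eigenvalue (π h : X →ₗ[ℂ] X)
      set W := Module.End.eigenspace (π h : X →ₗ[ℂ] X) z
      have hWne : W ≠ ⊥ := hz
      have hWlt : W < ⊤ := lt_top_iff_ne_top.2 fun htop => hns ⟨z, by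
        ext x
        exact Module.End.mem_eigenspace_iff.1 (htop ▸ Submodule.mem_top : x ∈ W)⟩
      set K := Subgroup.closure (T : Set Γ)
      have hKc : ∀ g ∈ K, Commute (π h) (π g) := by
        intro g hg
        induction hg using Subgroup.closure_induction with
        | mem x hx => exact hcomm x hx
        | one => rw [map_one]; exact Commute.one_right _
        | mul x y _ _ hx hy => rw [map_mul]; exact hx.mul_right hy
        | inv x _ hx =>
          have e1 := map_mul_map_inv π x
          have e2 := map_mul_map_inv π x⁻¹
          rw [inv_inv] at e2
          calc π h * π x⁻¹ = π x⁻¹ * (π x * π h) * π x⁻¹ := by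
                rw [← mul_assoc (π x⁻¹), e2, one_mul]
            _ = π x⁻¹ * (π h * π x) * π x⁻¹ := by rw [hx.eq]
            _ = π x⁻¹ * π h := by rw [mul_assoc, mul_assoc (π h), e1, mul_one]
      have hinv : ∀ g : K, ∀ x : W, π g x ∈ W := fun g x => by
        refine Module.End.mem_eigenspace_iff.2 ?_
        have e1 : π h (π g x) = π g (π h x) :=
          congrArg (fun A : X →L[ℂ] X => A x) (hKc g g.2).eq
        have e2 : π h x = z • (x : X) := Module.End.mem_eigenspace_iff.1 x.2
        change π h (π g x) = z • π g x
        rw [e1, e2, map_smul]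
      let π' : K →* (W →L[ℂ] W) :=
        { toFun := fun g => ((π g).comp W.subtypeL).codRestrict W (hinv g)
          map_one' := by ext x; simp
          map_mul' := fun a b => by ext x; simp; rfl }
      have : Nontrivial W := Submodule.nontrivial_iff_ne_bot.2 hWne
      have : Group.FG K := Subgroup.fg_of_index_ne_zero K
      obtain ⟨H, hH, x, hx, hxH⟩ := ih K (fun g => ℓ g) (hℓ.restrict K) W π'
        (fun g x => hπ g x) (by have := Submodule.finrank_lt hWlt.ne; omega)
      refine ⟨H.map K.subtype, ⟨?_⟩, x, by simpa using hx, ?_⟩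
      · rw [Subgroup.index_map_of_injective _ K.subtype_injective, K.range_subtype]
        exact mul_ne_zero hH.index_ne_zero hfi.index_ne_zero
      · rintro _ ⟨g, hg, rfl⟩
        obtain ⟨z', hz'⟩ := hxH g hg
        exact ⟨z', congrArg Subtype.val hz'⟩

section Eigenfunctional

variable {G : Type*} [Group G] {ℓ : G → ℕ} {C d k : ℕ}

/-- The contragredient of an isometric representation. -/
def dualRep {Γ X : Type*} [Group Γ] [NormedAddCommGroup X] [NormedSpace ℂ X]
    (π : Γ →* (X →L[ℂ] X)) : Γ →* ((X →L[ℂ] ℂ) →L[ℂ] (X →L[ℂ] ℂ)) where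
  toFun g := (ContinuousLinearMap.compL ℂ X X ℂ).flip (π g⁻¹)
  map_one' := by ext φ x; simp
  map_mul' g h := by ext φ x; simp

lemma dualRep_apply {Γ X : Type*} [Group Γ] [NormedAddCommGroup X] [NormedSpace ℂ X]
    (π : Γ →* (X →L[ℂ] X)) (g : Γ) (φ : X →L[ℂ] ℂ) (x : X) :
    dualRep π g φ x = φ (π g⁻¹ x) := rfl

lemma IsIsometric.dualRep {Γ X : Type*} [Group Γ] [NormedAddCommGroup X] [NormedSpace ℂ X]
    {π : Γ →* (X →L[ℂ] X)} (hπ : IsIsometric π) : IsIsometric (dualRep π) := by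
  have h1 : ∀ g φ, ‖PolyHarm.dualRep π g φ‖ ≤ ‖φ‖ := fun g φ => by
    refine ContinuousLinearMap.opNorm_le_bound _ (norm_nonneg _) fun x => ?_
    rw [dualRep_apply, ← hπ g⁻¹ x]
    exact φ.le_opNorm _
  intro g φ
  refine le_antisymm (h1 g φ) ?_
  have h2 := h1 g⁻¹ (PolyHarm.dualRep π g φ)
  have h3 : PolyHarm.dualRep π g⁻¹ (PolyHarm.dualRep π g φ) = φ := by
    have := congrArg (fun A : (X →L[ℂ] ℂ) →L[ℂ] (X →L[ℂ] ℂ) => A φ)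
      (map_mul (PolyHarm.dualRep π) g⁻¹ g)
    simpa using this.symm
  rwa [h3] at h2

lemma IsIsometric.norm_eigenvalue {Γ X : Type*} [Group Γ] [NormedAddCommGroup X] [NormedSpace ℂ X]
    {π : Γ →* (X →L[ℂ] X)} (hπ : IsIsometric π) {g : Γ} {x : X} (hx : x ≠ 0) {z : ℂ}
    (hz : π g x = z • x) : ‖z‖ = 1 := by
  have h1 := hπ g x
  rw [hz, norm_smul] at h1
  exact mul_right_cancel₀ (norm_ne_zero_iff.2 hx) (h1.trans (one_mul _).symm)

/-- A finite-dimensional space of functions of polynomial growth which is invariant under a finite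
index subgroup carries a nonzero functional on which a finite index subgroup acts by unitary
scalars. -/
theorem exists_eigenfunctional [Group.FG G] (hℓ : IsPolyLength ℓ C d) (H : Subgroup G)
    (hH : H.FiniteIndex) (V : Submodule ℂ (G → ℂ)) [FiniteDimensional ℂ V]
    (hV : V ≤ growthSpace ℓ k) (hne : V ≠ ⊥)
    (hinv : ∀ h ∈ H, ∀ f ∈ V, leftTr G h f ∈ V) :
    ∃ H' : Subgroup G, H'.FiniteIndex ∧ H' ≤ H ∧ ∃ lam : V →ₗ[ℂ] ℂ, lam ≠ 0 ∧ ∀ h ∈ H',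
      ∃ z : ℂ, ‖z‖ = 1 ∧ ∀ f f' : V, (f' : G → ℂ) = leftTr G h f → lam f' = z * lam f := by
  obtain ⟨D, T, hT, hTinv⟩ := exists_invariant_map hℓ V hV hne
  let A : H → V →ₗ[ℂ] V := fun h => (leftTr G (h : G)).restrict (hinv h h.2)
  have hA : ∀ h v, (A h v : G → ℂ) = leftTr G (h : G) v := fun h v => rfl
  have hAmul : ∀ g h v, A (g * h) v = A g (A h v) := fun g h v => by
    apply Subtype.ext
    rw [hA, hA, hA, Subgroup.coe_mul, map_mul]
    rfl
  have hAone : ∀ v, A 1 v = v := fun v => by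
    apply Subtype.ext
    rw [hA, Subgroup.coe_one, map_one]
    rfl
  have hnorm : ∀ h v, ‖T (A h v)‖ = ‖T v‖ := fun h v => by
    refine le_antisymm (hTinv _ _ _ (hA h v)) ?_
    have := hTinv _ _ _ (hA h⁻¹ (A h v))
    rwa [← hAmul, inv_mul_cancel, hAone] at this
  set X := LinearMap.range T
  let T' : V →ₗ[ℂ] X := T.rangeRestrict
  obtain ⟨s, hs⟩ := LinearMap.exists_rightInverse_of_surjective T' T.range_rangeRestrict
  have hs' : ∀ x, T' (s x) = x := fun x => congrArg (fun B : X →ₗ[ℂ] X => B x) hs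
  have hnorm' : ∀ h v, ‖T' (A h v)‖ = ‖T' v‖ := hnorm
  have hdesc : ∀ h v, T' (A h (s (T' v))) = T' (A h v) := fun h v => by
    rw [← sub_eq_zero, ← norm_eq_zero, ← map_sub, ← map_sub, hnorm', map_sub, hs', sub_self,
      norm_zero]
  let π : H →* (X →L[ℂ] X) :=
    { toFun := fun h => LinearMap.toContinuousLinearMap (T' ∘ₗ A h ∘ₗ s)
      map_one' := by
        ext1 x
        change T' (A 1 (s x)) = x
        rw [hAone, hs']
      map_mul' := fun g h => by
        ext1 x
        change T' (A (g * h) (s x)) = T' (A g (s (T' (A h (s x)))))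
        rw [hdesc, hAmul] }
  clear_value A
  have hπ_apply : ∀ h x, π h x = T' (A h (s x)) := fun h x => rfl
  have hπ : IsIsometric π := fun h x => by rw [hπ_apply, hnorm', hs']
  have hXne : X ≠ ⊥ := fun h => hT (LinearMap.range_eq_bot.1 h)
  have : Nontrivial X := Submodule.nontrivial_iff_ne_bot.2 hXne
  have : Group.FG H := Subgroup.fg_of_index_ne_zero H
  obtain ⟨K, hK, φ, hφ, hφK⟩ := exists_common_eigenvector _ H (fun h => ℓ h) (hℓ.restrict H)
    (X →L[ℂ] ℂ) (dualRep π) hπ.dualRep le_rfl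
  refine ⟨K.map H.subtype, ⟨?_⟩, Subgroup.map_subtype_le K, φ.toLinearMap ∘ₗ T', ?_, ?_⟩
  · rw [Subgroup.index_map_of_injective _ H.subtype_injective, H.range_subtype]
    exact mul_ne_zero hK.index_ne_zero hH.index_ne_zero
  · intro h0
    refine hφ (ContinuousLinearMap.ext fun x => ?_)
    have h1 : φ (T' (s x)) = 0 := LinearMap.congr_fun h0 (s x)
    rw [hs'] at h1
    exact h1
  · rintro _ ⟨g, hg, rfl⟩
    obtain ⟨z, hz⟩ := hφK g⁻¹ (K.inv_mem hg)
    refine ⟨z, ?_, fun f f' hff => ?_⟩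
    · exact hπ.dualRep.norm_eigenvalue hφ hz
    · have h1 : f' = A g f := Subtype.ext (hff.trans (hA g f).symm)
      have h2 := congrArg (fun ψ : X →L[ℂ] ℂ => ψ (T' f)) hz
      change dualRep π g⁻¹ φ (T' f) = z * φ (T' f) at h2
      rw [dualRep_apply, inv_inv, hπ_apply, hdesc] at h2
      rw [h1]
      exact h2

end Eigenfunctional

section PowerSums

open Polynomial

/-- The set of values at `x` of the polynomials of degree less than `m` with coefficients in
`{0, 1}`. -/
def powerSums {K : Type*} [Semiring K] (x : K) (m : ℕ) : Set K :=
  (fun s : Finset ℕ => ∑ i ∈ s, x ^ i) '' (Finset.range m).powerset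

lemma finite_powerSums {K : Type*} [Semiring K] (x : K) (m : ℕ) : (powerSums x m).Finite :=
  (Finset.finite_toSet _).image _

lemma ncard_powerSums_map {K L : Type*} [Field K] [Field L] (φ : K →+* L) (x : K) (m : ℕ) :
    (powerSums (φ x) m).ncard = (powerSums x m).ncard := by
  rw [← Set.ncard_image_of_injective _ φ.injective, powerSums, powerSums, Set.image_image]
  simp

/-- The polynomial `∑ i ∈ s, X ^ i`. -/
def indicatorPoly (s : Finset ℕ) : ℤ[X] := ∑ i ∈ s, X ^ i

lemma coeff_indicatorPoly (s : Finset ℕ) (j : ℕ) :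
    (indicatorPoly s).coeff j = if j ∈ s then 1 else 0 := by
  simp [indicatorPoly, coeff_X_pow]

lemma aeval_indicatorPoly {K : Type*} [CommRing K] (x : K) (s : Finset ℕ) :
    aeval x (indicatorPoly s) = ∑ i ∈ s, x ^ i := by
  simp [indicatorPoly]

lemma indicatorPoly_injective : Function.Injective indicatorPoly := by
  intro s t h
  ext j
  have := congrArg (fun p => p.coeff j) h
  simp only [coeff_indicatorPoly] at this
  split_ifs at this <;> simp_all

lemma abs_coeff_sub_indicatorPoly (s t : Finset ℕ) (j : ℕ) :
    |(indicatorPoly s - indicatorPoly t).coeff j| ≤ 1 := by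
  rw [coeff_sub, coeff_indicatorPoly, coeff_indicatorPoly]
  split_ifs <;> simp

lemma abs_leadingCoeff_sub_indicatorPoly {s t : Finset ℕ} (h : s ≠ t) :
    |(indicatorPoly s - indicatorPoly t).leadingCoeff| = 1 := by
  refine le_antisymm (abs_coeff_sub_indicatorPoly _ _ _) (Int.one_le_abs ?_)
  exact leadingCoeff_ne_zero.2 (sub_ne_zero.2 (indicatorPoly_injective.ne h))

lemma isIntegral_of_powerSum_eq {K : Type*} [CommRing K] {x : K} {s t : Finset ℕ} (hst : s ≠ t)
    (h : ∑ i ∈ s, x ^ i = ∑ i ∈ t, x ^ i) : IsIntegral ℤ x := by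
  have h0 : aeval x (indicatorPoly s - indicatorPoly t) = 0 := by
    rw [map_sub, aeval_indicatorPoly, aeval_indicatorPoly, h, sub_self]
  rcases (abs_eq one_pos.le).1 (abs_leadingCoeff_sub_indicatorPoly hst) with h1 | h1
  · exact ⟨_, h1, h0⟩
  · refine ⟨-(indicatorPoly s - indicatorPoly t), ?_, ?_⟩
    · rw [Monic, leadingCoeff_neg, h1, neg_neg]
    · change aeval x _ = 0
      rw [map_neg, h0, neg_zero]

lemma eq_of_powerSum_eq {x : ℂ} (hx : 2 ≤ ‖x‖) {s t : Finset ℕ}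
    (h : ∑ i ∈ s, x ^ i = ∑ i ∈ t, x ^ i) : s = t := by
  by_contra hst
  have hlead := abs_leadingCoeff_sub_indicatorPoly hst
  have hcoeff := abs_coeff_sub_indicatorPoly s t
  set p := indicatorPoly s - indicatorPoly t
  have hinj : Function.Injective (Int.castRingHom ℂ) := RingHom.injective_int _
  have hp : p.map (Int.castRingHom ℂ) ≠ 0 := by
    rw [Ne, Polynomial.map_eq_zero_iff hinj]
    exact sub_ne_zero.2 (indicatorPoly_injective.ne hst)
  have hroot : (p.map (Int.castRingHom ℂ)).IsRoot x := by
    rw [IsRoot.def, eval_map, ← algebraMap_int_eq, ← aeval_def, map_sub, aeval_indicatorPoly,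
      aeval_indicatorPoly, h, sub_self]
  have h1 := IsRoot.norm_lt_cauchyBound hp hroot
  have h2 : ‖(p.map (Int.castRingHom ℂ)).leadingCoeff‖₊ = 1 := by
    rw [leadingCoeff_map_of_injective hinj]
    ext
    rw [coe_nnnorm, eq_intCast, Complex.norm_intCast, ← Int.cast_abs, hlead]
    norm_num
  rw [cauchyBound, h2, div_one] at h1
  have h3 : (Finset.range (p.map (Int.castRingHom ℂ)).natDegree).sup
      (fun i => ‖(p.map (Int.castRingHom ℂ)).coeff i‖₊) ≤ 1 := by
    refine Finset.sup_le fun i _ => ?_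
    rw [← NNReal.coe_le_coe, coe_nnnorm, coeff_map, eq_intCast, Complex.norm_intCast]
    rw [← Int.cast_abs, NNReal.coe_one]
    exact_mod_cast hcoeff i
  have h4 : ‖x‖ < 2 := by
    have h5 := h1.trans_le (add_le_add_left h3 1)
    have h6 : ‖x‖ < ((1 + 1 : NNReal) : ℝ) := NNReal.coe_lt_coe.2 h5
    norm_num at h6
    exact h6
  linarith

lemma exists_lt_two_pow (C r d : ℕ) : ∃ q : ℕ, C * (r * q + 1) ^ d < 2 ^ q := by
  have h := tendsto_pow_const_div_const_pow_of_one_lt d (show (1 : ℝ) < 2 by norm_num)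
  obtain ⟨q, hq, hq1⟩ := ((h.eventually_lt_const (u := ((C * (r + 1) ^ d + 1 : ℕ) : ℝ)⁻¹)
    (by positivity)).and (Filter.eventually_ge_atTop 1)).exists
  refine ⟨q, ?_⟩
  rw [div_lt_iff₀ (by positivity), inv_mul_eq_div, lt_div_iff₀ (by positivity)] at hq
  have h1 : q ^ d * (C * (r + 1) ^ d + 1) < 2 ^ q := by exact_mod_cast hq
  have h2 : (r * q + 1) ^ d ≤ q ^ d * (r + 1) ^ d := by
    rw [← mul_pow]
    gcongr
    nlinarith
  calc C * (r * q + 1) ^ d ≤ C * (q ^ d * (r + 1) ^ d) := Nat.mul_le_mul_left C h2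
    _ ≤ q ^ d * (C * (r + 1) ^ d + 1) := by
      rw [mul_left_comm]
      gcongr
      omega
    _ < 2 ^ q := h1

lemma two_pow_le_ncard_powerSums {x : ℂ} {r : ℕ} (hr : 1 ≤ r) (hx : 2 ≤ ‖x ^ r‖) (q : ℕ) :
    2 ^ q ≤ (powerSums x (r * q)).ncard := by
  have h1 : (powerSums (x ^ r) q).ncard = 2 ^ q := by
    rw [powerSums, Set.ncard_image_of_injective _ fun s t => eq_of_powerSum_eq hx,
      Set.ncard_coe_finset, Finset.card_powerset, Finset.card_range]
  rw [← h1]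
  refine Set.ncard_le_ncard ?_ (finite_powerSums _ _)
  rintro _ ⟨s, hs, rfl⟩
  refine ⟨s.image (r * ·), ?_, ?_⟩
  · simp only [Finset.coe_powerset, Set.mem_preimage, Set.mem_powerset_iff, Finset.coe_subset,
      Finset.subset_iff, Finset.mem_range] at hs ⊢
    intro y hy
    obtain ⟨i, hi, rfl⟩ := Finset.mem_image.1 hy
    exact (Nat.mul_lt_mul_left (by omega)).2 (hs hi)
  · simp only
    rw [Finset.sum_image fun a _ b _ h => Nat.eq_of_mul_eq_mul_left (by omega) h]
    simp [pow_mul]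

/-- A nonzero complex number at which the polynomials with coefficients in `{0, 1}` take few values
is a root of unity. -/
theorem exists_pow_eq_one_of_powerSums {C d : ℕ} {z : ℂ} (hz : z ≠ 0)
    (h : ∀ m, (powerSums z m).ncard ≤ C * (m + 1) ^ d) : ∃ n, 0 < n ∧ z ^ n = 1 := by
  have hz_int : IsIntegral ℤ z := by
    obtain ⟨q, hq⟩ := exists_lt_two_pow C 1 d
    rw [one_mul] at hq
    by_contra hni
    have h1 : (powerSums z q).ncard = 2 ^ q := by
      rw [powerSums, Set.ncard_image_of_injective, Set.ncard_coe_finset, Finset.card_powerset,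
        Finset.card_range]
      intro s t hst
      by_contra hne
      exact hni (isIntegral_of_powerSum_eq hne hst)
    have := h q
    omega
  let K := IntermediateField.adjoin ℚ {z}
  have : NumberField K := {
    to_charZero := charZero_of_injective_algebraMap (algebraMap ℚ _).injective
    to_finiteDimensional := IntermediateField.adjoin.finiteDimensional hz_int.tower_top }
  let y : K := ⟨z, IntermediateField.mem_adjoin_simple_self ℚ z⟩
  have hy : algebraMap K ℂ y = z := rfl
  obtain ⟨n, hn, hyn⟩ := NumberField.Embeddings.pow_eq_one_of_norm_le_one (x := y) K ℂ
    (fun h0 => hz (by rw [← hy, h0, map_zero]))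
    ((isIntegral_algebraMap_iff (algebraMap K ℂ).injective).1 (hy ▸ hz_int)) fun φ => by
      by_contra! hφ
      obtain ⟨r, hr⟩ := pow_unbounded_of_one_lt 2 hφ
      have hr1 : 1 ≤ r := by
        rcases Nat.eq_zero_or_pos r with rfl | h0
        · norm_num at hr
        · exact h0
      obtain ⟨q, hq⟩ := exists_lt_two_pow C r d
      have h1 := two_pow_le_ncard_powerSums hr1 (by rw [norm_pow]; exact hr.le : 2 ≤ ‖φ y ^ r‖) q
      rw [ncard_powerSums_map φ y, ← ncard_powerSums_map (algebraMap K ℂ) y, hy] at h1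
      have := h (r * q)
      omega
  exact ⟨n, hn, by rw [← hy, ← map_pow, hyn, map_one]⟩

end PowerSums

section Cocycle

variable {Γ : Type*} [Group Γ] {ℓ : Γ → ℕ} {C d : ℕ}

/-- A cocycle twisted by a character of infinite order is a coboundary, on a group of polynomial
growth. -/
theorem exists_coboundary (hℓ : IsPolyLength ℓ C d) {X : Type*} [AddCommGroup X] [Module ℂ X]
    (χ : Γ →* ℂ) (c : Γ → X) (hc : ∀ g h, c (g * h) = χ h • c g + c h) {t : Γ}
    (ht : ∀ n, 0 < n → χ t ^ n ≠ 1) : ∃ a : X, ∀ g, c g = (1 - χ g) • a := by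
  have hχ : ∀ g, χ g ≠ 0 := fun g h0 => by
    have := map_mul χ g g⁻¹
    rw [mul_inv_cancel, h0, zero_mul, map_one] at this
    exact one_ne_zero this
  have ht1 : 1 - χ t ≠ 0 := fun h => ht 1 one_pos (by rw [pow_one]; linear_combination -h)
  set a : X := (1 - χ t)⁻¹ • c t
  set b : Γ → X := fun g => c g - (1 - χ g) • a
  have hb : ∀ g h, b (g * h) = χ h • b g + b h := fun g h => by
    simp only [b, hc, map_mul]
    module
  have hbt : b t = 0 := by
    simp only [b, a]
    rw [smul_smul, mul_inv_cancel₀ ht1, one_smul, sub_self]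
  refine ⟨a, fun g => ?_⟩
  rw [← sub_eq_zero]
  change b g = 0
  by_contra hg
  set n := t * g * t⁻¹ * g⁻¹
  have hχn : χ n = 1 := by
    have h1 := map_mul χ n (g * t)
    rw [show n * (g * t) = t * g by simp only [n]; group, map_mul χ t g, map_mul χ g t] at h1
    exact mul_right_cancel₀ (mul_ne_zero (hχ g) (hχ t)) (by rw [one_mul, ← h1, mul_comm])
  have hbn : b n ≠ 0 := fun h0 => by
    have h1 := hb n (g * t)
    rw [show n * (g * t) = t * g by simp only [n]; group, hb t g, hb g t, hbt, h0, smul_zero,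
      smul_zero, zero_add, zero_add, add_zero] at h1
    have h2 : (1 - χ t) • b g = 0 := by rw [sub_smul, one_smul, ← h1, sub_self]
    exact (smul_ne_zero ht1 hg) h2
  have hwords : ∀ m : ℕ, ∀ s ⊆ Finset.range m, ∃ u, ℓ u ≤ m * (ℓ n + ℓ t) ∧ χ u = χ t ^ m ∧
      b u = (∑ i ∈ s, χ t ^ i) • b n := by
    intro m
    induction m with
    | zero =>
      intro s hs
      have : s = ∅ := by simpa using hs
      subst this
      refine ⟨1, by simp [hℓ.one], by simp, ?_⟩
      have h1 := hb 1 1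
      rw [mul_one, map_one, one_smul] at h1
      simpa using h1
    | succ m ih =>
      intro s hs
      obtain ⟨u, hu, hχu, hbu⟩ := ih (s.erase m) fun i hi => by
        have h1 := hs (Finset.mem_of_mem_erase hi)
        have h2 := Finset.ne_of_mem_erase hi
        rw [Finset.mem_range] at h1 ⊢
        omega
      by_cases hm : m ∈ s
      · refine ⟨t * n * u, ?_, ?_, ?_⟩
        · have h1 := hℓ.mul (t * n) u
          have h2 := hℓ.mul t n
          rw [add_one_mul]
          omega
        · rw [map_mul, map_mul, hχn, hχu, mul_one, pow_succ']
        · rw [hb, hb, hbt, smul_zero, zero_add, hbu, hχu, ← Finset.add_sum_erase s _ hm, add_smul]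
      · refine ⟨t * u, ?_, ?_, ?_⟩
        · have h1 := hℓ.mul t u
          rw [add_one_mul]
          omega
        · rw [map_mul, hχu, pow_succ']
        · rw [hb, hbt, smul_zero, zero_add, hbu, Finset.erase_eq_of_notMem hm]
  obtain ⟨k, hk, hk1⟩ := exists_pow_eq_one_of_powerSums (C := C * (ℓ n + ℓ t + 1) ^ d) (d := d)
    (hχ t) fun m => by
      choose! u hu _ hbu using hwords m
      have h1 : ((fun v : ℂ => v • b n) '' powerSums (χ t) m).ncard = (powerSums (χ t) m).ncard :=
        Set.ncard_image_of_injective _ fun v w hvw => smul_left_injective ℂ hbn hvw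
      have h2 : ((fun v : ℂ => v • b n) '' powerSums (χ t) m)
          ⊆ b '' {g | ℓ g ≤ m * (ℓ n + ℓ t)} := by
        rintro _ ⟨_, ⟨s, hs, rfl⟩, rfl⟩
        have hs' : s ⊆ Finset.range m := Finset.mem_powerset.1 (Finset.mem_coe.1 hs)
        exact ⟨u s, hu s hs', hbu s hs'⟩
      have h3 := Set.ncard_le_ncard h2 ((hℓ.finite _).image _)
      rw [h1] at h3
      refine h3.trans ((Set.ncard_image_le (hℓ.finite _)).trans ((hℓ.card _).trans ?_))
      rw [mul_assoc, ← mul_pow]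
      gcongr
      nlinarith
  exact ht k hk hk1

end Cocycle

section Polynomials

variable {G : Type*} [Group G]

/-- Functions of degree less than `j` on `G`, with respect to left differences by elements of a
subgroup `H`. -/
def pol (H : Subgroup G) : ℕ → Submodule ℂ (G → ℂ)
  | 0 => ⊥
  | j + 1 => ⨅ h : H, (pol H j).comap (leftTr G (h : G) - LinearMap.id)

variable {H H' : Subgroup G}

lemma mem_pol_zero {f : G → ℂ} : f ∈ pol H 0 ↔ f = 0 := Submodule.mem_bot ℂ

lemma mem_pol_succ {j : ℕ} {f : G → ℂ} :
    f ∈ pol H (j + 1) ↔ ∀ h ∈ H, leftTr G h f - f ∈ pol H j := by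
  simp [pol, Submodule.mem_iInf]

lemma pol_le_succ (H : Subgroup G) (j : ℕ) : pol H j ≤ pol H (j + 1) := by
  induction j with
  | zero => exact bot_le
  | succ j ih => exact fun f hf => mem_pol_succ.2 fun h hh => ih (mem_pol_succ.1 hf h hh)

lemma pol_mono (H : Subgroup G) : Monotone (pol H) := monotone_nat_of_le_succ (pol_le_succ H)

lemma pol_anti (hH : H' ≤ H) (j : ℕ) : pol H j ≤ pol H' j := by
  induction j with
  | zero => exact le_rfl
  | succ j ih =>
    exact fun f hf => mem_pol_succ.2 fun h hh => ih (mem_pol_succ.1 hf h (hH hh))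

lemma leftTr_mem_pol {j : ℕ} {f : G → ℂ} (hf : f ∈ pol H j) {h : G} (hh : h ∈ H) :
    leftTr G h f ∈ pol H j := by
  cases j with
  | zero => rw [mem_pol_zero.1 hf, map_zero]; exact Submodule.zero_mem _
  | succ j =>
    rw [← sub_add_cancel (leftTr G h f) f]
    exact Submodule.add_mem _ (pol_le_succ H j (mem_pol_succ.1 hf h hh)) hf

end Polynomials

section MaximumPrinciple

variable {G : Type*} [Group G] {ℓ : G → ℕ} {C d k : ℕ} {m : G → ℝ}

lemma IsCourteousWeight.eq_of_forall_eq_mul (hm : IsCourteousWeight ℓ m) {P : G → Prop}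
    (hP : ∀ x s, m s ≠ 0 → P x → P (x * s)) {x : G} (hx : P x) (y : G) : P y := by
  have h1 : ∀ g ∈ Subgroup.closure {x | m x ≠ 0}, ∀ x, P x ↔ P (x * g) := by
    intro g hg
    induction hg using Subgroup.closure_induction with
    | mem s hs =>
      refine fun x => ⟨hP x s hs, fun h => ?_⟩
      have := hP (x * s) s⁻¹ (by rw [hm.symm]; exact hs) h
      rwa [mul_inv_cancel_right] at this
    | one => simp
    | mul a b _ _ ha hb => intro x; rw [← mul_assoc, ← hb, ha]
    | inv a _ ha => intro x; rw [ha (x * a⁻¹), inv_mul_cancel_right]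
  have h2 := (h1 (x⁻¹ * y) (by rw [hm.adapted]; trivial) x).1 hx
  rwa [mul_inv_cancel_left] at h2

lemma IsHarm.eq_of_norm_le (hm : IsCourteousWeight ℓ m) {f : G → ℂ} (hf : IsHarm m f) {x₀ : G}
    (hmax : ∀ x, ‖f x‖ ≤ ‖f x₀‖) (x : G) : f x = f x₀ := by
  refine hm.eq_of_forall_eq_mul (P := fun y => f y = f x₀) (fun x s hs hx => ?_) rfl x
  have hsum : Summable fun s => m s • f (x * s) := by
    refine Summable.of_norm_bounded (hm.hasSum.summable.mul_right ‖f x₀‖) fun s => ?_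
    rw [norm_smul, Real.norm_of_nonneg (hm.nonneg s)]
    exact mul_le_mul_of_nonneg_left (hmax _) (hm.nonneg s)
  have h1 : HasSum (fun s => m s • f (x * s)) (f x) := by
    rw [hf x]; exact hsum.hasSum
  have h2 : HasSum (fun s => m s * (‖f x₀‖ ^ 2 - (f (x * s) * (starRingEnd ℂ) (f x₀)).re)) 0 := by
    have h3 := ((h1.mul_right ((starRingEnd ℂ) (f x₀))).mapL Complex.reCLM)
    have h4 := (hm.hasSum.mul_right (‖f x₀‖ ^ 2)).sub h3
    rw [hx] at h4
    have h5 : 1 * ‖f x₀‖ ^ 2 - Complex.reCLM (f x₀ * (starRingEnd ℂ) (f x₀)) = 0 := by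
      rw [Complex.reCLM_apply, Complex.mul_conj, Complex.ofReal_re, Complex.normSq_eq_norm_sq]
      ring
    rw [h5] at h4
    refine h4.congr_fun fun s => ?_
    rw [Complex.reCLM_apply, Complex.real_smul, mul_assoc, Complex.re_ofReal_mul]
    ring
  have h5 : ∀ y, 0 ≤ ‖f x₀‖ ^ 2 - (f y * (starRingEnd ℂ) (f x₀)).re := fun y => by
    have h6 := Complex.re_le_norm (f y * (starRingEnd ℂ) (f x₀))
    rw [norm_mul, Complex.norm_conj] at h6
    nlinarith [hmax y, norm_nonneg (f x₀)]
  have h7 := congrFun ((hasSum_zero_iff_of_nonneg fun s =>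
    mul_nonneg (hm.nonneg s) (h5 (x * s))).1 h2) s
  have h8 : ‖f x₀‖ ^ 2 - (f (x * s) * (starRingEnd ℂ) (f x₀)).re = 0 :=
    (mul_eq_zero.1 h7).resolve_left hs
  have h9 := Complex.normSq_sub (f (x * s)) (f x₀)
  rw [Complex.normSq_eq_norm_sq, Complex.normSq_eq_norm_sq, Complex.normSq_eq_norm_sq] at h9
  have h10 : ‖f (x * s) - f x₀‖ ^ 2 ≤ 0 := by
    nlinarith [hmax (x * s), norm_nonneg (f (x * s)), norm_nonneg (f x₀)]
  have h11 : ‖f (x * s) - f x₀‖ = 0 := by nlinarith [norm_nonneg (f (x * s) - f x₀)]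
  exact sub_eq_zero.1 (norm_eq_zero.1 h11)

lemma exists_norm_max_of_left_invariant {H : Subgroup G} (hH : H.FiniteIndex) {f : G → ℂ}
    (hf : ∀ h ∈ H, ∀ x, ‖f (h * x)‖ = ‖f x‖) : ∃ x₀, ∀ x, ‖f x‖ ≤ ‖f x₀‖ := by
  have : Finite (G ⧸ H) := Subgroup.finite_quotient_of_finiteIndex
  obtain ⟨q, hq⟩ := Finite.exists_max fun q : G ⧸ H => ‖f (q.out)⁻¹‖
  refine ⟨q.out⁻¹, fun x => ?_⟩
  have h1 := hq (QuotientGroup.mk x⁻¹)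
  obtain ⟨h, hh⟩ := QuotientGroup.mk_out_eq_mul H x⁻¹
  have h2 : (Quotient.out (QuotientGroup.mk x⁻¹ : G ⧸ H))⁻¹ = (h : G)⁻¹ * x := by
    rw [hh]; group
  rw [h2, hf _ (H.inv_mem h.2)] at h1
  exact h1

end MaximumPrinciple

section Devissage

variable {G : Type*} [Group G] {ℓ : G → ℕ} {C d k : ℕ} {m : G → ℝ}

lemma finiteIndex_ker_of_torsion {Γ : Type*} [Group Γ] [Group.FG Γ] (χ : Γ →* ℂ)
    (h : ∀ g, ∃ n, 0 < n ∧ χ g ^ n = 1) : ∃ K : Subgroup Γ, K.FiniteIndex ∧ ∀ g ∈ K, χ g = 1 := by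
  have : Finite χ.toHomUnits.range := by
    refine CommGroup.finite_of_fg_isMulTorsion _ ?_
    rintro ⟨_, g, rfl⟩
    obtain ⟨n, hn, hg⟩ := h g
    refine isOfFinOrder_iff_pow_eq_one.2 ⟨n, hn, ?_⟩
    ext
    simpa using hg
  refine ⟨χ.toHomUnits.ker, inferInstance, fun g hg => ?_⟩
  have := congrArg Units.val (MonoidHom.mem_ker.1 hg)
  simpa using this

/-- If `f` is an eigenvector for a unitary character modulo functions of degree less than `r`, and
the character has infinite order, then `f` may be corrected to be an eigenvector. -/
lemma exists_eigenvector_of_mod_pol (hℓ : IsPolyLength ℓ C d) {H : Subgroup G} (χ : H →* ℂ)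
    {t : H} (ht : ∀ n, 0 < n → χ t ^ n ≠ 1) (W : Submodule ℂ (G → ℂ)) (r : ℕ) : ∀ (f : G → ℂ)
    (_ : ∀ h : H, leftTr G (h : G) f - χ h • f ∈ W ⊓ pol H r)
    (_ : ∀ h : H, ∀ w ∈ W, leftTr G (h : G) w ∈ W),
    ∃ f', f' - f ∈ W ∧ ∀ h : H, leftTr G (h : G) f' = χ h • f' := by
  induction r with
  | zero =>
    intro f hf _
    refine ⟨f, by rw [sub_self]; exact W.zero_mem, fun h => ?_⟩
    exact sub_eq_zero.1 (mem_pol_zero.1 (hf h).2)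
  | succ r ih =>
    intro f hf hW
    have hmod : ∀ h : H, ∀ w ∈ pol H (r + 1),
        (Submodule.Quotient.mk (leftTr G (h : G) w) : (G → ℂ) ⧸ pol H r)
          = Submodule.Quotient.mk w := fun h w hw =>
      (Submodule.Quotient.eq _).2 (mem_pol_succ.1 hw h h.2)
    let c : H → (G → ℂ) := fun h => leftTr G (h : G) f - χ h • f
    obtain ⟨a, ha⟩ := exists_coboundary (hℓ.restrict H) χ
      (fun h => (Submodule.Quotient.mk (c h) : (G → ℂ) ⧸ pol H r)) (fun g h => by
        have h1 : c (g * h) = χ h • c g + leftTr G (g : G) (c h) := by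
          simp only [c]
          rw [Subgroup.coe_mul, map_mul, map_mul, Module.End.mul_apply, map_sub, map_smul]
          module
        rw [h1, Submodule.Quotient.mk_add, Submodule.Quotient.mk_smul, hmod g _ (hf h).2]) ht
    have ht1 : 1 - χ t ≠ 0 := fun h => ht 1 one_pos (by rw [pow_one]; linear_combination -h)
    set b := (1 - χ t)⁻¹ • c t
    have hb : b ∈ W ⊓ pol H (r + 1) := Submodule.smul_mem _ _ (hf t)
    have hba : (Submodule.Quotient.mk b : (G → ℂ) ⧸ pol H r) = a := by
      rw [Submodule.Quotient.mk_smul, ha, smul_smul, inv_mul_cancel₀ ht1, one_smul]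
    have hstep : ∀ h : H, leftTr G (h : G) (f - b) - χ h • (f - b) ∈ W ⊓ pol H r := by
      refine fun h => ⟨?_, ?_⟩
      · have h1 : leftTr G (h : G) (f - b) - χ h • (f - b)
            = c h - leftTr G (h : G) b + χ h • b := by
          simp only [c]
          rw [map_sub]
          module
        rw [h1]
        exact W.add_mem (W.sub_mem (hf h).1 (hW h b hb.1)) (W.smul_mem _ hb.1)
      · have h1 : leftTr G (h : G) (f - b) - χ h • (f - b)
            = (c h - (1 - χ h) • b) - (leftTr G (h : G) b - b) := by
          simp only [c]
          rw [map_sub]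
          module
        rw [h1]
        refine Submodule.sub_mem _ ?_ (mem_pol_succ.1 hb.2 h h.2)
        rw [← Submodule.Quotient.mk_eq_zero, Submodule.Quotient.mk_sub, Submodule.Quotient.mk_smul,
          ha, hba, sub_self]
    obtain ⟨f', hf'W, hf'⟩ := ih (f - b) hstep hW
    refine ⟨f', ?_, hf'⟩
    rw [show f' - f = f' - (f - b) - b by abel]
    exact W.sub_mem hf'W hb.1

/-- A finite-dimensional translation invariant space of harmonic functions of polynomial growth
consists of polynomials with respect to some finite index subgroup. -/
theorem exists_le_pol [Group.FG G] (hℓ : IsPolyLength ℓ C d) (hm : IsCourteousWeight ℓ m) (n : ℕ) :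
    ∀ (V : Submodule ℂ (G → ℂ)) [FiniteDimensional ℂ V], Module.finrank ℂ V ≤ n →
    V ≤ harmSpace hℓ hm k → ∀ H : Subgroup G, H.FiniteIndex →
    (∀ h ∈ H, ∀ f ∈ V, leftTr G h f ∈ V) →
    ∃ H' : Subgroup G, H'.FiniteIndex ∧ H' ≤ H ∧ ∃ r, V ≤ pol H' r := by
  induction n with
  | zero =>
    intro V _ hV _ H hH _
    refine ⟨H, hH, le_rfl, 0, ?_⟩
    rw [Submodule.finrank_eq_zero.1 (Nat.le_zero.1 hV)]
    exact bot_le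
  | succ n ih =>
    intro V _ hVn hV H hH hinv
    by_cases hne : V = ⊥
    · exact ⟨H, hH, le_rfl, 0, hne ▸ bot_le⟩
    obtain ⟨H₁, hH₁, hH₁H, lam, hlam, heig⟩ := exists_eigenfunctional hℓ H hH V
      (fun f hf => (hV hf).1) hne hinv
    have hinv₁ : ∀ h ∈ H₁, ∀ f ∈ V, leftTr G h f ∈ V := fun h hh => hinv h (hH₁H hh)
    set W : Submodule ℂ (G → ℂ) := (LinearMap.ker lam).map V.subtype
    have hWV : W ≤ V := Submodule.map_subtype_le _ _
    have hWmem : ∀ f : V, lam f = 0 → (f : G → ℂ) ∈ W := fun f hf => ⟨f, hf, rfl⟩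
    have hWfin : Module.finrank ℂ W ≤ n := by
      have h1 : Module.finrank ℂ W = Module.finrank ℂ (LinearMap.ker lam) :=
        (LinearEquiv.finrank_eq (Submodule.equivMapOfInjective V.subtype V.subtype_injective
          (LinearMap.ker lam))).symm
      have h2 : Module.finrank ℂ (LinearMap.ker lam) < Module.finrank ℂ V :=
        Submodule.finrank_lt fun h => hlam (LinearMap.ker_eq_top.1 h)
      omega
    have hWinv₁ : ∀ h ∈ H₁, ∀ f ∈ W, leftTr G h f ∈ W := by
      rintro h hh _ ⟨f, hf, rfl⟩
      obtain ⟨z, -, hz⟩ := heig h hh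
      refine hWmem ⟨leftTr G h f, hinv₁ h hh f f.2⟩ ?_
      rw [hz f _ rfl, LinearMap.mem_ker.1 hf, mul_zero]
    have : FiniteDimensional ℂ W := Submodule.finiteDimensional_of_le hWV
    obtain ⟨H₂, hH₂, hH₂₁, r, hr⟩ := ih W hWfin (hWV.trans hV) H₁ hH₁ hWinv₁
    obtain ⟨f₀, hf₀⟩ : ∃ f₀, lam f₀ = 1 := LinearMap.surjective hlam 1
    have hinv₂ : ∀ h : H₂, ∀ f ∈ V, leftTr G (h : G) f ∈ V := fun h => hinv₁ h (hH₂₁ h.2)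
    have heig₂ : ∀ h : H₂, ∀ f : V, lam ⟨leftTr G (h : G) f, hinv₂ h f f.2⟩
        = lam ⟨leftTr G (h : G) f₀, hinv₂ h f₀ f₀.2⟩ * lam f := fun h f => by
      obtain ⟨z, -, hz⟩ := heig h (hH₂₁ h.2)
      rw [hz f ⟨_, hinv₂ h f f.2⟩ rfl, hz f₀ ⟨_, hinv₂ h f₀ f₀.2⟩ rfl, hf₀, mul_one]
    let χ : H₂ →* ℂ :=
      { toFun := fun h => lam ⟨leftTr G (h : G) f₀, hinv₂ h f₀ f₀.2⟩
        map_one' := by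
          rw [← hf₀]
          congr 1
          apply Subtype.ext
          simp
        map_mul' := fun g h => by
          rw [← heig₂ g ⟨leftTr G (h : G) f₀, hinv₂ h f₀ f₀.2⟩]
          congr 1
          apply Subtype.ext
          simp }
    have hχ : ∀ h : H₂, ∀ f : V, lam ⟨leftTr G (h : G) f, hinv₂ h f f.2⟩ = χ h * lam f := heig₂
    have hχ1 : ∀ h, ‖χ h‖ = 1 := fun h => by
      obtain ⟨z, hz1, hz⟩ := heig h (hH₂₁ h.2)
      have := hχ h f₀
      rw [hz f₀ _ rfl, hf₀, mul_one, mul_one] at this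
      rw [← this, hz1]
    have hdiff : ∀ h : H₂, ∀ f : V, leftTr G (h : G) f - χ h • (f : G → ℂ) ∈ W := fun h f => by
      refine hWmem (⟨leftTr G (h : G) f, hinv₂ h f f.2⟩ - χ h • f) ?_
      rw [map_sub, map_smul, hχ, smul_eq_mul, sub_self]
    have : Group.FG H₂ := Subgroup.fg_of_index_ne_zero H₂
    by_cases htor : ∀ g, ∃ n, 0 < n ∧ χ g ^ n = 1
    · obtain ⟨K, hK, hKχ⟩ := finiteIndex_ker_of_torsion χ htor
      refine ⟨K.map H₂.subtype, ⟨?_⟩, (Subgroup.map_subtype_le K).trans (hH₂₁.trans hH₁H), r + 1,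
        fun f hf => mem_pol_succ.2 ?_⟩
      · rw [Subgroup.index_map_of_injective _ H₂.subtype_injective, H₂.range_subtype]
        exact mul_ne_zero hK.index_ne_zero hH₂.index_ne_zero
      · rintro _ ⟨g, hg, rfl⟩
        have h1 := hdiff g ⟨f, hf⟩
        rw [hKχ g hg, one_smul] at h1
        exact pol_anti (Subgroup.map_subtype_le K) r (hr h1)
    · push Not at htor
      obtain ⟨t, ht⟩ := htor
      exfalso
      obtain ⟨f, hfW, hf⟩ := exists_eigenvector_of_mod_pol hℓ χ ht W r f₀
        (fun h => ⟨hdiff h f₀, hr (hdiff h f₀)⟩) fun h => hWinv₁ h (hH₂₁ h.2)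
      have hfV : f ∈ V := by
        rw [← sub_add_cancel f f₀]
        exact V.add_mem (hWV hfW) f₀.2
      have hf0 : f ≠ 0 := by
        rintro rfl
        obtain ⟨w, hw, hwe⟩ := hfW
        have h1 : w = -f₀ := Subtype.ext (by simpa using hwe)
        rw [SetLike.mem_coe, LinearMap.mem_ker, h1, map_neg, hf₀] at hw
        norm_num at hw
      obtain ⟨x₀, hx₀⟩ := exists_norm_max_of_left_invariant hH₂ (f := f) fun h hh x => by
        have h1 := congrFun (hf ⟨h⁻¹, H₂.inv_mem hh⟩) x
        rw [leftTr_apply, inv_inv] at h1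
        rw [h1, Pi.smul_apply, norm_smul, hχ1, one_mul]
      have hconst := (hV hfV).2.eq_of_norm_le hm hx₀
      have hfx : f x₀ ≠ 0 := fun h0 => hf0 (funext fun x => by rw [hconst x, h0]; rfl)
      refine ht 1 one_pos ?_
      have h1 := congrFun (hf t) x₀
      rw [leftTr_apply, hconst, Pi.smul_apply, smul_eq_mul] at h1
      rw [pow_one]
      exact mul_right_cancel₀ hfx (by rw [one_mul, ← h1])

end Devissage

section RightTranslation

variable {G : Type*} [Group G] {H : Subgroup G} {j : ℕ}

/-- Right translation of functions. -/
def rightTr (g : G) : (G → ℂ) →ₗ[ℂ] (G → ℂ) := LinearMap.funLeft ℂ ℂ (fun x => x * g)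

@[simp] lemma rightTr_apply (g : G) (f : G → ℂ) (x : G) : rightTr g f x = f (x * g) := rfl

/-- Invariance under left multiplication by elements of a subgroup. -/
def IsLeftInv (H : Subgroup G) {α : Type*} (a : G → α) : Prop := ∀ h ∈ H, ∀ x, a (h * x) = a x

lemma mem_pol_one {f : G → ℂ} : f ∈ pol H 1 ↔ IsLeftInv H f := by
  rw [mem_pol_succ]
  constructor
  · intro hf h hh x
    have := congrFun (mem_pol_zero.1 (hf h⁻¹ (H.inv_mem hh))) x
    simpa [sub_eq_zero] using this
  · intro hf h hh
    refine mem_pol_zero.2 (funext fun x => ?_)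
    simp [hf _ (H.inv_mem hh)]

lemma comp_mem_pol {a : G → G} (ha : IsLeftInv H a) {f : G → ℂ} (hf : f ∈ pol H j) :
    (fun x => f (x * a x)) ∈ pol H j := by
  induction j generalizing f with
  | zero => rw [mem_pol_zero.1 hf]; exact Submodule.zero_mem _
  | succ j ih =>
    refine mem_pol_succ.2 fun h hh => ?_
    convert ih (mem_pol_succ.1 hf h hh) using 1
    ext x
    simp [ha _ (H.inv_mem hh), mul_assoc]

lemma comp_sub_comp_mem_pol [H.Normal] {a b : G → G} (ha : IsLeftInv H a) (hb : IsLeftInv H b)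
    (hab : ∀ x, (a x)⁻¹ * b x ∈ H) {f : G → ℂ} (hf : f ∈ pol H (j + 1)) :
    (fun x => f (x * b x) - f (x * a x)) ∈ pol H j := by
  induction j generalizing f with
  | zero =>
    refine mem_pol_zero.2 (funext fun x => ?_)
    have h1 := mem_pol_one.1 hf _
      (Subgroup.Normal.conj_mem inferInstance _ (hab x) (x * a x)) (x * a x)
    rw [Pi.zero_apply, sub_eq_zero, ← h1]
    congr 1
    group
  | succ j ih =>
    refine mem_pol_succ.2 fun h hh => ?_
    convert ih (mem_pol_succ.1 hf h hh) using 1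
    ext x
    simp [ha _ (H.inv_mem hh), hb _ (H.inv_mem hh), mul_assoc]
    ring

lemma rightTr_mem_pol (g : G) {f : G → ℂ} (hf : f ∈ pol H j) : rightTr g f ∈ pol H j :=
  comp_mem_pol (a := fun _ => g) (fun _ _ _ => rfl) hf

lemma rightTr_sub_mem_pol [H.Normal] {g : G} (hg : g ∈ H) {f : G → ℂ} (hf : f ∈ pol H j) :
    rightTr g f - f ∈ pol H (j - 1) := by
  cases j with
  | zero => rw [mem_pol_zero.1 hf, map_zero, sub_zero]; exact Submodule.zero_mem _
  | succ j =>
    have := comp_sub_comp_mem_pol (a := fun _ => 1) (b := fun _ => g) (fun _ _ _ => rfl)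
      (fun _ _ _ => rfl) (fun _ => by simpa using hg) hf
    simp only [mul_one] at this
    exact this

lemma mul_mem_pol {a f : G → ℂ} (ha : IsLeftInv H a) (hf : f ∈ pol H j) : a * f ∈ pol H j := by
  induction j generalizing f with
  | zero => rw [mem_pol_zero.1 hf, mul_zero]; exact Submodule.zero_mem _
  | succ j ih =>
    refine mem_pol_succ.2 fun h hh => ?_
    convert ih (mem_pol_succ.1 hf h hh) using 1
    ext x
    simp [ha _ (H.inv_mem hh), mul_sub]

lemma mul_mem_pol_succ {a f : G → ℂ} {e : G → ℂ} (ha : ∀ h ∈ H, ∀ x, a (h * x) = e h + a x)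
    (hf : f ∈ pol H j) : a * f ∈ pol H (j + 1) := by
  induction j generalizing f with
  | zero => rw [mem_pol_zero.1 hf, mul_zero]; exact Submodule.zero_mem _
  | succ j ih =>
    refine mem_pol_succ.2 fun h hh => ?_
    have h1 : leftTr G h (a * f) - a * f = a * (leftTr G h f - f) + e h⁻¹ • leftTr G h f := by
      ext x
      simp only [Pi.sub_apply, Pi.mul_apply, Pi.add_apply, Pi.smul_apply, leftTr_apply,
        ha _ (H.inv_mem hh), smul_eq_mul]
      ring
    rw [h1]
    exact Submodule.add_mem _ (ih (mem_pol_succ.1 hf h hh))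
      (Submodule.smul_mem _ _ (leftTr_mem_pol hf hh))

lemma mem_pol_of_hasSum {ι : Type*} {F : ι → G → ℂ} {f : G → ℂ} (hF : ∀ i, F i ∈ pol H j)
    (h : ∀ x, HasSum (fun i => F i x) (f x)) : f ∈ pol H j := by
  induction j generalizing F f with
  | zero =>
    refine mem_pol_zero.2 (funext fun x => (h x).unique ?_)
    have h0 : ∀ i, F i x = 0 := fun i => by rw [mem_pol_zero.1 (hF i)]; rfl
    simp only [h0]
    exact hasSum_zero
  | succ j ih =>
    refine mem_pol_succ.2 fun g hg => ih (fun i => mem_pol_succ.1 (hF i) g hg) fun x => ?_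
    exact (h (g⁻¹ * x)).sub (h x)

lemma exists_finset_closure_subgroup [Group.FG G] (H : Subgroup G) [H.FiniteIndex] :
    ∃ T : Finset G, Subgroup.closure (T : Set G) = H :=
  (Group.fg_iff_subgroup_fg H).1 (Subgroup.fg_of_index_ne_zero H)

lemma isLeftInv_closure {T : Set G} {α : Type*} {a : G → α} (h : ∀ s ∈ T, ∀ x, a (s * x) = a x) :
    IsLeftInv (Subgroup.closure T) a := by
  intro g hg
  induction hg using Subgroup.closure_induction with
  | mem s hs => exact h s hs
  | one => simp
  | mul g g' _ _ h1 h2 => intro x; rw [mul_assoc, h1, h2]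
  | inv g _ h1 => intro x; rw [← h1, mul_inv_cancel_left]

/-- Coset representatives, with the trivial coset represented by `1`. -/
def cosetRep (H : Subgroup G) (q : G ⧸ H) : G :=
  open Classical in Function.update Quotient.out (QuotientGroup.mk 1) 1 q

lemma mk_cosetRep (q : G ⧸ H) : (QuotientGroup.mk (cosetRep H q) : G ⧸ H) = q := by
  classical
  by_cases hq : q = QuotientGroup.mk 1
  · rw [cosetRep, hq, Function.update_self]
  · rw [cosetRep, Function.update_of_ne hq, QuotientGroup.out_eq']

/-- The coset representative of an element. -/
def rep (H : Subgroup G) (x : G) : G := cosetRep H (QuotientGroup.mk x)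

variable [H.Normal]

lemma mk_mul_eq {h : G} (hh : h ∈ H) (x : G) :
    (QuotientGroup.mk (h * x) : G ⧸ H) = QuotientGroup.mk x := by
  rw [QuotientGroup.mk_mul, (QuotientGroup.eq_one_iff h).2 hh, one_mul]

lemma isLeftInv_rep : IsLeftInv H (rep H) := fun h hh x => by rw [rep, mk_mul_eq hh, rep]

lemma rep_of_mem {h : G} (hh : h ∈ H) : rep H h = 1 := by
  classical
  have h1 : (QuotientGroup.mk h : G ⧸ H) = QuotientGroup.mk 1 := (QuotientGroup.eq_one_iff h).2 hh
  rw [rep, h1]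
  exact Function.update_self _ _ _

lemma mul_rep_inv_mem (x : G) : x * (rep H x)⁻¹ ∈ H := by
  rw [← QuotientGroup.eq_one_iff, QuotientGroup.mk_mul, QuotientGroup.mk_inv, rep, mk_cosetRep,
    mul_inv_cancel]

lemma isLeftInv_rep_inv : IsLeftInv H fun x => (rep H x)⁻¹ :=
  fun h hh x => by simp only [isLeftInv_rep h hh]

lemma rep_mul_inv_mem (g x : G) : ((rep H x)⁻¹)⁻¹ * (g * (rep H (x * g))⁻¹) ∈ H := by
  rw [← QuotientGroup.eq_one_iff]
  simp only [QuotientGroup.mk_mul, QuotientGroup.mk_inv, rep, mk_cosetRep]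
  group

lemma rightTr_comp_rep_sub_mem {f : G → ℂ} (hf : f ∈ pol H j) (g : G) :
    (rightTr g (fun x => f (x * (rep H x)⁻¹)) - fun x => f (x * (rep H x)⁻¹))
      ∈ pol H (j - 1) := by
  cases j with
  | zero =>
    rw [mem_pol_zero.1 hf]
    convert Submodule.zero_mem _
    ext x
    simp
  | succ j =>
    have h1 := comp_sub_comp_mem_pol (b := fun x => g * (rep H (x * g))⁻¹) isLeftInv_rep_inv
      (fun h hh x => by simp only [mul_assoc, isLeftInv_rep h hh]) (rep_mul_inv_mem g) hf
    simp only [← mul_assoc] at h1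
    exact h1

lemma finiteDimensional_pol [Group.FG G] [H.FiniteIndex] (j : ℕ) :
    FiniteDimensional ℂ (pol H j) := by
  induction j with
  | zero => exact inferInstanceAs (FiniteDimensional ℂ (⊥ : Submodule ℂ (G → ℂ)))
  | succ j ih =>
    obtain ⟨T, hT⟩ := exists_finset_closure_subgroup H
    have hTH : ∀ s ∈ T, s ∈ H := fun s hs => hT ▸ Subgroup.subset_closure hs
    have : Fintype (G ⧸ H) := Fintype.ofFinite _
    let Φ : pol H (j + 1) →ₗ[ℂ] (T → pol H j) × (G ⧸ H → ℂ) :=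
      { toFun := fun f => (fun s => ⟨leftTr G (s : G)⁻¹ f - f,
          mem_pol_succ.1 f.2 _ (H.inv_mem (hTH s s.2))⟩, fun q => (f : G → ℂ) (cosetRep H q))
        map_add' := fun f g => by
          ext s
          · simp; ring
          · simp
        map_smul' := fun c f => by
          ext s
          · simp; ring
          · simp }
    refine FiniteDimensional.of_injective Φ ((injective_iff_map_eq_zero Φ).2 fun f hf => ?_)
    have h1 : ∀ s ∈ (T : Set G), ∀ x, (f : G → ℂ) (s * x) = (f : G → ℂ) x := fun s hs x => by
      have h2 := congrFun (congrArg Subtype.val (congrFun (congrArg Prod.fst hf) ⟨s, hs⟩)) x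
      simpa [Φ, sub_eq_zero] using h2
    have h2 := isLeftInv_closure h1
    rw [hT] at h2
    ext x
    have h3 : (f : G → ℂ) (rep H x) = 0 := congrFun (congrArg Prod.snd hf) (QuotientGroup.mk x)
    have h4 := h2 _ (mul_rep_inv_mem x) (rep H x)
    rw [inv_mul_cancel_right, h3] at h4
    exact h4

end RightTranslation

section Growth

variable {G : Type*} [Group G] {H : Subgroup G} {ℓ : G → ℕ} {C d k j : ℕ}

lemma IsLeftInv.hasGrowth_zero [H.Normal] [H.FiniteIndex] {f : G → ℂ} (hf : IsLeftInv H f) :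
    HasGrowth ℓ 0 f := by
  have : Fintype (G ⧸ H) := Fintype.ofFinite _
  refine ⟨1 + ∑ q : G ⧸ H, ‖f (cosetRep H q)‖, by positivity, fun x => ?_⟩
  have h1 := hf _ (mul_rep_inv_mem x) (rep H x)
  rw [inv_mul_cancel_right] at h1
  have h2 := Finset.single_le_sum (f := fun q : G ⧸ H => ‖f (cosetRep H q)‖)
    (fun q _ => norm_nonneg _) (Finset.mem_univ (QuotientGroup.mk x))
  rw [pow_zero, mul_one, h1]
  have h3 : ‖f (rep H x)‖ ≤ ∑ q : G ⧸ H, ‖f (cosetRep H q)‖ := h2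
  linarith

lemma hasGrowth_succ_of_rightTr_sub (hℓ : IsPolyLength ℓ C d) (hgeo : IsGeodesicLength ℓ)
    {f : G → ℂ} (h : ∀ s, HasGrowth ℓ j (rightTr s f - f)) : HasGrowth ℓ (j + 1) f := by
  choose c hc hcf using h
  set c₀ := ∑ s ∈ (hℓ.finite 1).toFinset, c s
  set B := 1 + ∑ x ∈ (hℓ.finite 0).toFinset, ‖f x‖
  have hc₀ : 0 ≤ c₀ := Finset.sum_nonneg fun s _ => (hc s).le
  have hB : 0 < B := by positivity
  have key : ∀ n x, ℓ x ≤ n → ‖f x‖ ≤ B + n * (c₀ * (1 + n) ^ j) := by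
    intro n
    induction n with
    | zero =>
      intro x hx
      have := Finset.single_le_sum (f := fun x => ‖f x‖) (fun x _ => norm_nonneg _)
        ((hℓ.finite 0).mem_toFinset.2 hx)
      simp only [Nat.cast_zero, zero_mul, add_zero, B]
      linarith
    | succ n ih =>
      intro x hx
      obtain ⟨y, s, hy, hs, rfl⟩ := hgeo x n hx
      have h1 := hcf s y
      have h2 : c s ≤ c₀ := Finset.single_le_sum (f := c) (fun s _ => (hc s).le)
        ((hℓ.finite 1).mem_toFinset.2 hs)
      have h3 : ‖f (y * s)‖ ≤ ‖f y‖ + ‖(rightTr s f - f) y‖ := by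
        have : f (y * s) = f y + (rightTr s f - f) y := by simp
        rw [this]
        exact norm_add_le _ _
      have h4 : c s * (1 + (ℓ y : ℝ)) ^ j ≤ c₀ * (1 + (n + 1 : ℕ)) ^ j := by
        gcongr
        omega
      have h5 : (n : ℝ) * (c₀ * (1 + n) ^ j) ≤ n * (c₀ * (1 + (n + 1 : ℕ)) ^ j) := by
        gcongr
        linarith
      have h6 : ((n + 1 : ℕ) : ℝ) * (c₀ * (1 + (n + 1 : ℕ)) ^ j)
          = n * (c₀ * (1 + (n + 1 : ℕ)) ^ j) + c₀ * (1 + (n + 1 : ℕ)) ^ j := by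
        push_cast
        ring
      rw [h6]
      linarith [ih y hy]
  refine ⟨B + c₀, by positivity, fun x => (key _ x le_rfl).trans ?_⟩
  have h1 : (1 : ℝ) ≤ (1 + (ℓ x : ℝ)) ^ (j + 1) := one_le_pow₀ (by simp)
  have h2 : (0 : ℝ) ≤ c₀ * (1 + (ℓ x : ℝ)) ^ j := by positivity
  rw [add_mul]
  refine add_le_add (le_mul_of_one_le_right hB.le h1) ?_
  rw [pow_succ]
  nlinarith

theorem hasGrowth_of_mem_pol [H.Normal] [H.FiniteIndex] (hℓ : IsPolyLength ℓ C d)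
    (hgeo : IsGeodesicLength ℓ) {f : G → ℂ} (hf : f ∈ pol H (j + 1)) : HasGrowth ℓ j f := by
  have : Fintype (G ⧸ H) := Fintype.ofFinite _
  induction j generalizing f with
  | zero => exact (mem_pol_one.1 hf).hasGrowth_zero
  | succ j ih =>
    have h1 : ∀ q : G ⧸ H, HasGrowth ℓ (j + 1)
        (fun x => rightTr (cosetRep H q) f (x * (rep H x)⁻¹)) := fun q =>
      hasGrowth_succ_of_rightTr_sub hℓ hgeo fun s =>
        ih (rightTr_comp_rep_sub_mem (rightTr_mem_pol (cosetRep H q) hf) s)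
    choose c hc hcf using h1
    refine ⟨1 + ∑ q, c q, by have := Finset.sum_nonneg fun q (_ : q ∈ Finset.univ) => (hc q).le
                             positivity, fun x => ?_⟩
    have h2 := hcf (QuotientGroup.mk x) x
    simp only [rightTr_apply] at h2
    rw [← rep, inv_mul_cancel_right] at h2
    refine h2.trans ?_
    gcongr
    have := Finset.single_le_sum (f := c) (fun q _ => (hc q).le)
      (Finset.mem_univ (QuotientGroup.mk x))
    linarith

/-- Iterated left differences. -/
def iterDiff : List G → (G → ℂ) → (G → ℂ)
  | [], f => f
  | h :: hs, f => iterDiff hs (leftTr G h f - f)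

lemma iterDiff_add (hs : List G) (f g : G → ℂ) :
    iterDiff hs (f + g) = iterDiff hs f + iterDiff hs g := by
  induction hs generalizing f g with
  | nil => rfl
  | cons h hs ih =>
    simp only [iterDiff]
    rw [← ih, map_add]
    congr 1
    abel

lemma iterDiff_smul (hs : List G) (c : ℂ) (f : G → ℂ) :
    iterDiff hs (c • f) = c • iterDiff hs f := by
  induction hs generalizing f with
  | nil => rfl
  | cons h hs ih =>
    simp only [iterDiff]
    rw [← ih, map_smul, smul_sub]

lemma mem_pol_iff_iterDiff {f : G → ℂ} :
    f ∈ pol H j ↔ ∀ hs : List G, hs.length = j → (∀ h ∈ hs, h ∈ H) → iterDiff hs f = 0 := by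
  induction j generalizing f with
  | zero =>
    rw [mem_pol_zero]
    refine ⟨fun h hs hl _ => ?_, fun h => h [] rfl (by simp)⟩
    rw [List.length_eq_zero_iff.1 hl]
    exact h
  | succ j ih =>
    rw [mem_pol_succ]
    constructor
    · rintro h (_ | ⟨g, hs⟩) hl hH
      · simp at hl
      · exact ih.1 (h g (hH g (by simp))) hs (by simpa using hl) fun x hx => hH x (by simp [hx])
    · intro h g hg
      refine ih.2 fun hs hl hH => h (g :: hs) (by simp [hl]) ?_
      simpa [hg] using hH

lemma leftTr_pow_sub_mem_pol {f : G → ℂ} (hf : f ∈ pol H (j + 1)) {h : G} (hh : h ∈ H) (n : ℕ) :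
    (leftTr G (h ^ n) f - f) - (n : ℂ) • (leftTr G h f - f) ∈ pol H (j - 1) := by
  induction n with
  | zero => simp
  | succ n ih =>
    have h1 : (leftTr G (h ^ (n + 1)) f - f) - ((n + 1 : ℕ) : ℂ) • (leftTr G h f - f)
        = (leftTr G (h ^ n) f - f - (n : ℂ) • (leftTr G h f - f))
          + (leftTr G (h ^ n) (leftTr G h f - f) - (leftTr G h f - f)) := by
      rw [pow_succ, map_mul, Module.End.mul_apply, map_sub]
      push_cast
      module
    rw [h1]
    refine Submodule.add_mem _ ih ?_
    have h2 := mem_pol_succ.1 hf h hh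
    cases j with
    | zero => rw [mem_pol_zero.1 h2, map_zero, sub_zero]; exact Submodule.zero_mem _
    | succ j => exact mem_pol_succ.1 h2 _ (H.pow_mem hh n)

lemma iterDiff_map_pow (n : ℕ) (hs : List G) (hH : ∀ h ∈ hs, h ∈ H) {f : G → ℂ}
    (hf : f ∈ pol H (hs.length + 1)) :
    iterDiff (hs.map (· ^ n)) f = (n : ℂ) ^ hs.length • iterDiff hs f := by
  induction hs generalizing f with
  | nil => simp [iterDiff]
  | cons h hs ih =>
    have hh : h ∈ H := hH h (by simp)
    have hH' : ∀ g ∈ hs, g ∈ H := fun g hg => hH g (by simp [hg])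
    have h1 := leftTr_pow_sub_mem_pol hf hh n
    rw [List.length_cons, Nat.add_sub_cancel] at h1
    have h2 := mem_pol_iff_iterDiff.1 h1 (hs.map (· ^ n)) (by simp) (by
      simp only [List.mem_map]
      rintro _ ⟨g, hg, rfl⟩
      exact H.pow_mem (hH' g hg) n)
    rw [List.map_cons, iterDiff, iterDiff, ← sub_add_cancel (leftTr G (h ^ n) f - f)
      ((n : ℂ) • (leftTr G h f - f)), iterDiff_add, h2, zero_add, iterDiff_smul,
      ih hH' (mem_pol_succ.1 hf h hh), smul_smul, List.length_cons, pow_succ']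

lemma IsPolyLength.pow_le (hℓ : IsPolyLength ℓ C d) (x : G) (n : ℕ) : ℓ (x ^ n) ≤ n * ℓ x := by
  induction n with
  | zero => simp [hℓ.one]
  | succ n ih =>
    rw [pow_succ, add_one_mul]
    exact (hℓ.mul _ _).trans (by omega)

lemma norm_iterDiff_map_pow_le (hℓ : IsPolyLength ℓ C d) (n : ℕ) (hs : List G) {f : G → ℂ} {c : ℝ}
    {a : ℕ} (hc : 0 ≤ c) (hf : ∀ x, ‖f x‖ ≤ c * ((1 + a + ℓ x : ℕ) : ℝ) ^ k) (x : G) :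
    ‖iterDiff (hs.map (· ^ n)) f x‖
      ≤ 2 ^ hs.length * c * ((1 + a + n * (hs.map ℓ).sum + ℓ x : ℕ) : ℝ) ^ k := by
  induction hs generalizing f a c with
  | nil => simpa [iterDiff] using hf x
  | cons h hs ih =>
    have h1 : ∀ x, ‖(leftTr G (h ^ n) f - f) x‖
        ≤ 2 * c * ((1 + (a + n * ℓ h) + ℓ x : ℕ) : ℝ) ^ k := fun x => by
      have h2 : ‖(leftTr G (h ^ n) f - f) x‖ ≤ ‖f ((h ^ n)⁻¹ * x)‖ + ‖f x‖ := norm_sub_le _ _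
      have h3 : ℓ ((h ^ n)⁻¹ * x) ≤ n * ℓ h + ℓ x :=
        (hℓ.mul _ _).trans (by rw [hℓ.inv]; have := hℓ.pow_le h n; omega)
      have h4 : c * ((1 + a + ℓ ((h ^ n)⁻¹ * x) : ℕ) : ℝ) ^ k
          ≤ c * ((1 + (a + n * ℓ h) + ℓ x : ℕ) : ℝ) ^ k := by
        gcongr 2
        exact_mod_cast (by omega)
      have h5 : c * ((1 + a + ℓ x : ℕ) : ℝ) ^ k
          ≤ c * ((1 + (a + n * ℓ h) + ℓ x : ℕ) : ℝ) ^ k := by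
        gcongr 2
        exact_mod_cast (by omega)
      linarith [hf x, hf ((h ^ n)⁻¹ * x)]
    have h2 := ih (by positivity) h1
    rw [List.map_cons, iterDiff]
    refine h2.trans (le_of_eq ?_)
    rw [List.map_cons, List.sum_cons, List.length_cons]
    congr 1
    · ring
    · congr 2
      ring

lemma mem_pol_of_hasGrowth (hℓ : IsPolyLength ℓ C d) {f : G → ℂ} (hf : f ∈ pol H (j + 1))
    (hg : HasGrowth ℓ k f) (hk : k < j) : f ∈ pol H j := by
  refine mem_pol_iff_iterDiff.2 fun hs hl hH => funext fun x => ?_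
  subst hl
  obtain ⟨c, hc, hcf⟩ := hg
  by_contra hne
  have hpos : 0 < ‖iterDiff hs f x‖ := norm_pos_iff.2 hne
  set Λ : ℝ := 2 ^ hs.length * c * ((1 + (hs.map ℓ).sum + ℓ x : ℕ) : ℝ) ^ k
  have key : ∀ n : ℕ, 1 ≤ n → (n : ℝ) * ‖iterDiff hs f x‖ ≤ Λ := fun n hn => by
    have hn' : (1 : ℝ) ≤ n := by exact_mod_cast hn
    have h1 := norm_iterDiff_map_pow_le (k := k) (a := 0) hℓ n hs hc.le
      (fun x => by push_cast; simpa using hcf x) x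
    rw [iterDiff_map_pow n hs hH hf, Pi.smul_apply, norm_smul, norm_pow, Complex.norm_natCast] at h1
    have h2 : ((1 + 0 + n * (hs.map ℓ).sum + ℓ x : ℕ) : ℝ)
        ≤ n * ((1 + (hs.map ℓ).sum + ℓ x : ℕ) : ℝ) := by
      exact_mod_cast (by nlinarith : 1 + 0 + n * (hs.map ℓ).sum + ℓ x
        ≤ n * (1 + (hs.map ℓ).sum + ℓ x))
    have h3 : (n : ℝ) ^ hs.length * ‖iterDiff hs f x‖ ≤ n ^ k * Λ := by
      refine h1.trans ?_
      calc _ ≤ 2 ^ hs.length * c * (n * ((1 + (hs.map ℓ).sum + ℓ x : ℕ) : ℝ)) ^ k := by gcongr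
        _ = n ^ k * Λ := by simp only [Λ]; ring
    have h4 : (n : ℝ) ^ (k + 1) ≤ n ^ hs.length := pow_le_pow_right₀ hn' hk
    have h5 : (n : ℝ) ^ k * (n * ‖iterDiff hs f x‖) ≤ n ^ k * Λ := by
      refine le_trans ?_ h3
      rw [← mul_assoc, ← pow_succ]
      gcongr
    exact le_of_mul_le_mul_left h5 (by positivity)
  obtain ⟨n, hn⟩ := exists_nat_gt (Λ / ‖iterDiff hs f x‖)
  have h1 := key (n + 1) (by omega)
  rw [div_lt_iff₀ hpos] at hn
  push_cast at h1
  nlinarith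

theorem mem_pol_succ_of_hasGrowth (hℓ : IsPolyLength ℓ C d) {f : G → ℂ} {r : ℕ}
    (hf : f ∈ pol H r) (hg : HasGrowth ℓ k f) : f ∈ pol H (k + 1) := by
  induction r with
  | zero => exact pol_mono H (Nat.zero_le _) hf
  | succ r ih =>
    rcases Nat.lt_or_ge k r with h | h
    · exact ih (mem_pol_of_hasGrowth hℓ hf hg h)
    · exact pol_mono H (by omega) hf

end Growth

section HarmonicSums

variable {G : Type*} [Group G] {ℓ : G → ℕ} {m : G → ℝ} {H : Subgroup G} {j : ℕ}

/-- Harmonicity together with absolute convergence of the averages. -/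
def IsSumHarm (m : G → ℝ) (f : G → ℂ) : Prop := ∀ x, HasSum (fun s => m s • f (x * s)) (f x)

lemma IsSumHarm.isHarm {f : G → ℂ} (hf : IsSumHarm m f) : IsHarm m f := fun x => (hf x).tsum_eq.symm

lemma IsSumHarm.sub {f g : G → ℂ} (hf : IsSumHarm m f) (hg : IsSumHarm m g) :
    IsSumHarm m (f - g) := fun x => by simpa [smul_sub] using (hf x).sub (hg x)

lemma IsSumHarm.leftTr {f : G → ℂ} (hf : IsSumHarm m f) (h : G) :
    IsSumHarm m (PolyHarm.leftTr G h f) := fun x => by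
  simpa [mul_assoc] using hf (h⁻¹ * x)

lemma IsSumHarm.eq_of_isLeftInv (hm : IsCourteousWeight ℓ m) (hH : H.FiniteIndex) {f : G → ℂ}
    (hf : IsSumHarm m f) (hinv : IsLeftInv H f) (x y : G) : f x = f y := by
  obtain ⟨x₀, hx₀⟩ := exists_norm_max_of_left_invariant (f := f) hH
    fun h hh x => by rw [hinv h hh]
  rw [hf.isHarm.eq_of_norm_le hm hx₀ x, hf.isHarm.eq_of_norm_le hm hx₀ y]

lemma IsSumHarm.rightTr_sub_mem_pol (hm : IsCourteousWeight ℓ m) (hH : H.FiniteIndex) {f : G → ℂ}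
    (hf : IsSumHarm m f) (hp : f ∈ pol H (j + 1)) (g : G) : rightTr g f - f ∈ pol H j := by
  induction j generalizing f with
  | zero =>
    refine mem_pol_zero.2 (funext fun x => ?_)
    simp [hf.eq_of_isLeftInv hm hH (mem_pol_one.1 hp) (x * g) x]
  | succ j ih =>
    refine mem_pol_succ.2 fun h hh => ?_
    convert ih ((hf.leftTr h).sub hf) (mem_pol_succ.1 hp h hh) using 1
    ext x
    simp [mul_assoc]
    ring

end HarmonicSums

section Uniqueness

variable {G : Type*} [Group G] {ℓ : G → ℕ} {m : G → ℝ} {H : Subgroup G} {t : G → ℤ} {τ : G}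

/-- A function on `G` extending a surjective homomorphism from `H` to the integers, equivariant
for left translation by `H`, together with an element of `H` of value one. -/
structure IsCoord (H : Subgroup G) (t : G → ℤ) (τ : G) : Prop where
  mul : ∀ h ∈ H, ∀ x, t (h * x) = t h + t x
  mem : τ ∈ H
  apply : t τ = 1

namespace IsCoord

lemma one (ht : IsCoord H t τ) : t 1 = 0 := by
  have := ht.mul 1 H.one_mem 1
  rw [one_mul] at this
  omega

lemma inv (ht : IsCoord H t τ) {h : G} (hh : h ∈ H) : t h⁻¹ = -t h := by
  have := ht.mul h⁻¹ (H.inv_mem hh) h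
  rw [inv_mul_cancel, ht.one] at this
  omega

lemma pow (ht : IsCoord H t τ) (n : ℕ) : t (τ ^ n) = n := by
  induction n with
  | zero => simp [ht.one]
  | succ n ih => rw [pow_succ', ht.mul _ ht.mem, ih, ht.apply]; push_cast; ring

lemma zpow (ht : IsCoord H t τ) (z : ℤ) : t (τ ^ z) = z := by
  obtain ⟨n, rfl | rfl⟩ := z.eq_nat_or_neg
  · rw [zpow_natCast, ht.pow]
  · rw [zpow_neg, zpow_natCast, ht.inv (H.pow_mem ht.mem n), ht.pow]

lemma isLeftInv (ht : IsCoord H t τ) {α : Type*} {f : G → α}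
    (hN : ∀ n ∈ H, t n = 0 → ∀ x, f (n * x) = f x) (hτ : ∀ x, f (τ⁻¹ * x) = f x) :
    IsLeftInv H f := by
  have h1 : ∀ n : ℕ, ∀ x, f (τ⁻¹ ^ n * x) = f x := fun n => by
    induction n with
    | zero => simp
    | succ n ih => intro x; rw [pow_succ, mul_assoc, ih, hτ]
  have h2 : ∀ z : ℤ, ∀ x, f (τ ^ z * x) = f x := fun z x => by
    obtain ⟨n, rfl | rfl⟩ := z.eq_nat_or_neg
    · rw [zpow_natCast, ← h1 n, ← mul_assoc, inv_pow, inv_mul_cancel, one_mul]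
    · rw [zpow_neg, zpow_natCast, ← inv_pow, h1]
  intro h hh x
  have h3 : h * τ ^ (-t h) ∈ H := H.mul_mem hh (H.zpow_mem ht.mem _)
  have h4 := hN _ h3 (by rw [ht.mul h hh, ht.zpow]; ring) (τ ^ t h * x)
  rw [h2] at h4
  rw [← h4]
  congr 1
  group

end IsCoord

lemma IsSumHarm.hasSum_re_div {f : G → ℂ} (hf : IsSumHarm m f) (β : ℂ) (x : G) :
    HasSum (fun s => m s * (f (x * s) / β).re) (f x / β).re := by
  have h1 := ((hf x).mul_right β⁻¹).mapL Complex.reCLM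
  refine h1.congr_fun fun s => ?_
  rw [Complex.reCLM_apply, Complex.real_smul, mul_assoc, Complex.re_ofReal_mul, div_eq_mul_inv]

/-- There is no harmonic function that is genuinely quadratic along a cyclic direction. -/
lemma IsSumHarm.eq_zero_of_quadratic (hm : IsCourteousWeight ℓ m) (hH : H.FiniteIndex)
    (ht : IsCoord H t τ) {f u : G → ℂ} (hf : IsSumHarm m f) (hu : IsSumHarm m u)
    (hfN : ∀ n ∈ H, t n = 0 → ∀ x, f (n * x) = f x) (huN : ∀ n ∈ H, t n = 0 → ∀ x, u (n * x) = u x)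
    {β : ℂ} (hfτ : ∀ x, f (τ⁻¹ * x) = f x + u x) (huτ : ∀ x, u (τ⁻¹ * x) = u x + β) : β = 0 := by
  by_contra hβ
  set y : G → ℝ := fun x => (u x / β).re with hy
  set F : G → ℝ := fun x => (f x / β).re with hF
  set w : G → ℝ := fun x => F x - (y x ^ 2 - y x) / 2 with hw
  have hyτ : ∀ x, y (τ⁻¹ * x) = y x + 1 := fun x => by
    simp only [hy, huτ, add_div, div_self hβ, Complex.add_re, Complex.one_re]
  have hFτ : ∀ x, F (τ⁻¹ * x) = F x + y x := fun x => by
    simp only [hy, hF, hfτ, add_div, Complex.add_re]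
  have hwinv : IsLeftInv H w := by
    refine ht.isLeftInv (fun n hn h0 x => ?_) fun x => ?_
    · simp only [hw, hy, hF, hfN n hn h0, huN n hn h0]
    · simp only [hw, hyτ, hFτ]
      ring
  have : Finite (G ⧸ H) := Subgroup.finite_quotient_of_finiteIndex
  obtain ⟨q, hq⟩ := Finite.exists_min fun q : G ⧸ H => w (q.out)⁻¹
  have hmin : ∀ x, w q.out⁻¹ ≤ w x := fun x => by
    have h1 := hq (QuotientGroup.mk x⁻¹)
    obtain ⟨h, hh⟩ := QuotientGroup.mk_out_eq_mul H x⁻¹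
    have h2 : (Quotient.out (QuotientGroup.mk x⁻¹ : G ⧸ H))⁻¹ = (h : G)⁻¹ * x := by
      rw [hh]; group
    rwa [h2, hwinv _ (H.inv_mem h.2)] at h1
  set x₀ := q.out⁻¹
  have key : ∀ x, w x = w x₀ ∧ y x = y x₀ := by
    refine hm.eq_of_forall_eq_mul (x := x₀) (P := fun x => w x = w x₀ ∧ y x = y x₀) ?_ ⟨rfl, rfl⟩
    rintro x s hs ⟨hx1, hx2⟩
    have hsum : HasSum (fun s => m s * ((y (x * s) - y x) ^ 2 + 2 * (w (x * s) - w x))) 0 := by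
      have h1 := (hf.hasSum_re_div β x).sub (hm.hasSum.mul_right (F x))
      have h2 := (hu.hasSum_re_div β x).sub (hm.hasSum.mul_right (y x))
      have h3 := (h1.mul_left 2).add (h2.mul_left (1 - 2 * y x))
      have h4 : 2 * ((f x / β).re - 1 * F x) + (1 - 2 * y x) * ((u x / β).re - 1 * y x) = 0 := by
        simp only [hF, hy]
        ring
      rw [h4] at h3
      refine h3.congr_fun fun s => ?_
      simp only [hw, hF, hy]
      ring
    have hnn : ∀ s, 0 ≤ (y (x * s) - y x) ^ 2 + 2 * (w (x * s) - w x) := fun s => by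
      have := hmin (x * s)
      rw [hx1]
      nlinarith [sq_nonneg (y (x * s) - y x)]
    have h5 := congrFun ((hasSum_zero_iff_of_nonneg fun s =>
      mul_nonneg (hm.nonneg s) (hnn s)).1 hsum) s
    have h6 : (y (x * s) - y x) ^ 2 + 2 * (w (x * s) - w x) = 0 := (mul_eq_zero.1 h5).resolve_left hs
    have h7 := hmin (x * s)
    have h8 : (y (x * s) - y x) ^ 2 = 0 := by
      rw [hx1] at h6
      nlinarith [sq_nonneg (y (x * s) - y x)]
    rw [h8] at h6
    have h9 := pow_eq_zero_iff (two_ne_zero) |>.1 h8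
    constructor <;> linarith
  have h1 := hyτ 1
  rw [(key _).2, (key 1).2] at h1
  linarith

lemma IsSumHarm.exists_eq_add_const (hm : IsCourteousWeight ℓ m) (hH : H.FiniteIndex)
    (ht : IsCoord H t τ) {r : ℕ} {f : G → ℂ} (hf : IsSumHarm m f) (hp : f ∈ pol H r)
    (hfN : ∀ n ∈ H, t n = 0 → ∀ x, f (n * x) = f x) : ∃ α, ∀ x, f (τ⁻¹ * x) = f x + α := by
  induction r generalizing f with
  | zero => exact ⟨0, by simp [mem_pol_zero.1 hp]⟩
  | succ r ih =>
    have hu := (hf.leftTr τ).sub hf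
    have huN : ∀ n ∈ H, t n = 0 → ∀ x, (PolyHarm.leftTr G τ f - f) (n * x)
        = (PolyHarm.leftTr G τ f - f) x := fun n hn h0 x => by
      have h1 := hfN (τ⁻¹ * n * τ) (H.mul_mem (H.mul_mem (H.inv_mem ht.mem) hn) ht.mem)
        (by rw [mul_assoc, ht.mul _ (H.inv_mem ht.mem), ht.mul n hn, ht.inv ht.mem, h0]; ring)
        (τ⁻¹ * x)
      have h2 : τ⁻¹ * n * τ * (τ⁻¹ * x) = τ⁻¹ * (n * x) := by group
      rw [h2] at h1
      simp [hfN n hn h0, h1]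
    obtain ⟨β, hβ⟩ := ih hu (mem_pol_succ.1 hp τ ht.mem) huN
    have h0 := hf.eq_zero_of_quadratic hm hH ht hu hfN huN (fun x => by simp) hβ
    have hinv := ht.isLeftInv huN fun x => by rw [hβ, h0, add_zero]
    refine ⟨(PolyHarm.leftTr G τ f - f) 1, fun x => ?_⟩
    rw [hu.eq_of_isLeftInv hm hH hinv 1 x]
    simp

/-- A polynomial harmonic function vanishing on two consecutive levels of `t` in `H` is zero. -/
theorem IsSumHarm.eq_zero_of_vanish (hm : IsCourteousWeight ℓ m) (hH : H.FiniteIndex)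
    (ht : IsCoord H t τ) {r : ℕ} {f : G → ℂ} (hf : IsSumHarm m f) (hp : f ∈ pol H r)
    (h0 : ∀ h ∈ H, t h = 0 ∨ t h = 1 → f h = 0) : f = 0 := by
  induction r generalizing f with
  | zero => exact mem_pol_zero.1 hp
  | succ r ih =>
    have hfN : ∀ n ∈ H, t n = 0 → ∀ x, f (n * x) = f x := fun n hn hn0 x => by
      have h1 := ih ((hf.leftTr n⁻¹).sub hf) (mem_pol_succ.1 hp _ (H.inv_mem hn))
        fun h hh hth => by
          have h2 : t (n * h) = t h := by rw [ht.mul n hn, hn0, zero_add]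
          simp [h0 h hh hth, h0 (n * h) (H.mul_mem hn hh) (by rwa [h2])]
      have h2 := congrFun h1 x
      simpa [sub_eq_zero] using h2
    obtain ⟨α, hα⟩ := hf.exists_eq_add_const hm hH ht hp hfN
    have hf1 := h0 1 H.one_mem (Or.inl ht.one)
    have hα0 : α = 0 := by
      have h2 := hα τ
      rw [inv_mul_cancel, h0 τ ht.mem (Or.inr ht.apply), hf1] at h2
      simpa using h2.symm
    have hinv := ht.isLeftInv hfN fun x => by rw [hα, hα0, add_zero]
    ext x
    rw [hf.eq_of_isLeftInv hm hH hinv x 1, hf1]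
    rfl

/-- A polynomial vanishing on `H` away from two levels of `t` vanishes on `H`. -/
lemma eq_zero_on_of_vanish (ht : IsCoord H t τ) {r : ℕ} {φ : G → ℂ} (hp : φ ∈ pol H r) (z : ℤ)
    (h0 : ∀ h ∈ H, z < t h → φ h = 0) : ∀ h ∈ H, φ h = 0 := by
  induction r generalizing φ with
  | zero => intro h _; rw [mem_pol_zero.1 hp]; rfl
  | succ r ih =>
    have h1 : ∀ h ∈ H, φ (τ * h) = φ h := fun h hh => by
      have h2 := ih (mem_pol_succ.1 hp _ (H.inv_mem ht.mem)) (fun g hg hz => by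
        have h3 : t (τ * g) = 1 + t g := by rw [ht.mul _ ht.mem, ht.apply]
        simp [h0 g hg hz, h0 (τ * g) (H.mul_mem ht.mem hg) (by omega)]) h hh
      simpa [sub_eq_zero] using h2
    have h2 : ∀ n : ℕ, ∀ h ∈ H, φ (τ ^ n * h) = φ h := fun n => by
      induction n with
      | zero => simp
      | succ n ihn =>
        intro h hh
        rw [pow_succ, mul_assoc, ihn _ (H.mul_mem ht.mem hh), h1 h hh]
    intro h hh
    rw [← h2 (z - t h + 1).toNat h hh]
    refine h0 _ (H.mul_mem (H.pow_mem ht.mem _) hh) ?_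
    rw [ht.mul _ (H.pow_mem ht.mem _), ht.pow]
    omega

end Uniqueness

section Laplacian

variable {G : Type*} [Group G] {ℓ : G → ℕ} {C d : ℕ} {m : G → ℝ} {H : Subgroup G} {j : ℕ}

/-- Polynomials whose right differences have smaller degree. -/
def tame (H : Subgroup G) (j : ℕ) : Submodule ℂ (G → ℂ) :=
  pol H j ⊓ ⨅ g, (pol H (j - 1)).comap (rightTr g - LinearMap.id)

lemma mem_tame {f : G → ℂ} :
    f ∈ tame H j ↔ f ∈ pol H j ∧ ∀ g, rightTr g f - f ∈ pol H (j - 1) := by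
  simp [tame, Submodule.mem_iInf]

/-- Averaging over right cosets. -/
def cosetSum (H : Subgroup G) [Fintype (G ⧸ H)] : (G → ℂ) →ₗ[ℂ] (G → ℂ) :=
  ∑ q : G ⧸ H, rightTr (cosetRep H q)

lemma cosetSum_apply [Fintype (G ⧸ H)] (f : G → ℂ) (x : G) :
    cosetSum H f x = ∑ q : G ⧸ H, f (x * cosetRep H q) := by
  simp [cosetSum]

lemma cosetSum_rightTr_sub_mem_pol [H.Normal] [Fintype (G ⧸ H)] {u : G → ℂ} (hu : u ∈ pol H j)
    (s : G) : cosetSum H (rightTr s u) - cosetSum H u ∈ pol H (j - 1) := by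
  let e : G ⧸ H ≃ G ⧸ H := Equiv.mulRight (QuotientGroup.mk s)
  let h : G ⧸ H → G := fun q => (cosetRep H (e q))⁻¹ * (cosetRep H q * s)
  have hh : ∀ q, h q ∈ H := fun q => by
    rw [← QuotientGroup.eq_one_iff]
    simp [h, e, mk_cosetRep]
  have h1 : cosetSum H (rightTr s u) - cosetSum H u
      = ∑ q, rightTr (cosetRep H (e q)) (rightTr (h q) u - u) := by
    ext x
    have h2 : ∑ q : G ⧸ H, u (x * cosetRep H (e q)) = ∑ q : G ⧸ H, u (x * cosetRep H q) :=
      Equiv.sum_comp e fun q => u (x * cosetRep H q)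
    simp only [Pi.sub_apply, cosetSum_apply, Finset.sum_apply, map_sub, rightTr_apply,
      Finset.sum_sub_distrib, h2]
    congr 1
    refine Finset.sum_congr rfl fun q _ => ?_
    congr 1
    simp only [h]
    group
  rw [h1]
  exact Submodule.sum_mem _ fun q _ => rightTr_mem_pol _ (rightTr_sub_mem_pol (hh q) hu)

/-- Polynomials whose coset average has smaller degree. -/
def normKer (H : Subgroup G) [Fintype (G ⧸ H)] (j : ℕ) : Submodule ℂ (G → ℂ) :=
  pol H j ⊓ (pol H (j - 1)).comap (cosetSum H)

lemma mem_normKer [Fintype (G ⧸ H)] {f : G → ℂ} :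
    f ∈ normKer H j ↔ f ∈ pol H j ∧ cosetSum H f ∈ pol H (j - 1) := by
  simp [normKer]

lemma cosetSum_rightTr_sub_add_mem_pol [H.Normal] [Fintype (G ⧸ H)] {f : G → ℂ}
    (hf : f ∈ tame H (j + 1)) (s : G) :
    cosetSum H (rightTr s f - f) + cosetSum H (rightTr s⁻¹ f - f) ∈ pol H (j - 1) := by
  have h1 := cosetSum_rightTr_sub_mem_pol ((mem_tame.1 hf).2 s⁻¹) s
  rw [← Submodule.neg_mem_iff]
  rw [Nat.add_sub_cancel] at h1
  convert h1 using 1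
  rw [← map_add, ← map_neg, ← map_sub]
  congr 1
  ext x
  simp
  ring

/-- The Laplacian of a random walk. -/
def lap (m : G → ℝ) (f : G → ℂ) : G → ℂ := fun x => f x - ∑' s, m s • f (x * s)

/-- Absolute convergence of the averages of a function. -/
def AvgSummable (m : G → ℝ) (f : G → ℂ) : Prop := ∀ x, Summable fun s => m s • f (x * s)

lemma lap_eq_zero_iff {f : G → ℂ} (hf : AvgSummable m f) : lap m f = 0 ↔ IsSumHarm m f := by
  constructor
  · intro h x
    have h1 := congrFun h x
    have h2 := (hf x).hasSum
    rw [lap, Pi.zero_apply, sub_eq_zero] at h1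
    rwa [← h1] at h2
  · intro h
    ext x
    rw [lap, (h x).tsum_eq, sub_self]
    rfl

lemma hasSum_lap (hm : IsCourteousWeight ℓ m) {f : G → ℂ} (hf : AvgSummable m f) (x : G) :
    HasSum (fun s => (m s : ℂ) • (rightTr s f - f) x) (-lap m f x) := by
  have h1 := (hf x).hasSum.sub (hm.hasSum.smul_const (f x))
  have h2 : ∑' s, m s • f (x * s) - (1 : ℝ) • f x = -lap m f x := by
    rw [lap, one_smul]
    ring
  rw [h2] at h1
  refine h1.congr_fun fun s => ?_
  simp [mul_sub]

lemma lap_mem_normKer [H.Normal] [Fintype (G ⧸ H)] (hm : IsCourteousWeight ℓ m) {f : G → ℂ}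
    (hf : f ∈ tame H (j + 1)) (hs : AvgSummable m f) : lap m f ∈ normKer H j := by
  refine mem_normKer.2 ⟨?_, ?_⟩
  · rw [← Submodule.neg_mem_iff]
    exact mem_pol_of_hasSum (F := fun s => (m s : ℂ) • (rightTr s f - f))
      (fun s => Submodule.smul_mem _ _ ((mem_tame.1 hf).2 s)) (hasSum_lap hm hs)
  · have h1 : ∀ x, HasSum (fun s => (m s : ℂ) • cosetSum H (rightTr s f - f) x)
        (-cosetSum H (lap m f) x) := fun x => by
      have h2 := hasSum_sum (s := Finset.univ) fun (q : G ⧸ H) _ =>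
        hasSum_lap hm hs (x * cosetRep H q)
      rw [cosetSum_apply, ← Finset.sum_neg_distrib]
      refine h2.congr_fun fun s => ?_
      rw [cosetSum_apply, Finset.smul_sum]
    have h3 : ∀ x, HasSum (fun s => (m s : ℂ) • cosetSum H (rightTr s⁻¹ f - f) x)
        (-cosetSum H (lap m f) x) := fun x => by
      refine ((Equiv.inv G).hasSum_iff.2 (h1 x)).congr_fun fun s => ?_
      simp [hm.symm]
    have h4 : ((-2 : ℂ) • cosetSum H (lap m f)) ∈ pol H (j - 1) := by
      refine mem_pol_of_hasSum (F := fun s => (m s : ℂ) •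
        (cosetSum H (rightTr s f - f) + cosetSum H (rightTr s⁻¹ f - f)))
        (fun s => Submodule.smul_mem _ _ (cosetSum_rightTr_sub_add_mem_pol hf s)) fun x => ?_
      have h5 := (h1 x).add (h3 x)
      have h6 : -cosetSum H (lap m f) x + -cosetSum H (lap m f) x
          = ((-2 : ℂ) • cosetSum H (lap m f)) x := by
        simp
        ring
      rw [h6] at h5
      refine h5.congr_fun fun s => ?_
      simp [mul_add]
    exact (Submodule.smul_mem_iff _ (by norm_num)).1 h4

end Laplacian

section RightInverse

variable {G : Type*} [Group G] {H : Subgroup G} {t : G → ℤ} {τ : G} {j : ℕ}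

lemma mul_mem_tame [H.Normal] {a e f : G → ℂ} (ha : ∀ h ∈ H, ∀ x, a (h * x) = e h + a x)
    (hf : f ∈ tame H j) : a * f ∈ tame H (j + 1) := by
  obtain ⟨h1, h2⟩ := mem_tame.1 hf
  refine mem_tame.2 ⟨mul_mem_pol_succ ha h1, fun g => ?_⟩
  rw [Nat.add_sub_cancel]
  have h3 : rightTr g (a * f) - a * f
      = (rightTr g a - a) * rightTr g f + a * (rightTr g f - f) := by
    ext x
    simp
    ring
  rw [h3]
  refine Submodule.add_mem _ (mul_mem_pol (fun h hh x => ?_) (rightTr_mem_pol g h1)) ?_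
  · simp only [Pi.sub_apply, rightTr_apply, mul_assoc, ha h hh]
    ring
  · cases j with
    | zero =>
      rw [mem_pol_zero.1 h1, map_zero, sub_zero, mul_zero]
      exact Submodule.zero_mem _
    | succ j => exact mul_mem_pol_succ ha (h2 g)

lemma pol_le_tame : pol H j ≤ tame H (j + 1) := fun _ hf =>
  mem_tame.2 ⟨pol_le_succ H j hf, fun g => Submodule.sub_mem _ (rightTr_mem_pol g hf) hf⟩

open Classical in
/-- The indicator function of the complement of `H`. -/
def offInd (H : Subgroup G) : G → ℂ := fun x => if x ∈ H then 0 else 1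

lemma isLeftInv_offInd : IsLeftInv H (offInd H) := fun h hh x => by
  have h1 : h * x ∈ H ↔ x ∈ H := H.mul_mem_cancel_left hh
  by_cases hx : x ∈ H <;> simp [offInd, h1, hx]

/-- A polynomial vanishing on two levels of `t` with prescribed values off `H` and prescribed
coset sums. -/
def lift (H : Subgroup G) [Fintype (G ⧸ H)] (t : G → ℤ) : (G → ℂ) →ₗ[ℂ] (G → ℂ) :=
  LinearMap.mulLeft ℂ (fun x => (t x : ℂ)) ∘ₗ LinearMap.mulLeft ℂ (fun x => (t x : ℂ) - 1) ∘ₗ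
    LinearMap.funLeft ℂ ℂ (fun x => x * (rep H x)⁻¹) ∘ₗ cosetSum H
  + LinearMap.mulLeft ℂ (offInd H)

lemma lift_apply [Fintype (G ⧸ H)] (g : G → ℂ) (x : G) :
    lift H t g x = t x * ((t x - 1) * cosetSum H g (x * (rep H x)⁻¹)) + offInd H x * g x := rfl

lemma lift_mem_tame [H.Normal] [Fintype (G ⧸ H)] (ht : IsCoord H t τ) {g : G → ℂ}
    (hg : g ∈ normKer H (j + 1)) : lift H t g ∈ tame H (j + 2) := by
  obtain ⟨h1, h2⟩ := mem_normKer.1 hg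
  refine Submodule.add_mem _ ?_ (pol_le_tame (mul_mem_pol isLeftInv_offInd h1))
  have h3 : (fun x => cosetSum H g (x * (rep H x)⁻¹)) ∈ tame H j :=
    mem_tame.2 ⟨comp_mem_pol isLeftInv_rep_inv h2, rightTr_comp_rep_sub_mem h2⟩
  have h4 := mul_mem_tame (a := fun x => (t x : ℂ) - 1) (e := fun x => (t x : ℂ))
    (fun h hh x => by rw [ht.mul h hh]; push_cast; ring) h3
  exact mul_mem_tame (a := fun x => (t x : ℂ)) (e := fun x => (t x : ℂ))
    (fun h hh x => by rw [ht.mul h hh]; push_cast; ring) h4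

lemma lift_eq_zero_of_mem [Fintype (G ⧸ H)] (g : G → ℂ) {h : G} (hh : h ∈ H)
    (h01 : t h = 0 ∨ t h = 1) : lift H t g h = 0 := by
  rw [lift_apply, offInd, if_pos hh]
  rcases h01 with h0 | h0 <;> simp [h0]

lemma eq_zero_of_lift_eq_zero [H.Normal] [Fintype (G ⧸ H)] (ht : IsCoord H t τ) {g : G → ℂ}
    (hg : g ∈ normKer H j) (h0 : lift H t g = 0) : g = 0 := by
  have h1 : ∀ h ∈ H, cosetSum H g h = 0 := by
    refine eq_zero_on_of_vanish ht (mem_normKer.1 hg).2 1 fun h hh hth => ?_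
    have h2 := congrFun h0 h
    rw [lift_apply, offInd, if_pos hh, rep_of_mem hh, inv_one, mul_one, zero_mul, add_zero,
      Pi.zero_apply] at h2
    have h3 : (t h : ℂ) ≠ 0 := by exact_mod_cast (by omega)
    have h4 : (t h : ℂ) - 1 ≠ 0 := by
      rw [sub_ne_zero]
      exact_mod_cast (by omega)
    exact (mul_eq_zero.1 ((mul_eq_zero.1 h2).resolve_left h3)).resolve_left h4
  have h2 : ∀ x ∉ H, g x = 0 := fun x hx => by
    have h3 := congrFun h0 x
    rw [lift_apply, offInd, if_neg hx, h1 _ (mul_rep_inv_mem x)] at h3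
    simpa using h3
  ext x
  by_cases hx : x ∈ H
  · have h3 := h1 x hx
    rw [cosetSum_apply, Finset.sum_eq_single (QuotientGroup.mk 1 : G ⧸ H)] at h3
    · have h4 : cosetRep H (QuotientGroup.mk 1 : G ⧸ H) = 1 := rep_of_mem H.one_mem
      rw [h4, mul_one] at h3
      exact h3
    · intro q _ hq
      refine h2 _ fun h4 => hq ?_
      rw [H.mul_mem_cancel_left hx, ← QuotientGroup.eq_one_iff, mk_cosetRep] at h4
      exact h4
    · simp
  · exact h2 x hx

end RightInverse

section Dimension

variable {G : Type*} [Group G] [Group.FG G] {ℓ : G → ℕ} {C d k : ℕ} {m : G → ℝ} {H : Subgroup G}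
  {t : G → ℤ} {τ : G} {j : ℕ}

theorem finrank_harmSpace_add [H.Normal] [Fintype (G ⧸ H)] (hℓ : IsPolyLength ℓ C d)
    (hgeo : IsGeodesicLength ℓ) (hm : IsCourteousWeight ℓ m) (ht : IsCoord H t τ) {r : ℕ}
    (hpol : harmSpace hℓ hm (j + 1) ≤ pol H r) :
    Module.finrank ℂ (harmSpace hℓ hm (j + 1)) + Module.finrank ℂ (normKer H (j + 1))
      = Module.finrank ℂ (tame H (j + 2)) := by
  have hH : H.FiniteIndex := Subgroup.finiteIndex_of_finite_quotient
  have hgr : ∀ f ∈ tame H (j + 2), HasGrowth ℓ (j + 1) f := fun f hf =>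
    hasGrowth_of_mem_pol hℓ hgeo (mem_tame.1 hf).1
  have hsum : ∀ f ∈ tame H (j + 2), AvgSummable m f := fun f hf => (hgr f hf).summable hℓ hm
  have := finiteDimensional_pol (H := H) (j + 2)
  have := finiteDimensional_pol (H := H) (j + 1)
  have : FiniteDimensional ℂ (tame H (j + 2)) :=
    Submodule.finiteDimensional_of_le (inf_le_left : tame H (j + 2) ≤ pol H (j + 2))
  have : FiniteDimensional ℂ (normKer H (j + 1)) :=
    Submodule.finiteDimensional_of_le (inf_le_left : normKer H (j + 1) ≤ pol H (j + 1))
  obtain ⟨Δ, hΔ⟩ : ∃ Δ : tame H (j + 2) →ₗ[ℂ] normKer H (j + 1),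
      ∀ f, (Δ f : G → ℂ) = lap m f :=
    ⟨{  toFun := fun f => ⟨lap m f, lap_mem_normKer hm f.2 (hsum f f.2)⟩
        map_add' := fun f g => by
          ext x
          have := ((hsum f f.2 x).hasSum.add (hsum g g.2 x).hasSum).tsum_eq
          simp only [lap, Submodule.coe_add, Pi.add_apply, smul_add, this]
          ring
        map_smul' := fun c f => by
          ext x
          have := ((hsum f f.2 x).hasSum.mul_left c).tsum_eq
          simp only [lap, Submodule.coe_smul, Pi.smul_apply, RingHom.id_apply, smul_eq_mul,
            mul_sub, mul_smul_comm] at this ⊢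
          rw [this] }, fun _ => rfl⟩
  obtain ⟨M, hM⟩ : ∃ M : normKer H (j + 1) →ₗ[ℂ] tame H (j + 2),
      ∀ g, (M g : G → ℂ) = lift H t g :=
    ⟨(lift H t).restrict fun g hg => lift_mem_tame ht hg, fun _ => rfl⟩
  have hinj : Function.Injective (Δ ∘ₗ M) := by
    refine (injective_iff_map_eq_zero _).2 fun g hg => Subtype.ext ?_
    have h1 : lap m (lift H t g) = 0 := by
      rw [← hM, ← hΔ]
      exact congrArg Subtype.val hg
    have h2 := lift_mem_tame ht g.2
    have h3 := (lap_eq_zero_iff (hsum _ h2)).1 h1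
    have h4 : ∀ h ∈ H, t h = 0 ∨ t h = 1 → lift H t (g : G → ℂ) h = 0 :=
      fun h hh h01 => lift_eq_zero_of_mem (g : G → ℂ) hh h01
    have h5 : lift H t (g : G → ℂ) = 0 := h3.eq_zero_of_vanish hm hH ht (mem_tame.1 h2).1 h4
    exact eq_zero_of_lift_eq_zero ht g.2 h5
  have hsurj : Function.Surjective Δ :=
    Function.Surjective.of_comp (g := ⇑M) (LinearMap.surjective_of_injective hinj)
  have hker : (LinearMap.ker Δ).map (tame H (j + 2)).subtype = harmSpace hℓ hm (j + 1) := by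
    ext f
    rw [mem_harmSpace]
    constructor
    · rintro ⟨f, hf, rfl⟩
      have h1 : lap m f = 0 := by
        rw [← hΔ]
        exact congrArg Subtype.val hf
      exact ⟨hgr f f.2, ((lap_eq_zero_iff (hsum f f.2)).1 h1).isHarm⟩
    · rintro ⟨h1, h2⟩
      have h3 : f ∈ pol H (j + 2) :=
        mem_pol_succ_of_hasGrowth hℓ (hpol ((mem_harmSpace hℓ hm).2 ⟨h1, h2⟩)) h1
      have h4 : IsSumHarm m f := fun x => by
        rw [h2 x]
        exact (h1.summable hℓ hm x).hasSum
      have h5 : f ∈ tame H (j + 2) := mem_tame.2 ⟨h3, h4.rightTr_sub_mem_pol hm hH h3⟩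
      exact ⟨⟨f, h5⟩, Subtype.ext ((hΔ _).trans ((lap_eq_zero_iff (hsum f h5)).2 h4)), rfl⟩
  rw [← hker, Submodule.finrank_map_subtype_eq, ← LinearMap.finrank_range_add_finrank_ker Δ,
    LinearMap.range_eq_top.2 hsurj, finrank_top, add_comm]

end Dimension

section Characters

variable {G : Type*} [Group G] {ℓ : G → ℕ} {C d k j : ℕ} {m m' : G → ℝ} {H : Subgroup G}

lemma exists_isCoord [Group.FG G] [H.Normal] [H.FiniteIndex] {φ : H →* Multiplicative ℂ}
    (hφ : φ ≠ 1) : ∃ t τ, IsCoord H t τ := by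
  let ψ : Additive H →+ ℂ := MonoidHom.toAdditiveLeft φ
  have hHfg : Group.FG H := Subgroup.fg_of_index_ne_zero H
  have : AddGroup.FG ψ.range := AddGroup.fg_range ψ
  have : Module.Finite ℤ ψ.range := Module.Finite.iff_addGroup_fg.2 inferInstance
  have : Module.Free ℤ ψ.range := inferInstance
  let b := Module.Free.chooseBasis ℤ ψ.range
  have hne : ∃ h : H, ψ (Additive.ofMul h) ≠ 0 := by
    by_contra! h
    exact hφ (MonoidHom.ext fun g => h g)
  obtain ⟨h₀, hh₀⟩ := hne
  have : Nonempty (Module.Free.ChooseBasisIndex ℤ ψ.range) := by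
    by_contra hempty
    rw [not_nonempty_iff] at hempty
    have := b.ext_elem (x := ψ.rangeRestrict (Additive.ofMul h₀)) (y := 0)
      fun i => hempty.elim i
    exact hh₀ (congrArg Subtype.val this)
  obtain ⟨i⟩ := this
  let c : Additive H →+ ℤ := (b.coord i).toAddMonoidHom.comp ψ.rangeRestrict
  obtain ⟨a, ha⟩ := ψ.rangeRestrict_surjective (b i)
  have hc : c a = 1 := by simp [c, ha]
  let t : G → ℤ := fun x => c (Additive.ofMul ⟨x * (rep H x)⁻¹, mul_rep_inv_mem x⟩)
  have ht : ∀ h : H, t h = c (Additive.ofMul h) := fun h => by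
    simp only [t, rep_of_mem h.2, inv_one, mul_one]
  refine ⟨t, (a.toMul : G), fun h hh x => ?_, (a.toMul).2, by rw [ht]; exact hc⟩
  have h1 := ht ⟨h, hh⟩
  rw [h1, ← map_add]
  simp only [t]
  congr 1
  rw [← ofMul_mul]
  congr 1
  ext
  simp [isLeftInv_rep h hh, mul_assoc]

lemma pol_two_le_of_forall_eq_one (hφ : ∀ φ : H →* Multiplicative ℂ, φ = 1) : pol H 2 ≤ pol H 1 := by
  intro f hf
  have h1 : ∀ g ∈ H, IsLeftInv H fun x => f (g * x) - f x := fun g hg => by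
    have := mem_pol_one.1 (mem_pol_succ.1 hf g⁻¹ (H.inv_mem hg))
    intro h hh x
    simpa using this h hh x
  refine mem_pol_one.2 fun h hh x => ?_
  let φ : H →* Multiplicative ℂ :=
    { toFun := fun g => Multiplicative.ofAdd (f (g * x) - f x)
      map_one' := by simp
      map_mul' := fun g g' => by
        rw [← ofAdd_add]
        congr 1
        have := h1 g g.2 g' g'.2 x
        simp only at this
        rw [← this, Subgroup.coe_mul, mul_assoc]
        ring }
  have h2 := congrArg Multiplicative.toAdd (DFunLike.congr_fun (hφ φ) ⟨h, hh⟩)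
  exact sub_eq_zero.1 h2

lemma pol_le_pol_one (hφ : ∀ φ : H →* Multiplicative ℂ, φ = 1) (r : ℕ) : pol H r ≤ pol H 1 := by
  induction r with
  | zero => exact pol_mono H zero_le_one
  | succ r ih =>
    exact fun f hf => pol_two_le_of_forall_eq_one hφ
      (mem_pol_succ.2 fun h hh => ih (mem_pol_succ.1 hf h hh))

end Characters

section Comparison

variable {G : Type*} [Group G] {ℓ : G → ℕ} {C d k j : ℕ} {m m' : G → ℝ}

lemma leftTr_mem_harmSpace (hℓ : IsPolyLength ℓ C d) (hm : IsCourteousWeight ℓ m) {f : G → ℂ}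
    (hf : f ∈ harmSpace hℓ hm k) (g : G) : leftTr G g f ∈ harmSpace hℓ hm k := by
  obtain ⟨h1, h2⟩ := (mem_harmSpace hℓ hm).1 hf
  refine (mem_harmSpace hℓ hm).2 ⟨?_, fun x => ?_⟩
  · exact h1.mul_left hℓ g⁻¹
  · simpa [mul_assoc] using h2 (g⁻¹ * x)

lemma exists_harmSpace_le_pol [Group.FG G] (hℓ : IsPolyLength ℓ C d) (hgeo : IsGeodesicLength ℓ)
    (hm : IsCourteousWeight ℓ m) (k : ℕ) :
    ∃ H : Subgroup G, H.FiniteIndex ∧ ∃ r, harmSpace hℓ hm k ≤ pol H r := by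
  have := finiteDimensional_harmSpace hℓ hgeo hm k
  obtain ⟨H, hH, -, r, hr⟩ := exists_le_pol hℓ hm _ (harmSpace hℓ hm k) le_rfl le_rfl ⊤
    inferInstance fun h _ f hf => leftTr_mem_harmSpace hℓ hm hf h
  exact ⟨H, hH, r, hr⟩

lemma harmSpace_le_of_pol_one [Group.FG G] {H : Subgroup G} (hH : H.FiniteIndex)
    (hℓ : IsPolyLength ℓ C d)
    (hm : IsCourteousWeight ℓ m) (hm' : IsCourteousWeight ℓ m')
    (hp : harmSpace hℓ hm k ≤ pol H 1) : harmSpace hℓ hm k ≤ harmSpace hℓ hm' k := by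
  intro f hf
  obtain ⟨h1, h2⟩ := (mem_harmSpace hℓ hm).1 hf
  refine (mem_harmSpace hℓ hm').2 ⟨h1, ?_⟩
  have h3 : IsSumHarm m f := fun x => by
    rw [h2 x]
    exact (h1.summable hℓ hm x).hasSum
  have h4 := h3.eq_of_isLeftInv hm hH (mem_pol_one.1 (hp hf))
  have h5 : IsSumHarm m' f := fun x => by
    have := hm'.hasSum.smul_const (f x)
    rw [one_smul] at this
    exact this.congr_fun fun s => by rw [h4 (x * s) x]
  exact h5.isHarm

theorem finrank_harmSpace_eq [Group.FG G] (hℓ : IsPolyLength ℓ C d) (hgeo : IsGeodesicLength ℓ)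
    (hm : IsCourteousWeight ℓ m) (hm' : IsCourteousWeight ℓ m') (j : ℕ) :
    Module.finrank ℂ (harmSpace hℓ hm (j + 1)) = Module.finrank ℂ (harmSpace hℓ hm' (j + 1)) := by
  obtain ⟨H₁, hH₁, r₁, hr₁⟩ := exists_harmSpace_le_pol hℓ hgeo hm (j + 1)
  obtain ⟨H₂, hH₂, r₂, hr₂⟩ := exists_harmSpace_le_pol hℓ hgeo hm' (j + 1)
  let H := (H₁ ⊓ H₂).normalCore
  have hH : H.FiniteIndex := Subgroup.finiteIndex_normalCore _
  have hHn : H.Normal := Subgroup.normalCore_normal _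
  have hle : H ≤ H₁ ⊓ H₂ := Subgroup.normalCore_le _
  have h1 := hr₁.trans (pol_anti (hle.trans inf_le_left) r₁)
  have h2 := hr₂.trans (pol_anti (hle.trans inf_le_right) r₂)
  by_cases hφ : ∀ φ : H →* Multiplicative ℂ, φ = 1
  · have h3 := h1.trans (pol_le_pol_one hφ r₁)
    have h4 := h2.trans (pol_le_pol_one hφ r₂)
    rw [le_antisymm (harmSpace_le_of_pol_one hH hℓ hm hm' h3)
      (harmSpace_le_of_pol_one hH hℓ hm' hm h4)]
  · push Not at hφ
    obtain ⟨φ, hφ⟩ := hφ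
    obtain ⟨t, τ, ht⟩ := exists_isCoord hφ
    have : Fintype (G ⧸ H) := Fintype.ofFinite _
    have h3 := finrank_harmSpace_add hℓ hgeo hm ht h1
    have h4 := finrank_harmSpace_add hℓ hgeo hm' ht h2
    omega

end Comparison

section WordLength

variable {G : Type*} [Group G] {S : Finset G}

lemma mem_pow_iff_wordNorm_le (hSone : (1 : G) ∈ S) (hSgen : ∀ x : G, ∃ n : ℕ, x ∈ (S : Set G) ^ n)
    {x : G} {n : ℕ} : x ∈ (S : Set G) ^ n ↔ wordNorm (S : Set G) x ≤ n := by
  constructor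
  · exact fun h => Nat.sInf_le h
  · intro h
    have h1 : x ∈ (S : Set G) ^ wordNorm (S : Set G) x := Nat.sInf_mem (hSgen x)
    exact Set.pow_subset_pow_right (by simpa using hSone) h h1

lemma isGeodesicLength_wordNorm (hSone : (1 : G) ∈ S)
    (hSgen : ∀ x : G, ∃ n : ℕ, x ∈ (S : Set G) ^ n) : IsGeodesicLength (wordNorm (S : Set G)) := by
  intro x n hx
  rw [← mem_pow_iff_wordNorm_le hSone hSgen, pow_succ] at hx
  obtain ⟨y, hy, s, hs, rfl⟩ := hx
  refine ⟨y, s, (mem_pow_iff_wordNorm_le hSone hSgen).1 hy,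
    (mem_pow_iff_wordNorm_le hSone hSgen).1 ?_, rfl⟩
  rwa [pow_one]

lemma exists_isPolyLength_wordNorm (hSsymm : (S : Set G)⁻¹ = (S : Set G)) (hSone : (1 : G) ∈ S)
    (hSgen : ∀ x : G, ∃ n : ℕ, x ∈ (S : Set G) ^ n)
    (hgrowth : ∃ c > 0, ∃ d > 0, ∀ n : ℕ, 1 ≤ n →
      (Nat.card (((S : Set G) ^ n : Set G) : Type _) : ℝ) ≤ c * (n : ℝ) ^ d) :
    ∃ C d, IsPolyLength (wordNorm (S : Set G)) C d := by
  obtain ⟨c, hc, d, hd, hcd⟩ := hgrowth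
  have hball : ∀ n, {x | wordNorm (S : Set G) x ≤ n} = (S : Set G) ^ n := fun n => by
    ext x
    exact (mem_pow_iff_wordNorm_le hSone hSgen).symm
  have hfin : ∀ n, ((S : Set G) ^ n).Finite := fun n => by
    induction n with
    | zero => simp
    | succ n ih => rw [pow_succ]; exact ih.mul S.finite_toSet
  have hinv : ∀ x, wordNorm (S : Set G) x⁻¹ ≤ wordNorm (S : Set G) x := fun x => by
    have h1 : x⁻¹ ∈ ((S : Set G) ^ wordNorm (S : Set G) x)⁻¹ :=
      Set.inv_mem_inv.2 ((mem_pow_iff_wordNorm_le hSone hSgen).2 le_rfl)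
    rw [← inv_pow, hSsymm] at h1
    exact (mem_pow_iff_wordNorm_le hSone hSgen).1 h1
  refine ⟨⌈c⌉₊, d, ⟨?_, fun x y => ?_, fun x => ?_, fun n => ?_, fun n => ?_⟩⟩
  · rw [← Nat.le_zero, ← mem_pow_iff_wordNorm_le hSone hSgen]
    simp
  · rw [← mem_pow_iff_wordNorm_le hSone hSgen, pow_add]
    exact Set.mul_mem_mul ((mem_pow_iff_wordNorm_le hSone hSgen).2 le_rfl)
      ((mem_pow_iff_wordNorm_le hSone hSgen).2 le_rfl)
  · refine le_antisymm (hinv x) ?_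
    have := hinv x⁻¹
    rwa [inv_inv] at this
  · rw [hball]
    exact hfin n
  · rw [hball]
    have h1 : ((S : Set G) ^ n).ncard ≤ ((S : Set G) ^ (n + 1)).ncard :=
      Set.ncard_le_ncard (Set.pow_subset_pow_right (by simpa using hSone) n.le_succ)
        (hfin _)
    refine h1.trans ?_
    have h2 := hcd (n + 1) (by omega)
    rw [Nat.card_coe_set_eq] at h2
    have h3 : c * ((n + 1 : ℕ) : ℝ) ^ d ≤ (⌈c⌉₊ * (n + 1) ^ d : ℕ) := by
      push_cast
      gcongr
      exact Nat.le_ceil c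
    exact_mod_cast h2.trans h3

lemma fg_of_forall_mem_pow (hSgen : ∀ x : G, ∃ n : ℕ, x ∈ (S : Set G) ^ n) : Group.FG G := by
  refine ⟨⟨S, ?_⟩⟩
  rw [eq_top_iff]
  intro x _
  obtain ⟨n, hn⟩ := hSgen x
  have h1 : ∀ n : ℕ, (S : Set G) ^ n ⊆ Subgroup.closure (S : Set G) := fun n => by
    induction n with
    | zero => simp
    | succ n ih =>
      rw [pow_succ]
      rintro _ ⟨y, hy, s, hs, rfl⟩
      exact Subgroup.mul_mem _ (ih hy) (Subgroup.subset_closure hs)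
  exact h1 n hn

lemma isCourteousWeight_of_isCourteousPMF {p : PMF G} (hp : IsCourteousPMF (S : Set G) p) :
    IsCourteousWeight (wordNorm (S : Set G)) fun x => (p x).toReal := by
  refine ⟨fun x => ENNReal.toReal_nonneg, ?_, fun x => by rw [hp.symm], ?_, ?_⟩
  · have h1 := (ENNReal.summable_toReal p.tsum_coe_ne_top).hasSum
    rwa [← ENNReal.tsum_toReal_eq p.apply_ne_top, p.tsum_coe, ENNReal.toReal_one] at h1
  · rw [← hp.adapted]
    congr 1
    ext x
    simp [ENNReal.toReal_eq_zero_iff, p.apply_ne_top]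
  · obtain ⟨c, hc, htail⟩ := hp.tail
    refine ⟨1, one_pos, c / 2, by positivity, fun x => ?_⟩
    rw [one_mul]
    rcases Nat.eq_zero_or_pos (wordNorm (S : Set G) x) with h0 | h0
    · rw [h0]
      simpa using ENNReal.toReal_mono ENNReal.one_ne_top (p.coe_le_one x)
    · have h1 : (0 : ℝ) < wordNorm (S : Set G) x := by exact_mod_cast h0
      have h2 := htail ((wordNorm (S : Set G) x : ℝ) / 2) (by positivity)
      have h3 := (ENNReal.le_tsum (f := fun y : {y : G //
        (wordNorm (S : Set G) x : ℝ) / 2 < (wordNorm (S : Set G) y : ℝ)} => p y)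
        ⟨x, by linarith⟩).trans h2
      refine (ENNReal.toReal_le_of_le_ofReal (Real.exp_pos _).le h3).trans (le_of_eq ?_)
      congr 1
      ring

lemma span_HFd_eq {C d : ℕ} (hℓ : IsPolyLength (wordNorm (S : Set G)) C d) {p : PMF G}
    (hp : IsCourteousWeight (wordNorm (S : Set G)) fun x => (p x).toReal) (k : ℕ) :
    Submodule.span ℂ (HFd (S : Set G) p k) = harmSpace hℓ hp k := by
  have h1 : HFd (S : Set G) p k = harmSpace hℓ hp k := by
    ext f
    exact and_comm
  rw [h1, Submodule.span_eq]

end WordLength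

end PolyHarm

/-- On a finitely generated group of polynomial growth, `HF_k(G,μ)` is finite dimensional
for every `k ≥ 1` and every courteous `μ`, and moreover its dimension does not depend on the
choice of courteous measure. -/
theorem stmt3 {G : Type*} [Group G] (S : Finset G)
    (hSsymm : (S : Set G)⁻¹ = (S : Set G)) (hSone : (1 : G) ∈ S)
    (hSgen : ∀ x : G, ∃ n : ℕ, x ∈ (S : Set G) ^ n)
    (hgrowth : ∃ c > 0, ∃ d > 0, ∀ n : ℕ, 1 ≤ n →
      (Nat.card (((S : Set G) ^ n : Set G) : Type _) : ℝ) ≤ c * (n : ℝ) ^ d)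
    (k : ℕ) (hk : 1 ≤ k)
    (p q : PMF G) (hp : IsCourteousPMF (S : Set G) p) (hq : IsCourteousPMF (S : Set G) q) :
    FiniteDimensional ℂ (Submodule.span ℂ (HFd (S : Set G) p k)) ∧
    Module.finrank ℂ (Submodule.span ℂ (HFd (S : Set G) p k)) =
      Module.finrank ℂ (Submodule.span ℂ (HFd (S : Set G) q k)) := by
  have hFG := PolyHarm.fg_of_forall_mem_pow hSgen
  obtain ⟨C, d, hℓ⟩ := PolyHarm.exists_isPolyLength_wordNorm hSsymm hSone hSgen hgrowth
  have hgeo := PolyHarm.isGeodesicLength_wordNorm hSone hSgen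
  have hp' := PolyHarm.isCourteousWeight_of_isCourteousPMF hp
  have hq' := PolyHarm.isCourteousWeight_of_isCourteousPMF hq
  rw [PolyHarm.span_HFd_eq hℓ hp' k, PolyHarm.span_HFd_eq hℓ hq' k]
  obtain ⟨j, rfl⟩ : ∃ j, k = j + 1 := ⟨k - 1, by omega⟩
  exact ⟨PolyHarm.finiteDimensional_harmSpace hℓ hgeo hp' _,
    PolyHarm.finrank_harmSpace_eq hℓ hgeo hp' hq' j⟩
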